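/- arXiv:math/0210136 — 3 statements merged into one kernel-verified Lean document; each statement's English description precedes it below -/
import Mathlib

section
/- For every Schwartz function ψ on ℝ², the iterated limit D(ψ) := lim_{ε→0⁺} lim_{δ→0⁺} I(ψ; ε, δ) exists, as does D(ψ̃), and D(ψ) + D(ψ̃) = π² · ψ(0,0). -/
/- STATEMENT 2: the iterated principal-value limits D(ψ) and D(ψ̃) exist for Schwartz ψ,
and D(ψ) + D(ψ̃) = π² ψ(0,0). -/

open MeasureTheory Filter

noncomputable section

/-- `I(ψ; ε, δ)`: the truncated principal-value integral. -/
def Ipv (ψ : ℝ × ℝ → ℝ) (ε δ : ℝ) : ℝ :=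
  ∫ s₂ in {s₂ : ℝ | ε < |s₂|},
    (2 * s₂)⁻¹ *
      ((∫ s₁ in {s₁ : ℝ | δ < |s₂ + s₁|}, ψ (s₁, s₂) / (s₂ + s₁)) +
       (∫ s₁ in {s₁ : ℝ | δ < |s₂ - s₁|}, ψ (s₁, s₂) / (s₂ - s₁)))

/-- `IterLim F L` expresses that `lim_{ε→0⁺} lim_{δ→0⁺} F ε δ = L`, i.e. for each `ε > 0`
the inner limit exists, and the resulting function of `ε` tends to `L` as `ε → 0⁺`. -/
def IterLim (F : ℝ → ℝ → ℝ) (L : ℝ) : Prop :=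
  ∃ g : ℝ → ℝ,
    (∀ ε > 0, Tendsto (fun δ => F ε δ) (nhdsWithin 0 (Set.Ioi 0)) (nhds (g ε))) ∧
    Tendsto g (nhdsWithin 0 (Set.Ioi 0)) (nhds L)

/-- Lebesgue measure on the open half-line `(0, ∞)`. -/
abbrev posVol : Measure ℝ := volume.restrict (Set.Ioi 0)

lemma ae_posVol : ∀ᵐ x ∂posVol, 0 < x :=
  ae_restrict_mem measurableSet_Ioi

lemma ae_posVol_prod : ∀ᵐ p ∂(posVol.prod posVol), 0 < p.1 ∧ 0 < p.2 := by
  rw [posVol, Measure.prod_restrict]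
  exact ae_restrict_mem (measurableSet_Ioi.prod measurableSet_Ioi)

lemma integrable_fold {h : ℝ → ℝ} (hh : Integrable h) :
    IntegrableOn (fun x => h x + h (-x)) (Set.Ioi 0) :=
  (hh.add hh.comp_neg).integrableOn

lemma integral_fold {h : ℝ → ℝ} (hh : Integrable h) :
    ∫ x, h x = ∫ x in Set.Ioi 0, (h x + h (-x)) := by
  rw [integral_add hh.integrableOn hh.comp_neg.integrableOn, integral_comp_neg_Ioi, neg_zero,
    add_comm, intervalIntegral.integral_Iic_add_Ioi hh.integrableOn hh.integrableOn]

lemma measurableSet_lt_abs (a : ℝ) : MeasurableSet {x : ℝ | a < |x|} :=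
  measurableSet_lt measurable_const continuous_abs.measurable

lemma setIntegral_fold {h : ℝ → ℝ} {a : ℝ} (ha : 0 < a)
    (hh : IntegrableOn h {x : ℝ | a < |x|}) :
    ∫ x in {x : ℝ | a < |x|}, h x = ∫ x in Set.Ioi a, (h x + h (-x)) := by
  rw [← integral_indicator (measurableSet_lt_abs a),
    integral_fold ((integrable_indicator_iff (measurableSet_lt_abs a)).2 hh),
    ← integral_indicator measurableSet_Ioi, ← integral_indicator measurableSet_Ioi]
  congr 1
  ext x
  by_cases hx : 0 < x
  · by_cases hxa : a < x <;> simp [Set.indicator, hx, hxa, abs_of_pos hx]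
  · have : ¬ a < x := fun h => hx (ha.trans h)
    simp [Set.indicator, hx, this]

lemma setIntegral_comp_add_abs (k : ℝ → ℝ) (s δ : ℝ) :
    ∫ x in {x : ℝ | δ < |s + x|}, k (s + x) = ∫ u in {u : ℝ | δ < |u|}, k u := by
  rw [← integral_indicator (measurableSet_lt_abs δ),
    ← integral_add_left_eq_self (Set.indicator _ k) s, ← integral_indicator]
  · rfl
  · exact (measurableSet_lt_abs δ).preimage (measurable_const_add s)

lemma setIntegral_comp_sub_abs (k : ℝ → ℝ) (s δ : ℝ) :
    ∫ x in {x : ℝ | δ < |s - x|}, k (s - x) = ∫ u in {u : ℝ | δ < |u|}, k u := by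
  rw [← integral_indicator (measurableSet_lt_abs δ),
    ← integral_sub_left_eq_self (Set.indicator _ k) _ s, ← integral_indicator]
  · rfl
  · exact (measurableSet_lt_abs δ).preimage (measurable_const_sub s)

lemma tendsto_setIntegral_Ioi_zero {f : ℝ → ℝ} (hf : Integrable f posVol) :
    Tendsto (fun δ => ∫ x in Set.Ioi δ, f x) (nhdsWithin 0 (Set.Ioi 0))
      (nhds (∫ x in Set.Ioi 0, f x)) := by
  have key : Tendsto (fun δ : ℝ => ∫ x in Set.Ioi 0, (Set.Ioi δ).indicator f x)
      (nhdsWithin 0 (Set.Ioi 0)) (nhds (∫ x in Set.Ioi 0, f x)) := by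
    refine tendsto_integral_filter_of_dominated_convergence (fun x => ‖f x‖) ?_ ?_ hf.norm ?_
    · exact .of_forall fun δ => hf.aestronglyMeasurable.indicator measurableSet_Ioi
    · exact .of_forall fun δ => .of_forall fun x => norm_indicator_le_norm_self _ _
    · filter_upwards [ae_posVol] with x hx
      refine tendsto_const_nhds.congr' ?_
      filter_upwards [mem_nhdsWithin_of_mem_nhds (Iio_mem_nhds hx)] with δ hδ
      rw [Set.indicator_of_mem (by exact hδ)]
  refine key.congr' ?_
  filter_upwards [self_mem_nhdsWithin] with δ hδ
  rw [integral_indicator measurableSet_Ioi, Measure.restrict_restrict measurableSet_Ioi,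
    Set.inter_eq_left.2 (Set.Ioi_subset_Ioi (le_of_lt hδ))]

lemma iterLim_setIntegral_Ioi {F : ℝ × ℝ → ℝ} (hF : Integrable F (posVol.prod posVol))
    {J : ℝ → ℝ → ℝ}
    (hJ : ∀ ε > 0, ∀ δ > 0, J ε δ = ∫ y in Set.Ioi ε, ∫ u in Set.Ioi δ, F (y, u)) :
    IterLim J (∫ y in Set.Ioi 0, ∫ u in Set.Ioi 0, F (y, u)) := by
  have hsub : ∀ ε > (0 : ℝ), volume.restrict (Set.Ioi ε) ≤ posVol := fun ε hε =>
    Measure.restrict_mono (Set.Ioi_subset_Ioi (le_of_lt hε)) le_rfl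
  refine ⟨fun ε => ∫ y in Set.Ioi ε, ∫ u in Set.Ioi 0, F (y, u), fun ε hε => ?_,
    tendsto_setIntegral_Ioi_zero hF.integral_prod_left⟩
  have h1 : Integrable F ((volume.restrict (Set.Ioi ε)).prod posVol) :=
    hF.mono_measure (Measure.prod_mono (hsub ε hε) le_rfl)
  beta_reduce
  rw [integral_integral_swap (f := fun y u => F (y, u)) h1]
  refine (tendsto_setIntegral_Ioi_zero h1.integral_prod_right).congr' ?_
  filter_upwards [self_mem_nhdsWithin] with δ hδ
  rw [hJ ε hε δ hδ, integral_integral_swap (f := fun y u => F (y, u))]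
  exact hF.mono_measure (Measure.prod_mono (hsub ε hε) (hsub δ hδ))

/-- The weight `1 / (√x (1 + x))`, integrable on the half-line. -/
def sqrtWeight (x : ℝ) : ℝ := (√x * (1 + x))⁻¹

lemma integrable_sqrtWeight : Integrable sqrtWeight posVol := by
  refine integrableOn_Ioi_deriv_of_nonneg (g := fun x => 2 * Real.arctan (√x))
    (l := 2 * (Real.pi / 2)) ?_ ?_ ?_ ?_
  · exact (continuous_const.mul
      (Real.continuous_arctan.comp Real.continuous_sqrt)).continuousWithinAt
  · intro x (hx : 0 < x)
    have h := (((Real.hasDerivAt_sqrt hx.ne').arctan).const_mul 2)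
    refine h.congr_deriv ?_
    have := Real.sqrt_pos.2 hx
    unfold sqrtWeight
    rw [Real.sq_sqrt hx.le]
    field_simp
  · intro x (hx : 0 < x)
    unfold sqrtWeight; positivity
  · exact ((Real.tendsto_arctan_atTop.mono_right nhdsWithin_le_nhds).comp
      Real.tendsto_sqrt_atTop).const_mul 2

lemma integrable_of_le_sqrtWeight {F : ℝ × ℝ → ℝ} (hF : Measurable F) {C : ℝ}
    (h : ∀ x y, 0 < x → 0 < y → |F (x, y)| * (√x * √y * (1 + x) * (1 + y)) ≤ C) :
    Integrable F (posVol.prod posVol) := by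
  refine ((integrable_sqrtWeight.mul_prod integrable_sqrtWeight).const_mul C).mono'
    hF.aestronglyMeasurable ?_
  filter_upwards [ae_posVol_prod] with p hp
  obtain ⟨x, y⟩ := p
  obtain ⟨hx, hy⟩ : 0 < x ∧ 0 < y := hp
  have h1 := Real.sqrt_pos.2 hx
  have h2 := Real.sqrt_pos.2 hy
  rw [sqrtWeight, sqrtWeight, ← mul_inv, ← div_eq_mul_inv, le_div_iff₀ (by positivity)]
  refine le_trans (le_of_eq ?_) (h x y hx hy)
  rw [Real.norm_eq_abs]
  ring

lemma sqrt_mul_sqrt_le_max {x y : ℝ} (hx : 0 < x) (hy : 0 < y) : √x * √y ≤ max x y := by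
  have h1 : √x ≤ √(max x y) := Real.sqrt_le_sqrt (le_max_left _ _)
  have h2 : √y ≤ √(max x y) := Real.sqrt_le_sqrt (le_max_right _ _)
  calc √x * √y ≤ √(max x y) * √(max x y) := by gcongr
    _ = max x y := Real.mul_self_sqrt (hx.le.trans (le_max_left _ _))

/-- The scale-invariant integral `∬ (g x - g y) / (y² - x²)` over the quadrant vanishes when
`g x / x` is integrable. -/
lemma integral_diff_div_eq_zero {g : ℝ → ℝ} (hgm : Measurable g)
    (hg : IntegrableOn (fun x => g x / x) (Set.Ioi 0))
    (hW : Integrable (fun p : ℝ × ℝ => (g p.1 - g p.2) / (p.2 ^ 2 - p.1 ^ 2))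
      (posVol.prod posVol)) :
    ∫ p, (g p.1 - g p.2) / (p.2 ^ 2 - p.1 ^ 2) ∂(posVol.prod posVol) = 0 := by
  set W : ℝ × ℝ → ℝ := fun p => (g p.1 - g p.2) / (p.2 ^ 2 - p.1 ^ 2) with hWdef
  have hVm : Measurable (fun p : ℝ × ℝ => p.1 * W (p.1, p.1 * p.2)) := by
    simp only [hWdef]; fun_prop
  have hscale : ∀ x > (0 : ℝ), ∀ k : ℝ → ℝ,
      ∫ t in Set.Ioi 0, x * k (x * t) = ∫ y in Set.Ioi 0, k y := by
    intro x hx k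
    rw [integral_const_mul, integral_comp_mul_left_Ioi _ _ hx, mul_zero, smul_eq_mul,
      mul_inv_cancel_left₀ hx.ne']
  have hV : Integrable (fun p : ℝ × ℝ => p.1 * W (p.1, p.1 * p.2)) (posVol.prod posVol) := by
    rw [integrable_prod_iff hVm.aestronglyMeasurable]
    constructor
    · filter_upwards [hW.prod_right_ae, ae_posVol] with x hx hx0
      refine Integrable.const_mul ?_ x
      have := (integrableOn_Ioi_comp_mul_left_iff (fun y => W (x, y)) 0 hx0).2
        (by rwa [mul_zero])
      exact this
    · refine hW.norm.integral_prod_left.congr ?_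
      filter_upwards [ae_posVol] with x hx0
      rw [← hscale x hx0 (fun y => ‖W (x, y)‖)]
      simp [abs_of_pos hx0]
  rw [integral_prod _ hW]
  have h1 : ∫ x, ∫ y, W (x, y) ∂posVol ∂posVol
      = ∫ x, ∫ t, x * W (x, x * t) ∂posVol ∂posVol := by
    refine integral_congr_ae ?_
    filter_upwards [ae_posVol] with x hx0
    rw [← hscale x hx0 (fun y => W (x, y))]
  rw [h1, integral_integral_swap (f := fun x t => x * W (x, x * t)) hV]
  refine integral_eq_zero_of_ae ?_
  filter_upwards [ae_posVol] with t ht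
  have hgt : IntegrableOn (fun x => t * (g (t * x) / (t * x))) (Set.Ioi 0) :=
    ((integrableOn_Ioi_comp_mul_left_iff (fun y => g y / y) 0 ht).2
      (by rwa [mul_zero])).const_mul t
  have h2 : ∫ x, x * W (x, x * t) ∂posVol
      = ∫ x, (t ^ 2 - 1)⁻¹ * (g x / x - t * (g (t * x) / (t * x))) ∂posVol := by
    refine integral_congr_ae ?_
    filter_upwards [ae_posVol] with x hx0
    simp only [hWdef]
    rw [show (x * t) ^ 2 - x ^ 2 = x ^ 2 * (t ^ 2 - 1) by ring, mul_comm t x, div_eq_mul_inv,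
      mul_inv]
    generalize (t ^ 2 - 1)⁻¹ = c
    field_simp
  rw [h2, integral_const_mul, integral_sub hg hgt, hscale t ht (fun y => g y / y)]
  simp

lemma setIntegral_Ico_inv {y : ℝ} (hy : 0 < y) :
    ∫ u in Set.Ico y (3 * y), u⁻¹ = Real.log 3 := by
  rw [integral_Ico_eq_integral_Ioc, ← intervalIntegral.integral_of_le (by linarith),
    integral_inv_of_pos hy (by linarith), mul_div_assoc, div_self hy.ne', mul_one]

lemma tail_kernel {y : ℝ} (hy : 0 < y) :
    IntegrableOn (fun x => 2 * y / (x ^ 2 - y ^ 2)) (Set.Ioi (2 * y)) ∧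
      ∫ x in Set.Ioi (2 * y), 2 * y / (x ^ 2 - y ^ 2) = Real.log 3 := by
  have hd : ∀ x ∈ Set.Ici (2 * y), HasDerivAt (fun x => Real.log ((x - y) / (x + y)))
      (2 * y / (x ^ 2 - y ^ 2)) x := by
    intro x (hx : 2 * y ≤ x)
    have h1 : 0 < x - y := by linarith
    have h2 : 0 < x + y := by linarith
    refine ((((hasDerivAt_id x).sub_const y).div ((hasDerivAt_id x).add_const y) h2.ne').log
      (div_pos h1 h2).ne').congr_deriv ?_
    rw [show x ^ 2 - y ^ 2 = (x - y) * (x + y) by ring]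
    simp only [id, Pi.div_apply]
    field_simp
    ring
  have hpos : ∀ x ∈ Set.Ioi (2 * y), 0 ≤ 2 * y / (x ^ 2 - y ^ 2) := by
    intro x (hx : 2 * y < x)
    have : 0 < x ^ 2 - y ^ 2 := by nlinarith
    positivity
  have hlim : Tendsto (fun x => Real.log ((x - y) / (x + y))) atTop (nhds 0) := by
    have h1 : Tendsto (fun x : ℝ => 1 - 2 * y / (x + y)) atTop (nhds (1 - 0)) :=
      tendsto_const_nhds.sub (tendsto_const_nhds.div_atTop
        (tendsto_atTop_add_const_right _ _ tendsto_id))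
    rw [sub_zero] at h1
    have h2 := h1.log one_ne_zero
    rw [Real.log_one] at h2
    refine h2.congr' ?_
    filter_upwards [eventually_gt_atTop 0] with x hx
    have : x + y ≠ 0 := by positivity
    congr 1
    field_simp
    ring
  have hc := (hd _ Set.self_mem_Ici).continuousAt.continuousWithinAt (s := Set.Ici (2 * y))
  refine ⟨integrableOn_Ioi_deriv_of_nonneg hc (fun x hx => hd x (Set.Ioi_subset_Ici_self hx)) hpos hlim, ?_⟩
  rw [integral_Ioi_of_hasDerivAt_of_nonneg hc (fun x hx => hd x (Set.Ioi_subset_Ici_self hx)) hpos hlim, zero_sub,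
    ← Real.log_inv]
  congr 1
  field_simp
  ring

/-- The principal value of `∫ g x / (y² - x²)` over the half-line, for `g` even: the symmetric
truncation and the subtraction of the value at the singularity agree. -/
lemma integral_symm_diff_eq {g : ℝ → ℝ} (hgm : Measurable g) (hgi : Integrable g)
    (heven : ∀ x, g (-x) = g x) {y C : ℝ} (hy : 0 < y)
    (hL : ∀ x, |g x - g y| ≤ C * |x - y|) :
    ∫ u in Set.Ioi 0, (g (y - u) - g (y + u)) / (2 * y * u) =
      ∫ x in Set.Ioi 0, (g x - g y) / (y ^ 2 - x ^ 2) := by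
  set S : Set ℝ := Set.Ioo (-(2 * y)) (2 * y) with hS
  have hSm : MeasurableSet S := measurableSet_Ioo
  set q : ℝ → ℝ := fun x => (g x - S.indicator (fun _ => g y) x) / (y - x) with hqdef
  have hC : 0 ≤ C := by
    have := (abs_nonneg _).trans (hL (y + 1))
    simpa using this
  have hq : Integrable q := by
    have hb : Integrable (fun x => S.indicator (fun _ => C) x + |g x| / y) := by
      refine Integrable.add ?_ (hgi.abs.div_const y)
      rw [integrable_indicator_iff hSm]
      exact integrableOn_const (by simp [hS])
    refine hb.mono' ?_ (.of_forall fun x => ?_)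
    · exact ((hgm.sub (measurable_const.indicator hSm)).div
        (measurable_const.sub measurable_id)).aestronglyMeasurable
    · rw [Real.norm_eq_abs, abs_div]
      by_cases hx : x ∈ S
      · simp only [Set.indicator_of_mem hx]
        have : |g x - g y| / |y - x| ≤ C := by
          rw [abs_sub_comm y x]
          exact div_le_of_le_mul₀ (abs_nonneg _) hC (hL x)
        have : 0 ≤ |g x| / y := by positivity
        linarith
      · simp only [Set.indicator_of_notMem hx, sub_zero, zero_add]
        have : y ≤ |y - x| := by
          simp only [hS, Set.mem_Ioo, not_and_or, not_lt] at hx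
          rcases hx with hx | hx
          · exact le_abs.2 (Or.inl (by linarith))
          · exact le_abs.2 (Or.inr (by linarith))
        gcongr
  have hu : ∀ u ∈ Set.Ioi (0 : ℝ), (g (y - u) - g (y + u)) / (2 * y * u) =
      (2 * y)⁻¹ * ((q (y + u) + q (y + -u)) +
        g y * (Set.Ico y (3 * y)).indicator (fun u => u⁻¹) u) := by
    intro u (hu : 0 < u)
    have e1 : (y + u ∈ S) ↔ u < y := by
      simp only [hS, Set.mem_Ioo]; constructor
      · rintro ⟨_, _⟩; linarith
      · intro; constructor <;> linarith
    have e2 : (y - u ∈ S) ↔ u < 3 * y := by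
      simp only [hS, Set.mem_Ioo]; constructor
      · rintro ⟨_, _⟩; linarith
      · intro; constructor <;> linarith
    simp only [hqdef, Set.indicator, e1, e2, Set.mem_Ico, ← sub_eq_add_neg]
    rw [show y - (y + u) = -u by ring, show y - (y - u) = u by ring]
    by_cases h1 : u < y
    · have h2 : u < 3 * y := by linarith
      simp only [h1, h2, not_le.2 h1, if_true, false_and, if_false]
      field_simp
      ring
    · by_cases h2 : u < 3 * y
      · simp only [h1, h2, not_lt.1 h1, if_true, true_and, if_false]
        field_simp
        ring
      · simp only [h1, h2, and_false, if_false]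
        field_simp
        ring
  have hx : ∀ x ∈ Set.Ioi (0 : ℝ), (g x - g y) / (y ^ 2 - x ^ 2) =
      (2 * y)⁻¹ * ((q x + q (-x)) +
        g y * (Set.Ici (2 * y)).indicator (fun x => 2 * y / (x ^ 2 - y ^ 2)) x) := by
    intro x (hx : 0 < x)
    have e1 : (x ∈ S) ↔ x < 2 * y := by
      simp only [hS, Set.mem_Ioo]; constructor
      · rintro ⟨_, _⟩; linarith
      · intro; constructor <;> linarith
    have e2 : (-x ∈ S) ↔ x < 2 * y := by
      simp only [hS, Set.mem_Ioo]; constructor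
      · rintro ⟨_, _⟩; linarith
      · intro; constructor <;> linarith
    simp only [hqdef, Set.indicator, e1, e2, Set.mem_Ici, heven]
    have hxy : y + x ≠ 0 := by positivity
    rw [sub_neg_eq_add, show y ^ 2 - x ^ 2 = (y - x) * (y + x) by ring,
      show x ^ 2 - y ^ 2 = -((y - x) * (y + x)) by ring]
    by_cases h0 : x = y
    · subst h0
      have h1 : x < 2 * x := by linarith
      simp [h1, not_le.2 h1]
    have h0' : y - x ≠ 0 := fun h => h0 (by linarith)
    by_cases h1 : x < 2 * y
    · simp only [h1, not_le.2 h1, if_true, if_false]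
      field_simp
      ring
    · simp only [h1, not_lt.1 h1, if_true, if_false]
      field_simp
      ring
  have hq' : Integrable (fun u => q (y + u)) := hq.comp_add_left y
  obtain ⟨ht, ht'⟩ := tail_kernel hy
  have hI1 : IntegrableOn ((Set.Ico y (3 * y)).indicator fun u : ℝ => u⁻¹) (Set.Ioi 0) := by
    refine Integrable.integrableOn ((integrable_indicator_iff measurableSet_Ico).2 ?_)
    refine (ContinuousOn.integrableOn_Icc ?_).mono_set Set.Ico_subset_Icc_self
    exact continuousOn_id.inv₀ fun x hx => (hy.trans_le hx.1).ne'
  have hI2 : IntegrableOn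
      ((Set.Ici (2 * y)).indicator fun x : ℝ => 2 * y / (x ^ 2 - y ^ 2)) (Set.Ioi 0) := by
    refine Integrable.integrableOn ((integrable_indicator_iff measurableSet_Ici).2 ?_)
    rwa [integrableOn_Ici_iff_integrableOn_Ioi]
  have hv1 : ∫ u in Set.Ioi 0, (Set.Ico y (3 * y)).indicator (fun u : ℝ => u⁻¹) u
      = Real.log 3 := by
    have hsub : Set.Ico y (3 * y) ⊆ Set.Ioi 0 := fun x hx => hy.trans_le hx.1
    rw [setIntegral_indicator measurableSet_Ico, Set.inter_eq_right.2 hsub,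
      setIntegral_Ico_inv hy]
  have hv2 : ∫ x in Set.Ioi 0, (Set.Ici (2 * y)).indicator
      (fun x : ℝ => 2 * y / (x ^ 2 - y ^ 2)) x = Real.log 3 := by
    have hsub : Set.Ici (2 * y) ⊆ Set.Ioi 0 := Set.Ici_subset_Ioi.2 (by positivity)
    rw [setIntegral_indicator measurableSet_Ici, Set.inter_eq_right.2 hsub,
      integral_Ici_eq_integral_Ioi, ht']
  rw [setIntegral_congr_fun measurableSet_Ioi hu, setIntegral_congr_fun measurableSet_Ioi hx,
    integral_const_mul, integral_const_mul,
    integral_add (integrable_fold hq') (hI1.const_mul _),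
    integral_add (integrable_fold hq) (hI2.const_mul _), ← integral_fold hq, ← integral_fold hq',
    integral_add_left_eq_self, integral_const_mul, integral_const_mul, hv1, hv2]

lemma SchwartzMap.exists_decay (f : SchwartzMap (ℝ × ℝ) ℝ) :
    ∃ C, 0 ≤ C ∧ ∀ p, |f p| * (1 + ‖p‖) ^ 4 ≤ C := by
  obtain ⟨C, hC⟩ : ∃ C, ∀ p, (1 + ‖p‖) ^ 4 * ‖iteratedFDeriv ℝ 0 f p‖ ≤ C :=
    ⟨_, SchwartzMap.one_add_le_sup_seminorm_apply (𝕜 := ℝ) (m := (4, 0)) le_rfl le_rfl f⟩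
  refine ⟨C, le_trans (by positivity) (hC 0), fun p => ?_⟩
  have := hC p
  rwa [norm_iteratedFDeriv_zero, mul_comm] at this

lemma SchwartzMap.exists_lipschitz_decay (f : SchwartzMap (ℝ × ℝ) ℝ) :
    ∃ C, 0 ≤ C ∧ ∀ p q : ℝ × ℝ, ∀ R : ℝ, 0 ≤ R → (∀ z ∈ segment ℝ p q, R ≤ ‖z‖) →
      |f p - f q| * (1 + R) ^ 2 ≤ C * ‖p - q‖ := by
  obtain ⟨C, hC⟩ : ∃ C, ∀ p, (1 + ‖p‖) ^ 2 * ‖iteratedFDeriv ℝ 1 f p‖ ≤ C :=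
    ⟨_, SchwartzMap.one_add_le_sup_seminorm_apply (𝕜 := ℝ) (m := (2, 1)) le_rfl le_rfl f⟩
  simp only [norm_iteratedFDeriv_one] at hC
  refine ⟨C, le_trans (by positivity) (hC 0), fun p q R hR h => ?_⟩
  have hb : ∀ z ∈ segment ℝ p q, ‖fderiv ℝ f z‖ ≤ C / (1 + R) ^ 2 := by
    intro z hz
    rw [le_div_iff₀ (by positivity), mul_comm]
    refine le_trans ?_ (hC z)
    gcongr
    exact h z hz
  have := (convex_segment p q).norm_image_sub_le_of_norm_fderiv_le
    (fun z _ => f.differentiableAt) hb (right_mem_segment ℝ p q) (left_mem_segment ℝ p q)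
  rw [Real.norm_eq_abs] at this
  calc |f p - f q| * (1 + R) ^ 2 ≤ C / (1 + R) ^ 2 * ‖p - q‖ * (1 + R) ^ 2 := by gcongr
    _ = C * ‖p - q‖ := by field_simp

lemma SchwartzMap.exists_decay_mul (f : SchwartzMap (ℝ × ℝ) ℝ) :
    ∃ C, 0 ≤ C ∧ ∀ a b u : ℝ, |u| ≤ |a| + |b| →
      |f (a, b)| * ((1 + b ^ 2) * (1 + u ^ 2)) ≤ C := by
  obtain ⟨C, hC0, hC⟩ := f.exists_decay
  refine ⟨4 * C, by positivity, fun a b u hu => ?_⟩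
  have h := hC (a, b)
  set m := ‖(a, b)‖
  have ha : |a| ≤ m := le_max_left _ _
  have hb : |b| ≤ m := le_max_right _ _
  have hm : 0 ≤ m := norm_nonneg _
  have hb2 : 1 + b ^ 2 ≤ (1 + m) ^ 2 := by
    rw [← sq_abs b]; nlinarith [abs_nonneg b]
  have hu2 : 1 + u ^ 2 ≤ 4 * (1 + m) ^ 2 := by
    rw [← sq_abs u]; nlinarith [abs_nonneg u]
  calc |f (a, b)| * ((1 + b ^ 2) * (1 + u ^ 2))
      ≤ |f (a, b)| * ((1 + m) ^ 2 * (4 * (1 + m) ^ 2)) := by gcongr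
    _ = 4 * (|f (a, b)| * (1 + m) ^ 4) := by ring
    _ ≤ 4 * C := by gcongr

lemma SchwartzMap.integrable_slice (f : SchwartzMap (ℝ × ℝ) ℝ) (b : ℝ) :
    Integrable (fun x => f (x, b)) := by
  obtain ⟨C, hC0, hC⟩ := f.exists_decay_mul
  refine (integrable_inv_one_add_sq.const_mul C).mono'
    (f.continuous.comp (by fun_prop)).aestronglyMeasurable (.of_forall fun x => ?_)
  rw [Real.norm_eq_abs, ← div_eq_mul_inv, le_div_iff₀ (by positivity)]
  refine le_trans ?_ (hC x b x (by linarith [abs_nonneg b]))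
  have : 1 + x ^ 2 ≤ (1 + b ^ 2) * (1 + x ^ 2) :=
    le_mul_of_one_le_left (by positivity) (by nlinarith [sq_nonneg b])
  gcongr

lemma integrableOn_div_lt_abs {k : ℝ → ℝ} (hk : Integrable k) {δ : ℝ} (hδ : 0 < δ) :
    IntegrableOn (fun u => k u / u) {u : ℝ | δ < |u|} := by
  refine (hk.norm.div_const δ).integrableOn.mono'
    (hk.aestronglyMeasurable.restrict.div₀ measurable_id.aestronglyMeasurable) ?_
  filter_upwards [ae_restrict_mem (measurableSet_lt_abs δ)] with u hu
  have hu : δ < |u| := hu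
  rw [norm_div, Real.norm_eq_abs u]
  gcongr

/-- The integrand of `Ipv ψ` after the inner variables are shifted to the singularity. -/
def shiftedKernel (ψ : ℝ × ℝ → ℝ) (s u : ℝ) : ℝ :=
  (2 * s)⁻¹ * (ψ (u - s, s) / u + ψ (s - u, s) / u)

lemma Ipv_eq_shiftedKernel (ψ : SchwartzMap (ℝ × ℝ) ℝ) (ε : ℝ) {δ : ℝ} (hδ : 0 < δ) :
    Ipv ψ ε δ = ∫ s in {s : ℝ | ε < |s|}, ∫ u in {u : ℝ | δ < |u|}, shiftedKernel ψ s u := by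
  unfold Ipv
  congr 1
  ext s
  have h1 := setIntegral_comp_add_abs (fun u => ψ (u - s, s) / u) s δ
  have h2 := setIntegral_comp_sub_abs (fun u => ψ (s - u, s) / u) s δ
  simp only [add_sub_cancel_left, sub_sub_cancel] at h1 h2
  rw [h1, h2, ← integral_add, ← integral_const_mul]
  · rfl
  · exact integrableOn_div_lt_abs ((ψ.integrable_slice s).comp_sub_right s) hδ
  · exact integrableOn_div_lt_abs ((ψ.integrable_slice s).comp_sub_left s) hδ

lemma integrableOn_shiftedKernel (ψ : SchwartzMap (ℝ × ℝ) ℝ) (s : ℝ) {δ : ℝ} (hδ : 0 < δ) :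
    IntegrableOn (shiftedKernel ψ s) {u : ℝ | δ < |u|} :=
  ((integrableOn_div_lt_abs ((ψ.integrable_slice s).comp_sub_right s) hδ).add
    (integrableOn_div_lt_abs ((ψ.integrable_slice s).comp_sub_left s) hδ)).const_mul _

lemma integrable_prod_shiftedKernel (ψ : SchwartzMap (ℝ × ℝ) ℝ) {ε δ : ℝ} (hε : 0 < ε)
    (hδ : 0 < δ) :
    Integrable (fun p : ℝ × ℝ => shiftedKernel ψ p.1 p.2)
      ((volume.restrict {s : ℝ | ε < |s|}).prod (volume.restrict {u : ℝ | δ < |u|})) := by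
  obtain ⟨C, hC0, hC⟩ := ψ.exists_decay_mul
  have hm : Measurable ψ := ψ.continuous.measurable
  refine ((integrable_inv_one_add_sq.restrict.mul_prod
    integrable_inv_one_add_sq.restrict).const_mul ((2 * ε)⁻¹ * (C / δ + C / δ))).mono' ?_ ?_
  · unfold shiftedKernel
    exact Measurable.aestronglyMeasurable (by fun_prop)
  · rw [Measure.prod_restrict]
    filter_upwards [ae_restrict_mem ((measurableSet_lt_abs ε).prod (measurableSet_lt_abs δ))]
      with p hp
    obtain ⟨s, u⟩ := p
    obtain ⟨hs, hu⟩ : ε < |s| ∧ δ < |u| := hp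
    have h1 : ∀ a : ℝ, |u| ≤ |a| + |s| →
        |ψ (a, s) / u| ≤ C / δ * ((1 + s ^ 2)⁻¹ * (1 + u ^ 2)⁻¹) := by
      intro a ha
      have h2 := hC a s u ha
      rw [← le_div_iff₀ (by positivity)] at h2
      rw [abs_div, div_le_iff₀ (hδ.trans hu)]
      refine h2.trans ?_
      rw [← mul_inv, ← div_eq_mul_inv, div_div, div_mul_eq_mul_div, div_le_div_iff₀ (by positivity)
        (by positivity)]
      have : C * (1 + s ^ 2) * (1 + u ^ 2) * δ ≤ C * (1 + s ^ 2) * (1 + u ^ 2) * |u| := by gcongr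
      linarith
    have ha : |u| ≤ |u - s| + |s| := by simpa using abs_add_le (u - s) s
    have hb := h1 _ ha
    rw [abs_sub_comm] at ha
    have hc := h1 _ ha
    have hd : |(2 * s)⁻¹| ≤ (2 * ε)⁻¹ := by
      rw [abs_inv, abs_mul, abs_two]
      gcongr
    simp only [shiftedKernel, norm_mul, Real.norm_eq_abs]
    calc _ ≤ (2 * ε)⁻¹ * (C / δ * ((1 + s ^ 2)⁻¹ * (1 + u ^ 2)⁻¹)
          + C / δ * ((1 + s ^ 2)⁻¹ * (1 + u ^ 2)⁻¹)) :=
          mul_le_mul hd ((abs_add_le _ _).trans (add_le_add hb hc)) (abs_nonneg _) (by positivity)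
      _ = _ := by ring

/-- The integrand of `Ipv` after both variables are folded to the half-line. -/
def foldedKernel (Φ : ℝ × ℝ → ℝ) (p : ℝ × ℝ) : ℝ :=
  (Φ (p.1 - p.2, p.1) - Φ (p.1 + p.2, p.1)) / (2 * p.1 * p.2)

/-- The kernel `1 / (y² - x²)` applied to `Φ` with its diagonal value subtracted. -/
def subtractedKernel (Φ : ℝ × ℝ → ℝ) (p : ℝ × ℝ) : ℝ :=
  (Φ (p.1, p.2) - Φ (p.2, p.2)) / (p.2 ^ 2 - p.1 ^ 2)

lemma Ipv_eq_foldedKernel (ψ : SchwartzMap (ℝ × ℝ) ℝ) {Φ : ℝ × ℝ → ℝ}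
    (hΦ : ∀ a b, Φ (a, b) = ψ (a, b) + ψ (-a, b) + ψ (a, -b) + ψ (-a, -b))
    {ε δ : ℝ} (hε : 0 < ε) (hδ : 0 < δ) :
    Ipv ψ ε δ = ∫ y in Set.Ioi ε, ∫ u in Set.Ioi δ, foldedKernel Φ (y, u) := by
  rw [Ipv_eq_shiftedKernel ψ ε hδ,
    setIntegral_fold hε (integrable_prod_shiftedKernel ψ hε hδ).integral_prod_left]
  refine setIntegral_congr_fun measurableSet_Ioi fun y hy => ?_
  have hi := integrableOn_shiftedKernel ψ y hδ
  have hi' := integrableOn_shiftedKernel ψ (-y) hδ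
  rw [← integral_add hi hi']
  refine (setIntegral_fold hδ (hi.add hi')).trans ?_
  refine setIntegral_congr_fun measurableSet_Ioi fun u hu => ?_
  have hy0 : 0 < y := hε.trans hy
  have hu0 : 0 < u := hδ.trans hu
  simp only [Pi.add_apply, shiftedKernel, foldedKernel, hΦ]
  rw [show u - -y = y + u by ring, show -u - y = -y - u by ring, show y - -u = y + u by ring,
    show -u - -y = y - u by ring, show -y - -u = u - y by ring, show -(y - u) = u - y by ring,
    show -(y + u) = -y - u by ring]
  field_simp
  ring

lemma snd_eq_of_mem_segment {a a' b : ℝ} {z : ℝ × ℝ} (hz : z ∈ segment ℝ (a, b) (a', b)) :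
    z.2 = b := by
  obtain ⟨α, β, -, -, h, rfl⟩ := hz
  simp [← add_mul, h]

lemma fst_ge_of_mem_segment {a a' b : ℝ} (h : a ≤ a') {z : ℝ × ℝ}
    (hz : z ∈ segment ℝ (a, b) (a', b)) : a ≤ z.1 := by
  obtain ⟨α, β, hα, hβ, hs, rfl⟩ := hz
  have : α * a + β * a ≤ α * a + β * a' := by gcongr
  rw [← add_mul, hs, one_mul] at this
  simpa using this

lemma norm_sub_same_snd (a a' b : ℝ) : ‖((a, b) : ℝ × ℝ) - (a', b)‖ = |a - a'| := by
  simp [Prod.norm_def]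

lemma integrable_foldedKernel (Φ : SchwartzMap (ℝ × ℝ) ℝ) (heven : ∀ a b, Φ (-a, b) = Φ (a, b)) :
    Integrable (foldedKernel Φ) (posVol.prod posVol) := by
  obtain ⟨C, hC0, hC⟩ := Φ.exists_lipschitz_decay
  have hm : Measurable Φ := Φ.continuous.measurable
  refine integrable_of_le_sqrtWeight (C := 4 * C) (by unfold foldedKernel; fun_prop)
    fun y u hy hu => ?_
  simp only [foldedKernel]
  have hsq := sqrt_mul_sqrt_le_max hy hu
  rw [abs_div, abs_of_pos (show 0 < 2 * y * u by positivity), div_mul_eq_mul_div,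
    div_le_iff₀ (by positivity)]
  rcases le_total u y with h | h
  · have h1 := hC (y - u, y) (y + u, y) y hy.le fun z hz => by
      rw [← snd_eq_of_mem_segment hz]
      exact (le_abs_self _).trans (norm_snd_le z)
    rw [norm_sub_same_snd, show y - u - (y + u) = -(2 * u) by ring, abs_neg,
      abs_of_pos (show 0 < 2 * u by positivity)] at h1
    rw [max_eq_left h] at hsq
    calc _ ≤ |Φ (y - u, y) - Φ (y + u, y)| * (y * (1 + y) * (1 + y)) := by gcongr
      _ = y * (|Φ (y - u, y) - Φ (y + u, y)| * (1 + y) ^ 2) := by ring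
      _ ≤ y * (C * (2 * u)) := by gcongr
      _ ≤ 4 * C * (2 * y * u) := by
        have : 0 ≤ C * y * u := by positivity
        linarith
  · rw [← neg_sub u y, heven]
    have h1 := hC (u - y, y) (u + y, y) (u / 2) (by positivity) fun z hz => by
      have e1 := snd_eq_of_mem_segment hz
      have e2 := fst_ge_of_mem_segment (by linarith) hz
      have e3 := (le_abs_self _).trans (norm_snd_le z)
      have e4 := (le_abs_self _).trans (norm_fst_le z)
      linarith
    rw [norm_sub_same_snd, show u - y - (u + y) = -(2 * y) by ring, abs_neg,
      abs_of_pos (show 0 < 2 * y by positivity), add_comm u y] at h1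
    rw [max_eq_right h] at hsq
    calc _ ≤ |Φ (u - y, y) - Φ (y + u, y)| * (u * (2 * (1 + u / 2)) * (2 * (1 + u / 2))) := by
          gcongr <;> linarith
      _ = 4 * u * (|Φ (u - y, y) - Φ (y + u, y)| * (1 + u / 2) ^ 2) := by ring
      _ ≤ 4 * u * (C * (2 * y)) := by gcongr
      _ = 4 * C * (2 * y * u) := by ring

lemma integrable_subtractedKernel (Φ : SchwartzMap (ℝ × ℝ) ℝ) :
    Integrable (subtractedKernel Φ) (posVol.prod posVol) := by
  obtain ⟨C, hC0, hC⟩ := Φ.exists_lipschitz_decay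
  obtain ⟨B, hB0, hB⟩ := Φ.exists_decay
  have hm : Measurable Φ := Φ.continuous.measurable
  refine integrable_of_le_sqrtWeight (C := 2 * B + C) (by unfold subtractedKernel; fun_prop)
    fun x y hx hy => ?_
  simp only [subtractedKernel]
  rcases eq_or_ne x y with rfl | hxy
  · simpa using by positivity
  have hd : 0 < |x - y| := abs_pos.2 (sub_ne_zero.2 hxy)
  have h1 := hC (x, y) (y, y) y hy.le fun z hz => by
    rw [← snd_eq_of_mem_segment hz]
    exact (le_abs_self _).trans (norm_snd_le z)
  rw [norm_sub_same_snd] at h1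
  have h2 : ∀ a, |Φ (a, y)| * (1 + y) ^ 2 ≤ B := by
    intro a
    refine le_trans ?_ (hB (a, y))
    have e1 : y ≤ ‖(a, y)‖ := (le_abs_self _).trans (norm_snd_le (a, y))
    gcongr
    calc (1 + y) ^ 2 ≤ (1 + y) ^ 4 := pow_le_pow_right₀ (by linarith) (by norm_num)
      _ ≤ _ := by gcongr
  have h3 : |Φ (x, y) - Φ (y, y)| * (1 + y) ^ 2 ≤ 2 * B := by
    calc _ ≤ (|Φ (x, y)| + |Φ (y, y)|) * (1 + y) ^ 2 := by gcongr; exact abs_sub _ _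
      _ ≤ 2 * B := by linarith [h2 x, h2 y]
  have hsq : √x * √y ≤ x + y :=
    (sqrt_mul_sqrt_le_max hx hy).trans (max_le (by linarith) (by linarith))
  have hx1 : 1 + x ≤ (1 + |x - y|) * (1 + y) := by
    nlinarith [le_abs_self (x - y)]
  rw [abs_div, show y ^ 2 - x ^ 2 = -((x - y) * (x + y)) by ring, abs_neg, abs_mul,
    abs_of_pos (show 0 < x + y by positivity), div_mul_eq_mul_div, div_le_iff₀ (by positivity)]
  set Δ := |Φ (x, y) - Φ (y, y)|
  calc Δ * (√x * √y * (1 + x) * (1 + y))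
      ≤ Δ * ((x + y) * ((1 + |x - y|) * (1 + y)) * (1 + y)) := by gcongr
    _ = (x + y) * (Δ * (1 + y) ^ 2 + (Δ * (1 + y) ^ 2) * |x - y|) := by ring
    _ ≤ (x + y) * (C * |x - y| + 2 * B * |x - y|) := by gcongr
    _ = _ := by ring

lemma iterLim_Ipv (ψ Φ : SchwartzMap (ℝ × ℝ) ℝ)
    (hΦ : ∀ a b, Φ (a, b) = ψ (a, b) + ψ (-a, b) + ψ (a, -b) + ψ (-a, -b)) :
    IterLim (Ipv ψ) (∫ p, subtractedKernel Φ p ∂(posVol.prod posVol)) := by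
  have heven : ∀ a b, Φ (-a, b) = Φ (a, b) := by
    intro a b
    simp only [hΦ, neg_neg]
    ring
  have h := iterLim_setIntegral_Ioi (integrable_foldedKernel Φ heven)
    (fun ε hε δ hδ => Ipv_eq_foldedKernel ψ hΦ hε hδ)
  convert h using 1
  rw [integral_prod_symm _ (integrable_subtractedKernel Φ)]
  obtain ⟨C, hC0, hC⟩ := Φ.exists_lipschitz_decay
  refine setIntegral_congr_fun measurableSet_Ioi fun y hy => ?_
  refine (integral_symm_diff_eq (g := fun x => Φ (x, y)) (C := C)
    (Φ.continuous.comp (by fun_prop)).measurable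
    (Φ.integrable_slice y) (fun x => heven x y) hy fun x => ?_).symm
  have := hC (x, y) (y, y) 0 le_rfl fun z _ => norm_nonneg z
  rwa [norm_sub_same_snd, add_zero, one_pow, mul_one] at this

lemma ae_fst_ne_snd : ∀ᵐ p ∂(posVol.prod posVol), p.1 ≠ p.2 := by
  refine (Measure.ae_prod_iff_ae_ae
    (measurableSet_eq_fun measurable_fst measurable_snd).compl).2 (.of_forall fun x => ?_)
  filter_upwards [Measure.ae_ne posVol x] with y hy using hy.symm

lemma integral_diag_diff (Φ : SchwartzMap (ℝ × ℝ) ℝ)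
    (hW : Integrable (fun p : ℝ × ℝ => (Φ (p.1, p.1) - Φ (p.2, p.2)) / (p.2 ^ 2 - p.1 ^ 2))
      (posVol.prod posVol)) :
    ∫ p : ℝ × ℝ, (Φ (p.1, p.1) - Φ (p.2, p.2)) / (p.2 ^ 2 - p.1 ^ 2) ∂(posVol.prod posVol) =
      Real.pi ^ 2 / 4 * Φ (0, 0) := by
  obtain ⟨C, hC0, hC⟩ := Φ.exists_lipschitz_decay
  obtain ⟨B, hB0, hB⟩ := Φ.exists_decay
  have hm : Measurable Φ := Φ.continuous.measurable
  set r : ℝ → ℝ := fun x => (1 + x ^ 2)⁻¹ with hr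
  set g : ℝ → ℝ := fun x => Φ (x, x) - Φ (0, 0) * r x with hg
  have hri : Integrable r posVol := integrable_inv_one_add_sq.integrableOn
  have hgm : Measurable g := by simp only [hg, hr]; fun_prop
  have hgi : IntegrableOn (fun x => g x / x) (Set.Ioi 0) := by
    refine (hri.const_mul (C + B)).mono' (hgm.div measurable_id).aestronglyMeasurable ?_
    filter_upwards [ae_posVol] with x hx
    have h1 := hC (x, x) (0, 0) 0 le_rfl fun z _ => norm_nonneg z
    have h2 := hB (x, x)
    have e1 : ‖((x, x) : ℝ × ℝ)‖ = x := by simp [Prod.norm_def, abs_of_pos hx]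
    rw [show ((x, x) : ℝ × ℝ) - (0, 0) = (x, x) by simp, e1, add_zero, one_pow, mul_one] at h1
    rw [e1] at h2
    have h3 : x ≤ (1 + x) ^ 4 := by
      calc x ≤ 1 + x := by linarith
        _ ≤ _ := le_self_pow₀ (by linarith) (by norm_num)
    have h4 : |Φ (x, x)| * x ^ 2 ≤ B * x := by
      calc |Φ (x, x)| * x ^ 2 = |Φ (x, x)| * x * x := by ring
        _ ≤ |Φ (x, x)| * (1 + x) ^ 4 * x := by gcongr
        _ ≤ B * x := by gcongr
    have h5 : g x / x = (Φ (x, x) - Φ (0, 0) + Φ (x, x) * x ^ 2) / x * r x := by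
      simp only [hg, hr]
      field_simp
      ring
    have hr0 : 0 ≤ r x := by simp only [hr]; positivity
    rw [h5, Real.norm_eq_abs, abs_mul, abs_of_nonneg hr0, abs_div, abs_of_pos hx]
    gcongr
    rw [div_le_iff₀ hx]
    refine (abs_add_le _ _).trans ?_
    rw [abs_mul, abs_of_nonneg (sq_nonneg x)]
    linarith
  have hrr := (hri.mul_prod hri).const_mul (Φ (0, 0))
  have hae : (fun p : ℝ × ℝ => (g p.1 - g p.2) / (p.2 ^ 2 - p.1 ^ 2)) =ᵐ[posVol.prod posVol]
      fun p => (Φ (p.1, p.1) - Φ (p.2, p.2)) / (p.2 ^ 2 - p.1 ^ 2)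
        - Φ (0, 0) * (r p.1 * r p.2) := by
    filter_upwards [ae_posVol_prod, ae_fst_ne_snd] with p hp hne
    obtain ⟨x, y⟩ := p
    obtain ⟨hx, hy⟩ : 0 < x ∧ 0 < y := hp
    have h1 : y ^ 2 - x ^ 2 ≠ 0 := by
      rw [sq_sub_sq]
      exact mul_ne_zero (by positivity) (sub_ne_zero.2 (Ne.symm hne))
    simp only [hg, hr]
    field_simp
    ring
  have h0 := integral_diff_div_eq_zero hgm hgi ((hW.sub hrr).congr hae.symm)
  rw [integral_congr_ae hae, integral_sub hW hrr, integral_const_mul, integral_prod_mul,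
    integral_Ioi_inv_one_add_sq, Real.arctan_zero] at h0
  linarith

theorem stmt2 (ψ : SchwartzMap (ℝ × ℝ) ℝ) :
    ∃ Dψ Dψt : ℝ,
      IterLim (Ipv ψ) Dψ ∧
      IterLim (Ipv fun p => ψ (p.2, p.1)) Dψt ∧
      Dψ + Dψt = Real.pi ^ 2 * ψ (0, 0) := by
  let comp (e : (ℝ × ℝ) ≃L[ℝ] ℝ × ℝ) (f : SchwartzMap (ℝ × ℝ) ℝ) : SchwartzMap (ℝ × ℝ) ℝ :=
    SchwartzMap.compCLMOfContinuousLinearEquiv ℝ e f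
  let neg := ContinuousLinearEquiv.neg ℝ (M := ℝ)
  let one := ContinuousLinearEquiv.refl ℝ ℝ
  let Φ : SchwartzMap (ℝ × ℝ) ℝ :=
    ψ + comp (neg.prodCongr one) ψ + comp (one.prodCongr neg) ψ + comp (neg.prodCongr neg) ψ
  have hΦ : ∀ a b, Φ (a, b) = ψ (a, b) + ψ (-a, b) + ψ (a, -b) + ψ (-a, -b) := fun a b => rfl
  let swap := ContinuousLinearEquiv.prodComm ℝ ℝ ℝ
  have hΦt : ∀ a b, comp swap Φ (a, b) = comp swap ψ (a, b) + comp swap ψ (-a, b)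
      + comp swap ψ (a, -b) + comp swap ψ (-a, -b) := by
    intro a b
    change Φ (b, a) = ψ (b, a) + ψ (b, -a) + ψ (-b, a) + ψ (-b, -a)
    rw [hΦ]
    ring
  refine ⟨_, _, iterLim_Ipv ψ Φ hΦ, iterLim_Ipv (comp swap ψ) (comp swap Φ) hΦt, ?_⟩
  have hi := integrable_subtractedKernel Φ
  have hit := (integrable_subtractedKernel (comp swap Φ)).swap
  have hsum : ∀ p : ℝ × ℝ, subtractedKernel Φ p + subtractedKernel (comp swap Φ) p.swap =
      (Φ (p.1, p.1) - Φ (p.2, p.2)) / (p.2 ^ 2 - p.1 ^ 2) := by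
    intro p
    change (Φ (p.1, p.2) - Φ (p.2, p.2)) / (p.2 ^ 2 - p.1 ^ 2)
      + (Φ (p.1, p.2) - Φ (p.1, p.1)) / (p.1 ^ 2 - p.2 ^ 2) = _
    rw [← neg_sub (p.2 ^ 2), div_neg]
    ring
  rw [← integral_prod_swap (subtractedKernel (comp swap Φ))]
  refine (integral_add hi hit).symm.trans ((integral_congr_ae (.of_forall hsum)).trans ?_)
  rw [integral_diag_diff Φ ((hi.add hit).congr (.of_forall hsum)), hΦ, neg_zero]
  ring

end
end

section
/- There is an admissible constant C (depending only on n and Γ) such that for all x₁, y₁ ∈ ℝ, all real polynomials p of degree at most n, all γ with min{1, n/2} ≤ |γ| ≤ Γ, and all g ∈ C_c^∞(ℝ), one has ‖ℬ^{x₁,y₁} g‖_{L²(ℝ)} ≤ C · ‖g‖_{L²(ℝ)}; that is, ℬ^{x₁,y₁} extends to a bounded operator on L²(ℝ) with norm bounded uniformly in (x₁,y₁). -/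
/- STATEMENT 4: the operators ℬ^{x₁,y₁} are bounded on L²(ℝ), uniformly in (x₁,y₁). -/

open MeasureTheory Polynomial

noncomputable section

/-- `β(t) = (1 + t²/4)^(1/2)`. -/
def bet (t : ℝ) : ℝ := Real.sqrt (1 + t ^ 2 / 4)

/-- The phase `Ψ(x,y) = (x₁−y₁)(x₂²+y₂²) − (x₂−y₂)·p(x₁+y₁)`. -/
def Psi (p : Polynomial ℝ) (x y : ℝ × ℝ) : ℝ :=
  (x.1 - y.1) * (x.2 ^ 2 + y.2 ^ 2) - (x.2 - y.2) * p.eval (x.1 + y.1)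

/-- `θ(x,y) = β(x₁−y₁)·|x₂+y₂+p′(x₁+y₁)|·(x₂−y₂)`. -/
def theta (p : Polynomial ℝ) (x y : ℝ × ℝ) : ℝ :=
  bet (x.1 - y.1) * |x.2 + y.2 + p.derivative.eval (x.1 + y.1)| * (x.2 - y.2)

/-- `sin θ(x,y)/(x₂−y₂)`, extended continuously across `x₂ = y₂`. -/
def sinq (p : Polynomial ℝ) (x y : ℝ × ℝ) : ℝ :=
  if x.2 = y.2 then bet (x.1 - y.1) * |x.2 + y.2 + p.derivative.eval (x.1 + y.1)|
  else Real.sin (theta p x y) / (x.2 - y.2)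

/-- The operator `ℬ^{x₁,y₁}` acting on functions of one variable. -/
def Bop (p : Polynomial ℝ) (γ x₁ y₁ : ℝ) (g : ℝ → ℂ) (x₂ : ℝ) : ℂ :=
  ∫ y₂ : ℝ, Complex.exp (Complex.I * (γ * Psi p (x₁, x₂) (y₁, y₂) : ℝ)) *
    (sinq p (x₁, x₂) (y₁, y₂) : ℝ) * g y₂

open FourierTransform in
theorem continuous_fourier_of_integrable {f : ℝ → ℂ} (hf : Integrable f) : Continuous (𝓕 f) :=
  VectorFourier.fourierIntegral_continuous Real.continuous_fourierChar
    (by exact continuous_inner) hf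

open FourierTransform in
/-- Plancherel's theorem for the Fourier integral of a function in `L¹ ∩ L²`. -/
theorem eLpNorm_fourier_eq {f : ℝ → ℂ} (hf : Integrable f) (hf2 : MemLp f 2) :
    eLpNorm (𝓕 f) 2 = eLpNorm f 2 := by
  set F : Lp ℂ 2 (volume : Measure ℝ) := hf2.toLp f with hF
  have hcont := continuous_fourier_of_integrable hf
  have hae : ∀ᵐ x, 𝓕 f x = (𝓕 F : Lp ℂ 2 (volume : Measure ℝ)) x := by
    refine ae_eq_of_integral_contDiff_smul_eq hcont.locallyIntegrable
      ((Lp.memLp (𝓕 F)).locallyIntegrable (by norm_num)) ?_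
    intro g hg hgs
    have hg' : ContDiff ℝ (⊤ : ℕ∞) (fun x => (g x : ℂ)) :=
      Complex.ofRealCLM.contDiff.comp hg
    have hgs' : HasCompactSupport (fun x => (g x : ℂ)) :=
      hgs.comp_left (g := fun r : ℝ => (r : ℂ)) (by simp)
    set φ : SchwartzMap ℝ ℂ := hgs'.toSchwartzMap hg' with hφ
    have hφx : ∀ x, φ x = (g x : ℂ) := fun x => rfl
    have h1 := congrArg (fun T => T φ) (Lp.fourier_toTemperedDistribution_eq F)
    simp only [TemperedDistribution.fourier_apply, Lp.toTemperedDistribution_apply] at h1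
    have h2 : ∫ x, φ x • (𝓕 f) x = ∫ x, (𝓕 φ) x • f x := by
      have := VectorFourier.integral_fourierIntegral_smul_eq_flip (μ := volume) (ν := volume)
        (L := innerₗ ℝ) (f := f) (g := φ) Real.continuous_fourierChar
        (by exact continuous_inner) hf φ.integrable
      simp only [flip_innerₗ] at this
      simp only [smul_eq_mul] at this ⊢
      simp_rw [mul_comm (φ _), SchwartzMap.fourier_coe, mul_comm _ (f _)]
      exact this
    have h3 : ∫ x, (𝓕 φ) x • f x = ∫ x, (𝓕 φ) x • F x := by
      refine integral_congr_ae ?_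
      filter_upwards [hf2.coeFn_toLp] with x hx
      rw [hF, hx]
    rw [← h3, ← h2] at h1
    simpa [hφx] using h1
  rw [eLpNorm_congr_ae hae, ← Lp.enorm_def, ← ofReal_norm, Lp.norm_fourier_eq, ofReal_norm, hF,
    Lp.enorm_toLp]

/-- The character `ξ ↦ e^{2πiξs}` cut off to the frequency band `|ξ| ≤ B`. -/
def bandChar (B s : ℝ) : ℝ → ℂ :=
  (Set.Ioc (-B) B).indicator (fun ξ => (Real.fourierChar (ξ * s) : ℂ))

theorem integrable_indicator_Ioc {h : ℝ → ℂ} (hh : Continuous h) (a b : ℝ) :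
    Integrable ((Set.Ioc a b).indicator h) :=
  (integrable_indicator_iff measurableSet_Ioc).2
    (hh.integrableOn_Icc.mono_set Set.Ioc_subset_Icc_self)

theorem integrable_bandChar (B s : ℝ) : Integrable (bandChar B s) :=
  integrable_indicator_Ioc (by fun_prop) _ _

open FourierTransform in
theorem fourier_bandChar {B : ℝ} (hB : 0 < B) (s t : ℝ) :
    𝓕 (bandChar B s) t = ((2 * B * Real.sinc (2 * Real.pi * B * (s - t)) : ℝ) : ℂ) := by
  rw [Real.fourier_eq']
  have e1 : ∀ v : ℝ,
      Complex.exp (((-2 * Real.pi * inner ℝ v t : ℝ) : ℂ) * Complex.I) • bandChar B s v =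
        (Set.Ioc (-B) B).indicator (fun v : ℝ => Complex.exp
          (((2 * Real.pi * (s - t) * v : ℝ) : ℂ) * Complex.I)) v := by
    intro v
    by_cases hv : v ∈ Set.Ioc (-B) B
    · simp only [bandChar, hv, Set.indicator_of_mem, Real.fourierChar_apply, smul_eq_mul,
        ← Complex.exp_add]
      congr 1
      simp
      ring
    · simp [bandChar, hv]
  simp_rw [e1]
  rw [integral_indicator measurableSet_Ioc, ← intervalIntegral.integral_of_le (by linarith)]
  rcases eq_or_ne s t with rfl | hst
  · simp
    ring
  · have hst' := sub_ne_zero.2 hst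
    have hc : 2 * Real.pi * (s - t) ≠ 0 := by
      have := Real.pi_ne_zero
      positivity
    rw [intervalIntegral.integral_comp_mul_left (a := -B) (b := B)
      (fun x : ℝ => Complex.exp ((x : ℂ) * Complex.I)) hc, mul_neg, integral_exp_mul_I_eq_sinc,
      mul_right_comm _ (s - t) B, Complex.real_smul]
    have hcC : (s : ℂ) - t ≠ 0 := by exact_mod_cast hst'
    have hpi : (Real.pi : ℂ) ≠ 0 := by exact_mod_cast Real.pi_ne_zero
    push_cast
    field_simp

open FourierTransform in
theorem integral_sinc_mul_eq_fourierInv {f : ℝ → ℂ} (hf : Integrable f) {B : ℝ} (hB : 0 < B)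
    (s : ℝ) :
    ∫ t, ((2 * B * Real.sinc (2 * Real.pi * B * (s - t)) : ℝ) : ℂ) * f t =
      𝓕⁻ ((Set.Ioc (-B) B).indicator (𝓕 f)) s := by
  have hmul := VectorFourier.integral_fourierIntegral_smul_eq_flip (μ := volume) (ν := volume)
    (L := innerₗ ℝ) (f := f) (g := bandChar B s) Real.continuous_fourierChar
    (by exact continuous_inner) hf (integrable_bandChar B s)
  rw [flip_innerₗ] at hmul
  change ∫ ξ, 𝓕 f ξ • bandChar B s ξ = ∫ x, f x • 𝓕 (bandChar B s) x at hmul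
  simp_rw [fourier_bandChar hB, smul_eq_mul, mul_comm (f _)] at hmul
  rw [← hmul, Real.fourierInv_eq]
  refine integral_congr_ae (.of_forall fun ξ => ?_)
  by_cases hξ : ξ ∈ Set.Ioc (-B) B
  · simp [bandChar, hξ, Circle.smul_def, mul_comm]
  · simp [bandChar, hξ]

open FourierTransform in
/-- Convolution with a sinc kernel is a multiple of a Fourier projection. -/
theorem eLpNorm_sinc_convolution_le {f : ℝ → ℂ} (hf : Integrable f) (hf2 : MemLp f 2) {B : ℝ}
    (hB : 0 < B) :
    eLpNorm (fun s => ∫ t, ((2 * B * Real.sinc (2 * Real.pi * B * (s - t)) : ℝ) : ℂ) * f t) 2 ≤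
      eLpNorm f 2 := by
  set H : ℝ → ℂ := (Set.Ioc (-B) B).indicator (𝓕 f)
  have hcont : Continuous (𝓕 f : ℝ → ℂ) := continuous_fourier_of_integrable hf
  have hH1 : Integrable H := integrable_indicator_Ioc hcont _ _
  have hFL : MemLp (𝓕 f : ℝ → ℂ) 2 :=
    ⟨hcont.aestronglyMeasurable, by rw [eLpNorm_fourier_eq hf hf2]; exact hf2.2⟩
  have hH2 : MemLp H 2 := hFL.indicator measurableSet_Ioc
  have hinv : (fun s => ∫ t, ((2 * B * Real.sinc (2 * Real.pi * B * (s - t)) : ℝ) : ℂ) * f t) =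
      (𝓕 H : ℝ → ℂ) ∘ (Neg.neg : ℝ → ℝ) := by
    funext w
    rw [integral_sinc_mul_eq_fourierInv hf hB, Real.fourierInv_eq_fourier_neg]
    rfl
  rw [hinv, eLpNorm_comp_measurePreserving
      (continuous_fourier_of_integrable hH1).aestronglyMeasurable
      (Measure.measurePreserving_neg volume), eLpNorm_fourier_eq hH1 hH2]
  exact (eLpNorm_indicator_le _).trans (eLpNorm_fourier_eq hf hf2).le

theorem lintegral_enorm_sq_eq {α : Type*} [MeasurableSpace α] (μ : Measure α) (f : α → ℂ) :
    ∫⁻ x, ‖f x‖ₑ ^ 2 ∂μ = eLpNorm f 2 μ ^ 2 := by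
  have := eLpNorm_nnreal_pow_eq_lintegral (f := f) (μ := μ) (p := 2) (by norm_num)
  simpa using this.symm

theorem lintegral_eq_lintegral_Ioi_add (F : ℝ → ENNReal) :
    ∫⁻ x, F x = (∫⁻ x in Set.Ioi 0, F x) + ∫⁻ x in Set.Ioi 0, F (-x) := by
  have h1 : ∫⁻ x in Set.Ioi 0, F (-x) = ∫⁻ x in Set.Iio 0, F x := by
    have := (Measure.measurePreserving_neg (volume : Measure ℝ)).setLIntegral_comp_preimage_emb
      (MeasurableEquiv.neg ℝ).measurableEmbedding F (Set.Iio 0)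
    simpa using this
  rw [h1, ← lintegral_add_compl F (measurableSet_Ioi (a := (0 : ℝ))), Set.compl_Ioi,
    setLIntegral_congr (Iio_ae_eq_Iic (a := (0 : ℝ)))]

theorem image_sq_Ioi : (fun v : ℝ => v ^ 2) '' Set.Ioi 0 = Set.Ioi 0 := by
  ext t
  constructor
  · rintro ⟨v, hv, rfl⟩
    exact pow_pos (Set.mem_Ioi.1 hv) 2
  · intro ht
    exact ⟨√t, Real.sqrt_pos.2 ht, Real.sq_sqrt (le_of_lt ht)⟩

theorem hasDerivWithinAt_sq (v : ℝ) (s : Set ℝ) :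
    HasDerivWithinAt (fun v : ℝ => v ^ 2) (2 * v) s v := by
  simpa using (hasDerivAt_pow 2 v).hasDerivWithinAt

theorem injOn_sq_Ioi : Set.InjOn (fun v : ℝ => v ^ 2) (Set.Ioi 0) := fun _ ha _ hb h =>
  (pow_left_inj₀ (le_of_lt ha) (le_of_lt hb) two_ne_zero).1 h

theorem lintegral_Ioi_comp_sq (G : ℝ → ENNReal) :
    ∫⁻ s in Set.Ioi 0, G s = ∫⁻ v in Set.Ioi 0, ENNReal.ofReal |2 * v| * G (v ^ 2) := by
  have := lintegral_image_eq_lintegral_abs_deriv_mul (measurableSet_Ioi (a := (0 : ℝ)))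
    (fun v _ => hasDerivWithinAt_sq v _) injOn_sq_Ioi G
  rwa [image_sq_Ioi] at this

theorem integral_Ioi_comp_sq (G : ℝ → ℂ) :
    ∫ s in Set.Ioi 0, G s = ∫ v in Set.Ioi 0, |2 * v| • G (v ^ 2) := by
  have := integral_image_eq_integral_abs_deriv_smul (measurableSet_Ioi (a := (0 : ℝ)))
    (fun v _ => hasDerivWithinAt_sq v _) injOn_sq_Ioi G
  rwa [image_sq_Ioi] at this

theorem integrableOn_Ioi_comp_sq (G : ℝ → ℂ) :
    IntegrableOn G (Set.Ioi 0) ↔ IntegrableOn (fun v => |2 * v| • G (v ^ 2)) (Set.Ioi 0) := by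
  have := integrableOn_image_iff_integrableOn_abs_deriv_smul (measurableSet_Ioi (a := (0 : ℝ)))
    (fun v _ => hasDerivWithinAt_sq v _) injOn_sq_Ioi G
  rwa [image_sq_Ioi] at this

/-- The pull-back of `h` under `v ↦ v²` on the half line, normalised in `L²`. -/
def sqPullback (h : ℝ → ℂ) : ℝ → ℂ :=
  (Set.Ioi 0).indicator fun t => ((1 / (2 * √(√t)) : ℝ) : ℂ) * h (√t)

theorem sqPullback_sq (h : ℝ → ℂ) {v : ℝ} (hv : 0 < v) :
    sqPullback h (v ^ 2) = ((1 / (2 * √v) : ℝ) : ℂ) * h v := by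
  have : v ^ 2 ∈ Set.Ioi (0 : ℝ) := pow_pos hv 2
  rw [sqPullback, Set.indicator_of_mem this, Real.sqrt_sq hv.le]

theorem abs_two_mul_smul_sqPullback_sq (h : ℝ → ℂ) {v : ℝ} (hv : 0 < v) :
    |2 * v| • sqPullback h (v ^ 2) = ((√v : ℝ) : ℂ) * h v := by
  rw [sqPullback_sq h hv, abs_of_pos (by positivity), Complex.real_smul, ← mul_assoc,
    ← Complex.ofReal_mul]
  congr 2
  have := Real.sqrt_pos.2 hv
  field_simp
  exact (Real.sq_sqrt hv.le).symm

theorem integrable_sqPullback {h : ℝ → ℂ} (hc : Continuous h) (hs : HasCompactSupport h) :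
    Integrable (sqPullback h) := by
  rw [sqPullback, integrable_indicator_iff measurableSet_Ioi]
  have e : Set.EqOn (sqPullback h) (fun t => ((1 / (2 * √(√t)) : ℝ) : ℂ) * h (√t)) (Set.Ioi 0) :=
    fun t ht => Set.indicator_of_mem ht _
  rw [← integrableOn_congr_fun e measurableSet_Ioi, integrableOn_Ioi_comp_sq]
  refine (integrableOn_congr_fun
    (fun v hv => (abs_two_mul_smul_sqPullback_sq h hv)) measurableSet_Ioi).2 ?_
  have : Continuous fun v : ℝ => ((√v : ℝ) : ℂ) * h v := by fun_prop
  exact (this.integrable_of_hasCompactSupport hs.mul_left).integrableOn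

theorem lintegral_sqPullback_le (h : ℝ → ℂ) :
    ∫⁻ t, ‖sqPullback h t‖ₑ ^ 2 ≤ ∫⁻ v, ‖h v‖ₑ ^ 2 := by
  have e : (fun t => ‖sqPullback h t‖ₑ ^ 2) =
      (Set.Ioi 0).indicator (fun t => ‖sqPullback h t‖ₑ ^ 2) := by
    funext t
    by_cases ht : t ∈ Set.Ioi (0 : ℝ)
    · rw [Set.indicator_of_mem ht]
    · simp only [sqPullback, Set.indicator_of_notMem ht]
      simp
  rw [e, lintegral_indicator measurableSet_Ioi, lintegral_Ioi_comp_sq]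
  refine (setLIntegral_mono' measurableSet_Ioi fun v hv => ?_).trans
    (setLIntegral_le_lintegral (Set.Ioi 0) _)
  rw [sqPullback_sq h hv, enorm_mul, mul_pow, ← mul_assoc]
  refine mul_le_of_le_one_left' ?_
  have hv' : (0 : ℝ) < v := hv
  have := Real.sqrt_pos.2 hv'
  rw [← ofReal_norm, Complex.norm_real, Real.norm_of_nonneg (by positivity),
    ← ENNReal.ofReal_pow (by positivity), ← ENNReal.ofReal_mul (by positivity),
    ← ENNReal.ofReal_one]
  refine ENNReal.ofReal_le_ofReal ?_
  rw [abs_of_pos (by positivity), div_pow, mul_pow, Real.sq_sqrt hv'.le]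
  field_simp
  norm_num

/-- The operator with kernel `√(uv)·2B·sinc(2πB(u²−v²))` on the half line is bounded on `L²`. -/
theorem lintegral_main_le {h : ℝ → ℂ} (hc : Continuous h) (hs : HasCompactSupport h) {B : ℝ}
    (hB : 0 < B) :
    ∫⁻ u in Set.Ioi 0, ‖∫ v,
      ((√(u * v) * (2 * B * Real.sinc (2 * Real.pi * B * (u ^ 2 - v ^ 2))) : ℝ) : ℂ) * h v‖ₑ ^ 2 ≤
      ∫⁻ v, ‖h v‖ₑ ^ 2 := by
  have hf := integrable_sqPullback hc hs
  have hle := lintegral_sqPullback_le h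
  have hfin : ∫⁻ v, ‖h v‖ₑ ^ 2 < ⊤ := by
    rw [lintegral_enorm_sq_eq]
    exact ENNReal.pow_lt_top (hc.memLp_of_hasCompactSupport hs).2
  have hf2 : MemLp (sqPullback h) 2 := by
    refine ⟨hf.1, ?_⟩
    rw [lintegral_enorm_sq_eq volume (sqPullback h)] at hle
    by_contra hcon
    rw [not_lt, top_le_iff] at hcon
    rw [hcon] at hle
    exact absurd hfin (by simpa using hle)
  set N : ℝ → ℂ := fun s =>
    ∫ t, ((2 * B * Real.sinc (2 * Real.pi * B * (s - t)) : ℝ) : ℂ) * sqPullback h t with hN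
  have hrep : ∀ u ∈ Set.Ioi (0 : ℝ), ∫ v,
      ((√(u * v) * (2 * B * Real.sinc (2 * Real.pi * B * (u ^ 2 - v ^ 2))) : ℝ) : ℂ) * h v =
      ((√u : ℝ) : ℂ) * N (u ^ 2) := by
    intro u hu
    have hu' : (0 : ℝ) < u := hu
    have eN : N (u ^ 2) = ∫ t in Set.Ioi 0,
        ((2 * B * Real.sinc (2 * Real.pi * B * (u ^ 2 - t)) : ℝ) : ℂ) * sqPullback h t := by
      refine (setIntegral_eq_integral_of_forall_compl_eq_zero fun t ht => ?_).symm
      rw [sqPullback, Set.indicator_of_notMem ht, mul_zero]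
    rw [eN, integral_Ioi_comp_sq, ← integral_const_mul]
    have eL : ∫ v,
        ((√(u * v) * (2 * B * Real.sinc (2 * Real.pi * B * (u ^ 2 - v ^ 2))) : ℝ) : ℂ) * h v =
        ∫ v in Set.Ioi 0,
        ((√(u * v) * (2 * B * Real.sinc (2 * Real.pi * B * (u ^ 2 - v ^ 2))) : ℝ) : ℂ) * h v := by
      refine (setIntegral_eq_integral_of_forall_compl_eq_zero fun v hv => ?_).symm
      have hv' : v ≤ 0 := not_lt.1 hv
      rw [Real.sqrt_eq_zero_of_nonpos (mul_nonpos_of_nonneg_of_nonpos hu'.le hv')]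
      simp
    rw [eL]
    refine setIntegral_congr_fun measurableSet_Ioi fun v hv => ?_
    have := abs_two_mul_smul_sqPullback_sq h (v := v) hv
    rw [← mul_smul_comm, this, Real.sqrt_mul hu'.le]
    push_cast
    ring
  rw [setLIntegral_congr_fun measurableSet_Ioi fun u hu => by rw [hrep u hu]]
  calc ∫⁻ u in Set.Ioi 0, ‖((√u : ℝ) : ℂ) * N (u ^ 2)‖ₑ ^ 2
      ≤ ∫⁻ u in Set.Ioi 0, ENNReal.ofReal |2 * u| * ‖N (u ^ 2)‖ₑ ^ 2 := by
        refine setLIntegral_mono' measurableSet_Ioi fun u hu => ?_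
        have hu' : (0 : ℝ) < u := hu
        rw [enorm_mul, mul_pow]
        gcongr
        rw [← ofReal_norm, Complex.norm_real, Real.norm_of_nonneg (by positivity),
          ← ENNReal.ofReal_pow (by positivity), Real.sq_sqrt hu'.le]
        refine ENNReal.ofReal_le_ofReal ?_
        rw [abs_of_pos (by positivity)]
        linarith
    _ = ∫⁻ s in Set.Ioi 0, ‖N s‖ₑ ^ 2 := (lintegral_Ioi_comp_sq fun s => ‖N s‖ₑ ^ 2).symm
    _ ≤ ∫⁻ s, ‖N s‖ₑ ^ 2 := setLIntegral_le_lintegral _ _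
    _ ≤ ∫⁻ t, ‖sqPullback h t‖ₑ ^ 2 := by
        rw [lintegral_enorm_sq_eq, lintegral_enorm_sq_eq]
        gcongr
        exact eLpNorm_sinc_convolution_le hf hf2 hB
    _ ≤ _ := hle

/-- Schur's test with a weight for symmetric kernels. -/
theorem lintegral_sq_le_of_schur {α : Type*} [MeasurableSpace α] {μ : Measure α} [SFinite μ]
    {K : α → α → ENNReal} (hK : Measurable (Function.uncurry K)) (hsymm : ∀ u v, K u v = K v u)
    {w : α → ENNReal} (hw : Measurable w) (hw0 : ∀ᵐ v ∂μ, w v ≠ 0) (hwtop : ∀ᵐ v ∂μ, w v ≠ ⊤)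
    {C : ENNReal} (hC : ∀ᵐ u ∂μ, ∫⁻ v, K u v * w v ∂μ ≤ C * w u)
    {f : α → ENNReal} (hf : Measurable f) :
    ∫⁻ u, (∫⁻ v, K u v * f v ∂μ) ^ 2 ∂μ ≤ C ^ 2 * ∫⁻ v, f v ^ 2 ∂μ := by
  have hKu : ∀ u, Measurable (K u) := fun u => hK.comp measurable_prodMk_left
  have hcs : ∀ u, (∫⁻ v, K u v * f v ∂μ) ^ 2 ≤
      (∫⁻ v, K u v * w v ∂μ) * ∫⁻ v, K u v * ((w v)⁻¹ * f v ^ 2) ∂μ := by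
    intro u
    have hKu' := hKu u
    have hold := ENNReal.lintegral_mul_le_Lp_mul_Lq μ Real.HolderConjugate.two_two
      (f := fun v => (K u v * w v) ^ (1 / 2 : ℝ))
      (g := fun v => (K u v * ((w v)⁻¹ * f v ^ 2)) ^ (1 / 2 : ℝ))
      (by fun_prop) (by fun_prop)
    have e : ∫⁻ v, K u v * f v ∂μ = ∫⁻ v, ((fun v => (K u v * w v) ^ (1 / 2 : ℝ)) *
        fun v => (K u v * ((w v)⁻¹ * f v ^ 2)) ^ (1 / 2 : ℝ)) v ∂μ := by
      refine lintegral_congr_ae ?_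
      filter_upwards [hw0, hwtop] with v h0 h1
      simp only [Pi.mul_apply]
      rw [← ENNReal.mul_rpow_of_nonneg _ _ (by norm_num)]
      have : K u v * w v * (K u v * ((w v)⁻¹ * f v ^ 2)) = (K u v * f v) ^ (2 : ℝ) := by
        rw [ENNReal.rpow_two]
        calc K u v * w v * (K u v * ((w v)⁻¹ * f v ^ 2))
            = (w v * (w v)⁻¹) * (K u v * f v) ^ 2 := by ring
          _ = _ := by rw [ENNReal.mul_inv_cancel h0 h1, one_mul]
      rw [this, ← ENNReal.rpow_mul]
      norm_num
    rw [← e] at hold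
    simp_rw [← ENNReal.rpow_mul] at hold
    norm_num at hold
    calc (∫⁻ v, K u v * f v ∂μ) ^ 2 ≤ _ := pow_le_pow_left' hold 2
      _ = _ := by
        rw [mul_pow, ← ENNReal.rpow_two, ← ENNReal.rpow_two, ← ENNReal.rpow_mul,
          ← ENNReal.rpow_mul]
        norm_num
  calc ∫⁻ u, (∫⁻ v, K u v * f v ∂μ) ^ 2 ∂μ
      ≤ ∫⁻ u, C * ∫⁻ v, w u * (K u v * ((w v)⁻¹ * f v ^ 2)) ∂μ ∂μ := by
        refine lintegral_mono_ae ?_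
        filter_upwards [hC] with u hu
        have hKu' := hKu u
        rw [lintegral_const_mul _ (by fun_prop), ← mul_assoc]
        exact (hcs u).trans (mul_le_mul_left hu _)
    _ = C * ∫⁻ v, ∫⁻ u, w u * (K u v * ((w v)⁻¹ * f v ^ 2)) ∂μ ∂μ := by
        have hmeas : Measurable (Function.uncurry fun u v =>
            w u * (K u v * ((w v)⁻¹ * f v ^ 2))) := by
          have : Measurable fun q : α × α => K q.1 q.2 := hK
          simp only [Function.uncurry_def]
          fun_prop
        have hmeas' := hmeas.lintegral_prod_right' (ν := μ)
        simp only [Function.uncurry_apply_pair] at hmeas'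
        rw [lintegral_const_mul _ hmeas', lintegral_lintegral_swap hmeas.aemeasurable]
    _ ≤ C * ∫⁻ v, C * f v ^ 2 ∂μ := by
        gcongr C * ?_
        refine lintegral_mono_ae ?_
        filter_upwards [hC, hw0, hwtop] with v hv h0 h1
        have hKv := hKu v
        calc ∫⁻ u, w u * (K u v * ((w v)⁻¹ * f v ^ 2)) ∂μ
            = ((w v)⁻¹ * f v ^ 2) * ∫⁻ u, K v u * w u ∂μ := by
              rw [← lintegral_const_mul _ (by fun_prop)]
              refine lintegral_congr fun u => ?_
              rw [hsymm u v]
              ring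
          _ ≤ ((w v)⁻¹ * f v ^ 2) * (C * w v) := by gcongr
          _ = (w v * (w v)⁻¹) * (C * f v ^ 2) := by ring
          _ = C * f v ^ 2 := by rw [ENNReal.mul_inv_cancel h0 h1, one_mul]
    _ = C ^ 2 * ∫⁻ v, f v ^ 2 ∂μ := by
        rw [lintegral_const_mul _ (by fun_prop)]
        ring

theorem lintegral_hilbert_weight_Ioi {a : ℝ} (ha : 0 < a) :
    ∫⁻ v in Set.Ioi 0, ENNReal.ofReal (1 / (a + v) * (√v)⁻¹) =
      ENNReal.ofReal (Real.pi * (√a)⁻¹) := by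
  have hsa := Real.sqrt_pos.2 ha
  set g : ℝ → ℝ := fun v => 2 * (√a)⁻¹ * Real.arctan (√v / √a) with hg
  have hcont : Continuous g := by fun_prop
  have hderiv : ∀ v ∈ Set.Ioi (0 : ℝ), HasDerivAt g (1 / (a + v) * (√v)⁻¹) v := by
    intro v hv
    have hv' : (0 : ℝ) < v := hv
    have hsv := Real.sqrt_pos.2 hv'
    convert! (((Real.hasDerivAt_sqrt hv'.ne').div_const (√a)).arctan).const_mul (2 * (√a)⁻¹) using 1
    rw [div_pow, Real.sq_sqrt ha.le, Real.sq_sqrt hv'.le]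
    field_simp
    rw [Real.sq_sqrt ha.le]
  have hpos : ∀ v ∈ Set.Ioi (0 : ℝ), 0 ≤ 1 / (a + v) * (√v)⁻¹ := by
    intro v hv
    have hv' : (0 : ℝ) < v := hv
    positivity
  have hlim : Filter.Tendsto g Filter.atTop (nhds (Real.pi * (√a)⁻¹)) := by
    have h1 : Filter.Tendsto (fun v => √v / √a) Filter.atTop Filter.atTop :=
      Real.tendsto_sqrt_atTop.atTop_div_const hsa
    have h2 := ((Real.tendsto_arctan_atTop.mono_right nhdsWithin_le_nhds).comp h1).const_mul
      (2 * (√a)⁻¹)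
    convert! h2 using 2
    ring
  have hderiv_int := integrableOn_Ioi_deriv_of_nonneg hcont.continuousWithinAt hderiv hpos hlim
  have hval := integral_Ioi_of_hasDerivAt_of_nonneg hcont.continuousWithinAt hderiv hpos hlim
  rw [← ofReal_integral_eq_lintegral_ofReal hderiv_int
    ((ae_restrict_iff' measurableSet_Ioi).2 (.of_forall hpos)), hval]
  simp [hg]

/-- A form of Hilbert's inequality on the whole line. -/
theorem lintegral_hilbert_sq_le {f : ℝ → ENNReal} (hf : Measurable f) :
    ∫⁻ u : ℝ, (∫⁻ v, ENNReal.ofReal (1 / (|u| + |v|)) * f v) ^ 2 ≤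
      ENNReal.ofReal (2 * Real.pi) ^ 2 * ∫⁻ v, f v ^ 2 := by
  have hne : ∀ᵐ v : ℝ, v ≠ 0 := by simp [ae_iff]
  refine lintegral_sq_le_of_schur (w := fun v : ℝ => ENNReal.ofReal (√|v|)⁻¹) ?_ ?_ ?_ ?_ ?_ ?_ hf
  · simp only [Function.uncurry_def]
    fun_prop
  · intro u v
    rw [add_comm]
  · fun_prop
  · filter_upwards [hne] with v hv
    have : 0 < (√|v|)⁻¹ := inv_pos.2 (Real.sqrt_pos.2 (abs_pos.2 hv))
    simpa using this
  · exact .of_forall fun v => ENNReal.ofReal_ne_top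
  · filter_upwards [hne] with u hu
    have e : ∫⁻ v in Set.Ioi (0 : ℝ), ENNReal.ofReal (1 / (|u| + |v|)) * ENNReal.ofReal (√|v|)⁻¹ =
        ENNReal.ofReal (Real.pi * (√|u|)⁻¹) := by
      rw [← lintegral_hilbert_weight_Ioi (abs_pos.2 hu)]
      refine setLIntegral_congr_fun measurableSet_Ioi fun v hv => ?_
      have hv' : (0 : ℝ) < v := hv
      rw [← ENNReal.ofReal_mul (by positivity), abs_of_pos hv']
    rw [lintegral_eq_lintegral_Ioi_add]
    simp_rw [abs_neg]
    rw [e, ← two_mul,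
      ENNReal.ofReal_mul (p := Real.pi) (by positivity),
      ENNReal.ofReal_mul (p := 2) (by norm_num), mul_assoc]
    simp

/-- The kernel `sin(b|u+v|(u−v))/(u−v)`, extended continuously to the diagonal. -/
def oscKernel (b u v : ℝ) : ℝ := b * |u + v| * Real.sinc (b * |u + v| * (u - v))

theorem continuous_oscKernel (b u : ℝ) : Continuous (oscKernel b u) := by
  have := Real.continuous_sinc
  unfold oscKernel
  fun_prop

theorem oscKernel_neg_neg (b u v : ℝ) : oscKernel b (-u) (-v) = oscKernel b u v := by
  unfold oscKernel
  rw [show -u + -v = -(u + v) by ring, abs_neg,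
    show b * |u + v| * (-u - -v) = -(b * |u + v| * (u - v)) by ring, Real.sinc_neg]

theorem mul_sinc_mul {c d : ℝ} (hd : d ≠ 0) : c * Real.sinc (c * d) = Real.sin (c * d) / d := by
  rcases eq_or_ne c 0 with rfl | hc
  · simp
  · rw [Real.sinc_of_ne_zero (mul_ne_zero hc hd)]
    field_simp

theorem abs_oscKernel_sub_le {u : ℝ} (hu : 0 < u) (b v : ℝ) :
    |oscKernel b u v - √(u * v) * (2 * b * Real.sinc (b * (u ^ 2 - v ^ 2)))| ≤
      1 / (|u| + |v|) := by
  rw [abs_of_pos hu]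
  rcases le_or_gt v 0 with hv | hv
  · rw [Real.sqrt_eq_zero_of_nonpos (mul_nonpos_of_nonneg_of_nonpos hu.le hv), zero_mul, sub_zero,
      abs_of_nonpos hv, oscKernel, mul_sinc_mul (by linarith), abs_div, ← sub_eq_add_neg,
      abs_of_pos (a := u - v) (by linarith)]
    gcongr
    · linarith
    · exact Real.abs_sin_le_one _
  · rw [abs_of_pos hv, oscKernel, abs_of_pos (a := u + v) (by positivity),
      show b * (u + v) * (u - v) = b * (u ^ 2 - v ^ 2) by ring, Real.sqrt_mul hu.le]
    have hsu := Real.sq_sqrt hu.le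
    have hsv := Real.sq_sqrt hv.le
    rcases eq_or_ne u v with rfl | huv
    · have : b * (u + u) * Real.sinc (b * (u ^ 2 - u ^ 2)) -
          √u * √u * (2 * b * Real.sinc (b * (u ^ 2 - u ^ 2))) = 0 := by
        rw [← sq, hsu]
        ring
      rw [this]
      simp
      positivity
    · have hd : u ^ 2 - v ^ 2 ≠ 0 := by
        rw [sq_sub_sq]
        exact mul_ne_zero (by positivity) (sub_ne_zero.2 huv)
      have e : b * (u + v) * Real.sinc (b * (u ^ 2 - v ^ 2)) -
          √u * √v * (2 * b * Real.sinc (b * (u ^ 2 - v ^ 2))) =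
          (√u - √v) ^ 2 * (b * Real.sinc (b * (u ^ 2 - v ^ 2))) := by
        nth_rewrite 1 [← hsu, ← hsv]
        ring
      have hk : (√u - √v) ^ 2 ≤ |u - v| := by
        have h1 : |u - v| = |√u - √v| * (√u + √v) := by
          rw [← abs_of_nonneg (a := √u + √v) (by positivity), ← abs_mul]
          congr 1
          nlinarith
        rw [h1, ← sq_abs, sq]
        gcongr
        refine (abs_sub _ _).trans ?_
        rw [abs_of_nonneg (Real.sqrt_nonneg _), abs_of_nonneg (Real.sqrt_nonneg _)]
      have huv' : 0 < |u - v| := abs_pos.2 (sub_ne_zero.2 huv)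
      rw [e, mul_sinc_mul hd, abs_mul, abs_div, abs_of_nonneg (sq_nonneg _), sq_sub_sq, abs_mul,
        abs_of_pos (a := u + v) (by positivity)]
      calc (√u - √v) ^ 2 * (|Real.sin (b * ((u + v) * (u - v)))| / ((u + v) * |u - v|))
          ≤ |u - v| * (1 / ((u + v) * |u - v|)) := by
            gcongr
            exact Real.abs_sin_le_one _
        _ = 1 / (u + v) := by field_simp

/-- The integral operator with kernel `oscKernel b`. -/
def oscOp (b : ℝ) (h : ℝ → ℂ) (u : ℝ) : ℂ := ∫ v, (oscKernel b u v : ℂ) * h v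

theorem oscOp_neg (b : ℝ) (h : ℝ → ℂ) (u : ℝ) :
    oscOp b h (-u) = oscOp b (fun v => h (-v)) u := by
  unfold oscOp
  rw [← integral_neg_eq_self]
  simp_rw [oscKernel_neg_neg]

theorem enorm_oscOp_le {h : ℝ → ℂ} (hc : Continuous h) (hs : HasCompactSupport h) (b : ℝ) {u : ℝ}
    (hu : 0 < u) :
    ‖oscOp b h u‖ₑ ≤
      ‖∫ v, ((√(u * v) * (2 * b * Real.sinc (b * (u ^ 2 - v ^ 2))) : ℝ) : ℂ) * h v‖ₑ +
        ∫⁻ v, ENNReal.ofReal (1 / (|u| + |v|)) * ‖h v‖ₑ := by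
  have hsinc := Real.continuous_sinc
  have c1 : Continuous fun v => (oscKernel b u v : ℂ) * h v := by
    have := continuous_oscKernel b u
    fun_prop
  have c2 : Continuous fun v =>
      ((√(u * v) * (2 * b * Real.sinc (b * (u ^ 2 - v ^ 2))) : ℝ) : ℂ) * h v := by
    fun_prop
  have i1 := c1.integrable_of_hasCompactSupport (μ := volume) hs.mul_left
  have i2 := c2.integrable_of_hasCompactSupport (μ := volume) hs.mul_left
  have e : oscOp b h u =
      (∫ v, ((√(u * v) * (2 * b * Real.sinc (b * (u ^ 2 - v ^ 2))) : ℝ) : ℂ) * h v) +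
      ∫ v, ((oscKernel b u v : ℂ) * h v -
        ((√(u * v) * (2 * b * Real.sinc (b * (u ^ 2 - v ^ 2))) : ℝ) : ℂ) * h v) := by
    rw [integral_sub i1 i2, oscOp]
    ring
  rw [e]
  refine (enorm_add_le _ _).trans ?_
  gcongr
  refine (enorm_integral_le_lintegral_enorm _).trans (lintegral_mono fun v => ?_)
  rw [← sub_mul, enorm_mul, ← Complex.ofReal_sub]
  gcongr
  rw [← ofReal_norm, Complex.norm_real]
  exact ENNReal.ofReal_le_ofReal (abs_oscKernel_sub_le hu b v)

theorem lintegral_oscOp_Ioi_le {h : ℝ → ℂ} (hc : Continuous h) (hs : HasCompactSupport h) {b : ℝ}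
    (hb : 0 < b) :
    ∫⁻ u in Set.Ioi 0, ‖oscOp b h u‖ₑ ^ 2 ≤
      4 * ENNReal.ofReal (2 * Real.pi) ^ 2 * ∫⁻ v, ‖h v‖ₑ ^ 2 := by
  set A := ENNReal.ofReal (2 * Real.pi) with hA
  set S : ℝ → ENNReal := fun u => ∫⁻ v, ENNReal.ofReal (1 / (|u| + |v|)) * ‖h v‖ₑ with hS
  set B := b / (2 * Real.pi) with hB
  have hBpos : 0 < B := by positivity
  have hbB : b = 2 * Real.pi * B := by
    rw [hB]
    field_simp
  set M : ℝ → ℂ := fun u => ∫ v,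
      ((√(u * v) * (2 * B * Real.sinc (2 * Real.pi * B * (u ^ 2 - v ^ 2))) : ℝ) : ℂ) * h v with hM
  have hMb : ∀ u, ‖∫ v, ((√(u * v) * (2 * b * Real.sinc (b * (u ^ 2 - v ^ 2))) : ℝ) : ℂ) * h v‖ₑ =
      A * ‖M u‖ₑ := by
    intro u
    have : A = ‖((2 * Real.pi : ℝ) : ℂ)‖ₑ := by
      rw [← ofReal_norm, Complex.norm_real, Real.norm_of_nonneg (by positivity)]
    rw [this, ← enorm_mul, hM, ← integral_const_mul]
    congr 2
    funext v
    rw [hbB]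
    push_cast
    ring
  have hSm : Measurable S := by
    have : Measurable fun q : ℝ × ℝ => ENNReal.ofReal (1 / (|q.1| + |q.2|)) * ‖h q.2‖ₑ := by
      have := hc.measurable
      fun_prop
    exact this.lintegral_prod_right'
  have hsq : ∀ x y : ENNReal, (x + y) ^ 2 ≤ 2 * x ^ 2 + 2 * y ^ 2 := by
    intro x y
    have := ENNReal.rpow_add_le_mul_rpow_add_rpow x y (p := 2) (by norm_num)
    norm_num at this
    rwa [mul_add] at this
  calc ∫⁻ u in Set.Ioi 0, ‖oscOp b h u‖ₑ ^ 2
      ≤ ∫⁻ u in Set.Ioi 0, (2 * A ^ 2 * ‖M u‖ₑ ^ 2 + 2 * S u ^ 2) := by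
        refine setLIntegral_mono' measurableSet_Ioi fun u hu => ?_
        have h1 := enorm_oscOp_le hc hs b hu
        rw [hMb] at h1
        refine (pow_le_pow_left' h1 2).trans ((hsq _ _).trans (le_of_eq ?_))
        rw [mul_pow, ← mul_assoc]
    _ = 2 * A ^ 2 * (∫⁻ u in Set.Ioi 0, ‖M u‖ₑ ^ 2) + 2 * ∫⁻ u in Set.Ioi 0, S u ^ 2 := by
        rw [lintegral_add_right _ (by fun_prop), lintegral_const_mul' _ _ (by finiteness),
          lintegral_const_mul _ (by fun_prop)]
    _ ≤ 2 * A ^ 2 * (∫⁻ v, ‖h v‖ₑ ^ 2) + 2 * (A ^ 2 * ∫⁻ v, ‖h v‖ₑ ^ 2) := by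
        refine add_le_add (mul_le_mul_right (lintegral_main_le hc hs hBpos) _)
          (mul_le_mul_right ((setLIntegral_le_lintegral _ _).trans ?_) _)
        exact lintegral_hilbert_sq_le hc.measurable.enorm
    _ = 4 * A ^ 2 * ∫⁻ v, ‖h v‖ₑ ^ 2 := by ring

theorem eLpNorm_oscOp_le {h : ℝ → ℂ} (hc : Continuous h) (hs : HasCompactSupport h) {b : ℝ}
    (hb : 0 < b) :
    eLpNorm (oscOp b h) 2 ≤ ENNReal.ofReal (6 * Real.pi) * eLpNorm h 2 := by
  have hneg : ∫⁻ v, ‖h (-v)‖ₑ ^ 2 = ∫⁻ v, ‖h v‖ₑ ^ 2 := by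
    rw [lintegral_eq_lintegral_Ioi_add, lintegral_eq_lintegral_Ioi_add fun v => ‖h v‖ₑ ^ 2]
    simp_rw [neg_neg]
    exact add_comm _ _
  have hsneg : HasCompactSupport fun v => h (-v) :=
    hs.comp_homeomorph (Homeomorph.neg ℝ)
  rw [← ENNReal.pow_le_pow_left_iff two_ne_zero, mul_pow, ← lintegral_enorm_sq_eq,
    ← lintegral_enorm_sq_eq, lintegral_eq_lintegral_Ioi_add]
  simp_rw [oscOp_neg]
  refine (add_le_add (lintegral_oscOp_Ioi_le hc hs hb)
    (lintegral_oscOp_Ioi_le (h := fun v => h (-v)) (by fun_prop) hsneg hb)).trans ?_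
  rw [hneg, ← add_mul]
  refine mul_le_mul' ?_ le_rfl
  rw [show 6 * Real.pi = 3 * (2 * Real.pi) by ring,
    ENNReal.ofReal_mul (p := 3) (q := 2 * Real.pi) (by norm_num), mul_pow, ← add_mul]
  refine mul_le_mul' ?_ le_rfl
  norm_num

theorem bet_pos (t : ℝ) : 0 < bet t := Real.sqrt_pos.2 (by positivity)

theorem sinq_eq_oscKernel (p : Polynomial ℝ) (x y : ℝ × ℝ) :
    sinq p x y = oscKernel (bet (x.1 - y.1)) (x.2 + p.derivative.eval (x.1 + y.1) / 2)
      (y.2 + p.derivative.eval (x.1 + y.1) / 2) := by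
  rw [oscKernel, add_add_add_comm, add_halves, add_sub_add_right_eq_sub, sinq]
  split_ifs with hxy
  · simp [hxy]
  · rw [mul_sinc_mul (sub_ne_zero.2 hxy), theta]

/-- The phase separates, so `ℬ^{x₁,y₁}` is a modulated translate of `oscOp`. -/
theorem Bop_eq_oscOp (p : Polynomial ℝ) (γ x₁ y₁ : ℝ) (g : ℝ → ℂ) (x₂ : ℝ) :
    Bop p γ x₁ y₁ g x₂ =
      Complex.exp (((γ * ((x₁ - y₁) * x₂ ^ 2 - x₂ * p.eval (x₁ + y₁)) : ℝ) : ℂ) * Complex.I) *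
      oscOp (bet (x₁ - y₁)) (fun v =>
        Complex.exp (((γ * ((x₁ - y₁) * (v - p.derivative.eval (x₁ + y₁) / 2) ^ 2 +
          (v - p.derivative.eval (x₁ + y₁) / 2) * p.eval (x₁ + y₁)) : ℝ) : ℂ) * Complex.I) *
        g (v - p.derivative.eval (x₁ + y₁) / 2)) (x₂ + p.derivative.eval (x₁ + y₁) / 2) := by
  rw [oscOp, ← integral_add_right_eq_self _ (p.derivative.eval (x₁ + y₁) / 2), Bop,
    ← integral_const_mul]
  congr 1
  funext v
  simp only [sinq_eq_oscKernel, add_sub_cancel_right]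
  have e : Complex.exp (Complex.I * ((γ * Psi p (x₁, x₂) (y₁, v) : ℝ) : ℂ)) =
      Complex.exp (((γ * ((x₁ - y₁) * x₂ ^ 2 - x₂ * p.eval (x₁ + y₁)) : ℝ) : ℂ) * Complex.I) *
      Complex.exp (((γ * ((x₁ - y₁) * v ^ 2 + v * p.eval (x₁ + y₁)) : ℝ) : ℂ) * Complex.I) := by
    rw [← Complex.exp_add, ← add_mul, ← Complex.ofReal_add, mul_comm Complex.I, Psi]
    congr 3
    ring
  rw [e]
  ring

theorem stmt4 (n : ℕ) (hn : 1 ≤ n) (Γ : ℝ) (hΓ : 1 / 2 < Γ) :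
    ∃ C > 0,
      ∀ x₁ y₁ : ℝ,
      ∀ p : Polynomial ℝ, p.natDegree ≤ n →
      ∀ γ : ℝ, min 1 ((n : ℝ) / 2) ≤ |γ| → |γ| ≤ Γ →
      ∀ g : ℝ → ℂ, ContDiff ℝ (⊤ : ℕ∞) g → HasCompactSupport g →
        eLpNorm (Bop p γ x₁ y₁ g) 2 volume ≤ ENNReal.ofReal C * eLpNorm g 2 volume := by
  refine ⟨6 * Real.pi, by positivity, fun x₁ y₁ p _ γ _ _ g hg hgs => ?_⟩
  set a := p.eval (x₁ + y₁)
  set c := p.derivative.eval (x₁ + y₁) / 2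
  set h : ℝ → ℂ := fun v => Complex.exp (((γ * ((x₁ - y₁) * (v - c) ^ 2 + (v - c) * a) : ℝ) : ℂ) *
    Complex.I) * g (v - c) with hh
  have hgc := hg.continuous
  have hc : Continuous h := by fun_prop
  have hs : HasCompactSupport h :=
    HasCompactSupport.mul_left (hgs.comp_homeomorph (Homeomorph.subRight c))
  have hleft : eLpNorm (Bop p γ x₁ y₁ g) 2 = eLpNorm (fun x => oscOp (bet (x₁ - y₁)) h (x + c)) 2 :=
    eLpNorm_congr_norm_ae <| .of_forall fun x => by
      rw [Bop_eq_oscOp, norm_mul, Complex.norm_exp_ofReal_mul_I, one_mul]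
  have hright : eLpNorm h 2 = eLpNorm g 2 := by
    rw [eLpNorm_congr_norm_ae (g := g ∘ fun v => v - c) <| .of_forall fun x => by
      rw [hh, norm_mul, Complex.norm_exp_ofReal_mul_I, one_mul, Function.comp_apply]]
    exact eLpNorm_comp_measurePreserving hgc.aestronglyMeasurable
      (measurePreserving_sub_right volume c)
  have htrans : eLpNorm (fun x => oscOp (bet (x₁ - y₁)) h (x + c)) 2 =
      eLpNorm (oscOp (bet (x₁ - y₁)) h) 2 := by
    rw [← (ENNReal.pow_right_strictMono two_ne_zero).injective.eq_iff, ← lintegral_enorm_sq_eq,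
      ← lintegral_enorm_sq_eq]
    exact lintegral_add_right_eq_self (fun x => ‖oscOp (bet (x₁ - y₁)) h x‖ₑ ^ 2) c
  rw [hleft, htrans, ← hright]
  exact eLpNorm_oscOp_le hc hs (bet_pos _)

end
end

section
/- There is an admissible constant C (depending only on n, Γ and η₀) such that for every R ≥ 100, every real polynomial p of degree at most n, every γ with min{1, n/2} ≤ |γ| ≤ Γ, and every f ∈ C_c^∞(ℝ²), one has ‖𝒪^R f − 𝒯^R f‖_{L²(ℝ²)} ≤ C · ‖f‖_{L²(ℝ²)}. -/
/- STATEMENT 6: 𝒪^R − 𝒯^R is bounded on L²(ℝ²) uniformly in R. -/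

open MeasureTheory Polynomial

noncomputable section

/-- The kernel of the singular oscillatory integral operator `𝒪^R`. -/
def Oker (p : Polynomial ℝ) (γ R : ℝ) (x y : ℝ × ℝ) : ℂ :=
  Complex.exp (Complex.I * (γ * Psi p x y : ℝ)) * (sinq p x y : ℝ) *
    ((bet (x.1 - y.1))⁻¹ : ℝ) * (if |x.1 - y.1| ≤ R then 1 else 0)

/-- The operator `𝒪^R`. -/
def Oop (p : Polynomial ℝ) (γ R : ℝ) (f : ℝ × ℝ → ℂ) (x : ℝ × ℝ) : ℂ :=
  ∫ y : ℝ × ℝ, Oker p γ R x y * f y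

/-- `g` has only finitely many sign changes: there is a uniform bound `N` on the length of
increasing chains of points at which `g` changes sign between consecutive points. -/
def FinSignChanges (g : ℝ → ℝ) : Prop :=
  ∃ N : ℕ, ∀ s : ℕ → ℝ, StrictMono s →
    ∀ m : ℕ, (∀ i < m, g (s i) * g (s (i + 1)) < 0) → m ≤ N

/-- The standing hypotheses on the cut-off function `η₀`: smooth, even, `[0,1]`-valued,
`≡ 1` on `{|s| ≤ 1/2}`, `≡ 0` on `{|s| ≥ 3/4}`, and `η₀′` has finitely many sign changes. -/
structure CutoffFun (η₀ : ℝ → ℝ) : Prop where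
  smooth : ContDiff ℝ (⊤ : ℕ∞) η₀
  even : ∀ s, η₀ (-s) = η₀ s
  mem01 : ∀ s, η₀ s ∈ Set.Icc (0 : ℝ) 1
  eq_one : ∀ s, |s| ≤ 1 / 2 → η₀ s = 1
  eq_zero : ∀ s, 3 / 4 ≤ |s| → η₀ s = 0
  signChanges : FinSignChanges (deriv η₀)

/-- `η(s) = η₀(s/2) − η₀(s)`. -/
def etad (η₀ : ℝ → ℝ) (s : ℝ) : ℝ := η₀ (s / 2) - η₀ s

/-- `χ_{1,j₁}(s) = 2^{j₁}·η(2^{−j₁}s)/β(s)`. -/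
def chi1 (η₀ : ℝ → ℝ) (j₁ : ℤ) (s : ℝ) : ℝ :=
  (2 : ℝ) ^ j₁ * etad η₀ ((2 : ℝ) ^ (-j₁) * s) / bet s

/-- `χ_{2,j₂}(s) = 2^{j₂}·η(2^{−j₂}s)/s`. -/
def chi2 (η₀ : ℝ → ℝ) (j₂ : ℤ) (s : ℝ) : ℝ :=
  (2 : ℝ) ^ j₂ * etad η₀ ((2 : ℝ) ^ (-j₂) * s) / s

/-- The kernel `T_j(x,y) = 2^{−j₁−j₂}·χ_j(x−y)·e^{iγΨ(x,y)}·sin θ(x,y)`. -/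
def Tker (η₀ : ℝ → ℝ) (p : Polynomial ℝ) (γ : ℝ) (j : ℤ × ℤ) (x y : ℝ × ℝ) : ℂ :=
  ((2 : ℝ) ^ (-j.1 - j.2) * chi1 η₀ j.1 (x.1 - y.1) * chi2 η₀ j.2 (x.2 - y.2) *
      Real.sin (theta p x y) : ℝ) * Complex.exp (Complex.I * (γ * Psi p x y : ℝ))

/-- The operator 𝒯^R, summing the pieces `T_j` over `10 < j₁ ≤ log₂ R`. -/
def Toper (η₀ : ℝ → ℝ) (p : Polynomial ℝ) (γ R : ℝ) (f : ℝ × ℝ → ℂ) (x : ℝ × ℝ) : ℂ :=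
  ∑' j : ℤ × ℤ,
    Set.indicator {j : ℤ × ℤ | 10 < j.1 ∧ (j.1 : ℝ) ≤ Real.logb 2 R}
      (fun j => ∫ y : ℝ × ℝ, Tker η₀ p γ j x y * f y) j

/-- Bounded measurable functions on `ℝ` that vanish outside a bounded interval. -/
structure IsNice (g : ℝ → ℂ) : Prop where
  meas : Measurable g
  bdd : ∃ L : ℝ, ∀ v, ‖g v‖ ≤ L ∧ (L < |v| → g v = 0)

lemma lintegral_comp_abs (f : ℝ → ENNReal) :
    ∫⁻ x, f |x| = 2 * ∫⁻ x in Set.Ioi 0, f x := by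
  rw [← lintegral_add_compl (fun x => f |x|) (measurableSet_Ioi (a := (0:ℝ))), two_mul]
  congr 1
  · exact setLIntegral_congr_fun measurableSet_Ioi fun x hx => by
      simp only [abs_of_pos (Set.mem_Ioi.mp hx)]
  · rw [Set.compl_Ioi, setLIntegral_congr (Iio_ae_eq_Iic (a := (0:ℝ))).symm]
    have := (Measure.measurePreserving_neg (volume : Measure ℝ)).setLIntegral_comp_preimage_emb
      (MeasurableEquiv.neg ℝ).measurableEmbedding f (Set.Ioi 0)
    rw [← this]
    have hs : (Neg.neg ⁻¹' Set.Ioi (0:ℝ)) = Set.Iio 0 := by ext; simp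
    rw [hs]
    exact setLIntegral_congr_fun measurableSet_Iio fun x hx => by
      simp only [abs_of_neg (Set.mem_Iio.mp hx)]

lemma lintegral_Ioi_of_hasDerivAt {g g' : ℝ → ℝ} {l : ℝ}
    (hc : ContinuousWithinAt g (Set.Ici 0) 0)
    (hd : ∀ x ∈ Set.Ioi (0:ℝ), HasDerivAt g (g' x) x) (hn : ∀ x ∈ Set.Ioi (0:ℝ), 0 ≤ g' x)
    (hl : Filter.Tendsto g Filter.atTop (nhds l)) :
    ∫⁻ x in Set.Ioi 0, ENNReal.ofReal (g' x) = ENNReal.ofReal (l - g 0) := by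
  rw [← integral_Ioi_of_hasDerivAt_of_nonneg hc hd hn hl]
  rw [ofReal_integral_eq_lintegral_ofReal (integrableOn_Ioi_deriv_of_nonneg hc hd hn hl)]
  filter_upwards [ae_restrict_mem measurableSet_Ioi] with x hx using hn x hx

/-- The weighted Hilbert kernel has bounded row integrals. -/
lemma lintegral_hilbert_weight (u : ℝ) (hu : u ≠ 0) :
    ∫⁻ v : ℝ, ENNReal.ofReal (√|u| / (√|v| * (|u| + |v|))) = ENNReal.ofReal (2 * Real.pi) := by
  have h := lintegral_comp_abs (fun v => ENNReal.ofReal (√|u| / (√v * (|u| + v))))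
  rw [h]
  have hu' : 0 < |u| := abs_pos.mpr hu
  have hs : 0 < √|u| := Real.sqrt_pos.mpr hu'
  rw [lintegral_Ioi_of_hasDerivAt (g := fun v => 2 * Real.arctan (√v / √|u|)) (l := Real.pi)]
  · rw [show (2:ENNReal) = ENNReal.ofReal 2 by simp, ← ENNReal.ofReal_mul (by norm_num)]
    simp
  · exact Continuous.continuousWithinAt (by fun_prop)
  · intro v hv
    have hv' : 0 < v := hv
    have hsv : 0 < √v := Real.sqrt_pos.mpr hv'
    have h1 := (((Real.hasDerivAt_sqrt hv'.ne').div_const (√|u|)).arctan).const_mul 2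
    refine h1.congr_deriv ?_
    have e1 : √|u| ^ 2 = |u| := Real.sq_sqrt hu'.le
    have e2 : √v ^ 2 = v := Real.sq_sqrt hv'.le
    rw [div_pow, e1, e2]
    field_simp
    rw [e1]
  · intro v hv
    have hv' : 0 < v := hv
    positivity
  · have h2 : Filter.Tendsto (fun v : ℝ => √v / √|u|) Filter.atTop Filter.atTop :=
      Real.tendsto_sqrt_atTop.atTop_div_const hs
    have h3 := (Real.tendsto_arctan_atTop.mono_right nhdsWithin_le_nhds).comp h2
    have h4 := h3.const_mul 2
    rwa [show 2 * (Real.pi / 2) = Real.pi by ring] at h4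

/-- The weighted Cauchy kernel in the variables `b u²`, `b v²` has bounded row integrals. -/
lemma lintegral_cauchy_weight (b : ℝ) (hb : 0 < b) (u : ℝ) :
    ∫⁻ v : ℝ, ENNReal.ofReal (b * |v| / (1 + (b * (u ^ 2 - v ^ 2)) ^ 2)) ≤
      ENNReal.ofReal (2 * Real.pi) := by
  have h := lintegral_comp_abs
    (fun v => ENNReal.ofReal (b * v / (1 + (b * (u ^ 2 - v ^ 2)) ^ 2)))
  simp only [sq_abs] at h
  rw [h]
  rw [lintegral_Ioi_of_hasDerivAt (g := fun v => 1 / 2 * Real.arctan (b * (v ^ 2 - u ^ 2)))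
    (l := 1 / 2 * (Real.pi / 2))]
  · rw [show (2:ENNReal) = ENNReal.ofReal 2 by simp, ← ENNReal.ofReal_mul (by norm_num)]
    apply ENNReal.ofReal_le_ofReal
    have := Real.neg_pi_div_two_lt_arctan (b * (0 ^ 2 - u ^ 2))
    nlinarith [Real.pi_pos]
  · exact Continuous.continuousWithinAt (by fun_prop)
  · intro v hv
    have h1 := ((((hasDerivAt_pow 2 v).sub_const (u ^ 2)).const_mul b).arctan).const_mul (1 / 2)
    refine h1.congr_deriv ?_
    rw [show (b * (u ^ 2 - v ^ 2)) ^ 2 = (b * (v ^ 2 - u ^ 2)) ^ 2 by ring]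
    simp
    ring
  · intro v hv
    have hv' : 0 < v := hv
    positivity
  · have h2 : Filter.Tendsto (fun v : ℝ => b * (v ^ 2 - u ^ 2)) Filter.atTop Filter.atTop := by
      apply Filter.Tendsto.const_mul_atTop hb
      exact Filter.tendsto_atTop_add_const_right _ _ (Filter.tendsto_pow_atTop two_ne_zero)
    exact ((Real.tendsto_arctan_atTop.mono_right nhdsWithin_le_nhds).comp h2).const_mul _

/-- Schur's test in bilinear form. -/
lemma lintegral_schur {K K1 : ℝ → ℝ → ℝ} {A : ENNReal} (hm : Measurable (Function.uncurry K1))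
    (h0 : ∀ u v, 0 ≤ K1 u v)
    (hA : ∀ u ≠ 0, ∫⁻ v, ENNReal.ofReal (K1 u v) ≤ A)
    (hK : ∀ u ≠ 0, ∀ v ≠ 0, ∀ x y : ℝ, 2 * (K u v * x * y) ≤ K1 u v * x ^ 2 + K1 v u * y ^ 2)
    {F G : ℝ → ℂ} (hF : Measurable F) (hG : Measurable G) {f : ℝ × ℝ → ℂ}
    (hf : ∀ u v, u ≠ 0 → v ≠ 0 → ‖f (u, v)‖ ≤ K u v * ‖F u‖ * ‖G v‖) :
    2 * ‖∫ z, f z‖ₑ ≤ A * ((∫⁻ u, ‖F u‖ₑ ^ 2) + ∫⁻ u, ‖G u‖ₑ ^ 2) := by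
  have hm1 : Measurable fun z : ℝ × ℝ => ENNReal.ofReal (K1 z.1 z.2) := hm.ennreal_ofReal
  have hm2 : Measurable fun z : ℝ × ℝ => ENNReal.ofReal (K1 z.2 z.1) :=
    hm1.comp measurable_swap
  have hne : ∀ᵐ z : ℝ × ℝ, z.1 ≠ 0 ∧ z.2 ≠ 0 := by
    have h1 : ∀ᵐ u : ℝ, u ≠ 0 := by simp [ae_iff]
    exact (Measure.quasiMeasurePreserving_fst.ae h1).and
      (Measure.quasiMeasurePreserving_snd.ae h1)
  have half : ∀ H : ℝ → ℂ, Measurable H →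
      ∫⁻ z : ℝ × ℝ, ENNReal.ofReal (K1 z.1 z.2) * ‖H z.1‖ₑ ^ 2 ≤ A * ∫⁻ u, ‖H u‖ₑ ^ 2 := by
    intro H hH
    have hHm : Measurable fun u => ‖H u‖ₑ ^ 2 := by fun_prop
    rw [Measure.volume_eq_prod, lintegral_prod _ (by fun_prop), ← lintegral_const_mul _ hHm]
    apply lintegral_mono_ae
    have h1 : ∀ᵐ u : ℝ, u ≠ 0 := by simp [ae_iff]
    filter_upwards [h1] with u hu
    rw [lintegral_mul_const _ (by fun_prop)]
    gcongr
    exact hA u hu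
  calc 2 * ‖∫ z, f z‖ₑ ≤ 2 * ∫⁻ z, ‖f z‖ₑ := by
        gcongr; exact enorm_integral_le_lintegral_enorm _
    _ = ∫⁻ z, 2 * ‖f z‖ₑ := (lintegral_const_mul' _ _ (by simp)).symm
    _ ≤ ∫⁻ z : ℝ × ℝ, (ENNReal.ofReal (K1 z.1 z.2) * ‖F z.1‖ₑ ^ 2 +
          ENNReal.ofReal (K1 z.2 z.1) * ‖G z.2‖ₑ ^ 2) := by
        apply lintegral_mono_ae
        filter_upwards [hne] with z hz
        obtain ⟨u, v⟩ := z
        have h1 := hf u v hz.1 hz.2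
        have h2 := hK u hz.1 v hz.2 ‖F u‖ ‖G v‖
        have h3 : 2 * ‖f (u, v)‖ ≤ K1 u v * ‖F u‖ ^ 2 + K1 v u * ‖G v‖ ^ 2 := by linarith
        have h4 := ENNReal.ofReal_le_ofReal h3
        have p1 := h0 u v
        have p2 := h0 v u
        rw [ENNReal.ofReal_add (by positivity) (by positivity), ENNReal.ofReal_mul (by norm_num),
          ENNReal.ofReal_mul p1, ENNReal.ofReal_mul p2, ENNReal.ofReal_pow (norm_nonneg _),
          ENNReal.ofReal_pow (norm_nonneg _), ofReal_norm, ofReal_norm, ofReal_norm] at h4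
        simpa using h4
    _ = (∫⁻ z : ℝ × ℝ, ENNReal.ofReal (K1 z.1 z.2) * ‖F z.1‖ₑ ^ 2) +
          ∫⁻ z : ℝ × ℝ, ENNReal.ofReal (K1 z.2 z.1) * ‖G z.2‖ₑ ^ 2 :=
        lintegral_add_left (by fun_prop) _
    _ ≤ A * (∫⁻ u, ‖F u‖ₑ ^ 2) + A * ∫⁻ u, ‖G u‖ₑ ^ 2 := by
        gcongr
        · exact half F hF
        · have := (Measure.measurePreserving_swap (μ := (volume : Measure ℝ))
            (ν := (volume : Measure ℝ))).lintegral_comp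
            (f := fun z : ℝ × ℝ => ENNReal.ofReal (K1 z.1 z.2) * ‖G z.1‖ₑ ^ 2) (by fun_prop)
          rw [Measure.volume_eq_prod]
          exact this.le.trans (half G hG)
    _ = _ := by ring

lemma IsNice.integrable_sq {g : ℝ → ℂ} (hg : IsNice g) : Integrable fun v => ‖g v‖ ^ 2 := by
  obtain ⟨L, hL⟩ := hg.bdd
  have hm := hg.meas
  refine Integrable.mono' (g := (Set.Icc (-L) L).indicator fun _ => L ^ 2)
    ((integrable_indicator_iff measurableSet_Icc).2 (by simp)) (by fun_prop) ?_
  refine Filter.Eventually.of_forall fun v => ?_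
  by_cases hv : v ∈ Set.Icc (-L) L
  · rw [Set.indicator_of_mem hv]
    simp only [norm_pow, norm_norm]
    exact pow_le_pow_left₀ (norm_nonneg _) (hL v).1 2
  · have : L < |v| := by
      by_contra h
      exact hv (abs_le.mp (not_lt.mp h))
    simp [Set.indicator_of_notMem hv, (hL v).2 this]

lemma IsNice.lintegral_sq {g : ℝ → ℂ} (hg : IsNice g) :
    ∫⁻ v, ‖g v‖ₑ ^ 2 = ENNReal.ofReal (∫ v, ‖g v‖ ^ 2) := by
  rw [ofReal_integral_eq_lintegral_ofReal hg.integrable_sq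
    (Filter.Eventually.of_forall fun v => by positivity)]
  simp [ENNReal.ofReal_pow, ofReal_norm]

lemma norm_integral_schur {K K1 : ℝ → ℝ → ℝ} {A : ℝ} (hA0 : 0 ≤ A)
    (hm : Measurable (Function.uncurry K1)) (h0 : ∀ u v, 0 ≤ K1 u v)
    (hA : ∀ u ≠ 0, ∫⁻ v, ENNReal.ofReal (K1 u v) ≤ ENNReal.ofReal A)
    (hK : ∀ u ≠ 0, ∀ v ≠ 0, ∀ x y : ℝ, 2 * (K u v * x * y) ≤ K1 u v * x ^ 2 + K1 v u * y ^ 2)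
    {F G : ℝ → ℂ} (hF : IsNice F) (hG : IsNice G) {f : ℝ × ℝ → ℂ}
    (hf : ∀ u v, u ≠ 0 → v ≠ 0 → ‖f (u, v)‖ ≤ K u v * ‖F u‖ * ‖G v‖) :
    2 * ‖∫ z, f z‖ ≤ A * ((∫ u, ‖F u‖ ^ 2) + ∫ u, ‖G u‖ ^ 2) := by
  have h := lintegral_schur hm h0 hA hK hF.meas hG.meas hf
  have i1 : 0 ≤ ∫ u, ‖F u‖ ^ 2 := integral_nonneg fun _ => by positivity
  have i2 : 0 ≤ ∫ u, ‖G u‖ ^ 2 := integral_nonneg fun _ => by positivity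
  rw [hF.lintegral_sq, hG.lintegral_sq, ← ENNReal.ofReal_add i1 i2, ← ENNReal.ofReal_mul hA0,
    ← ofReal_norm, show (2:ENNReal) = ENNReal.ofReal 2 by simp,
    ← ENNReal.ofReal_mul (by norm_num)] at h
  exact (ENNReal.ofReal_le_ofReal_iff (by positivity)).1 h

/-- Hilbert's inequality. -/
lemma norm_integral_hilbert {F G : ℝ → ℂ} (hF : IsNice F) (hG : IsNice G) {f : ℝ × ℝ → ℂ}
    (hf : ∀ u v, u ≠ 0 → v ≠ 0 → ‖f (u, v)‖ ≤ 1 / (|u| + |v|) * ‖F u‖ * ‖G v‖) :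
    2 * ‖∫ z, f z‖ ≤ 2 * Real.pi * ((∫ u, ‖F u‖ ^ 2) + ∫ u, ‖G u‖ ^ 2) := by
  refine norm_integral_schur (K1 := fun u v => √|u| / (√|v| * (|u| + |v|))) (by positivity)
    (by unfold Function.uncurry; fun_prop) (fun u v => by positivity)
    (fun u hu => (lintegral_hilbert_weight u hu).le) ?_ hF hG hf
  intro u hu v hv x y
  have hu' : 0 < √|u| := Real.sqrt_pos.mpr (abs_pos.mpr hu)
  have hv' : 0 < √|v| := Real.sqrt_pos.mpr (abs_pos.mpr hv)
  have hs : 0 < |u| + |v| := by positivity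
  have key : √|u| / (√|v| * (|u| + |v|)) * x ^ 2 + √|v| / (√|u| * (|v| + |u|)) * y ^ 2
      - 2 * (1 / (|u| + |v|) * x * y) =
      (√|u| * x - √|v| * y) ^ 2 / (√|u| * √|v| * (|u| + |v|)) := by
    rw [add_comm |v| |u|]
    field_simp
    ring
  have : 0 ≤ (√|u| * x - √|v| * y) ^ 2 / (√|u| * √|v| * (|u| + |v|)) := by positivity
  linarith

lemma norm_integral_cauchy (b : ℝ) (hb : 0 < b) {F G : ℝ → ℂ} (hF : IsNice F) (hG : IsNice G)
    {f : ℝ × ℝ → ℂ} (hf : ∀ u v, u ≠ 0 → v ≠ 0 → ‖f (u, v)‖ ≤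
      b * (√|u| * √|v|) / (1 + (b * (u ^ 2 - v ^ 2)) ^ 2) * ‖F u‖ * ‖G v‖) :
    2 * ‖∫ z, f z‖ ≤ 2 * Real.pi * ((∫ u, ‖F u‖ ^ 2) + ∫ u, ‖G u‖ ^ 2) := by
  refine norm_integral_schur
    (K1 := fun u v => b * |v| / (1 + (b * (u ^ 2 - v ^ 2)) ^ 2)) (by positivity)
    (by unfold Function.uncurry; fun_prop) (fun u v => by positivity)
    (fun u hu => lintegral_cauchy_weight b hb u) ?_ hF hG hf
  intro u hu v hv x y
  have e1 : √|u| ^ 2 = |u| := Real.sq_sqrt (abs_nonneg u)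
  have e2 : √|v| ^ 2 = |v| := Real.sq_sqrt (abs_nonneg v)
  have key : b * |v| / (1 + (b * (u ^ 2 - v ^ 2)) ^ 2) * x ^ 2
      + b * |u| / (1 + (b * (v ^ 2 - u ^ 2)) ^ 2) * y ^ 2
      - 2 * (b * (√|u| * √|v|) / (1 + (b * (u ^ 2 - v ^ 2)) ^ 2) * x * y) =
      b * (√|v| * x - √|u| * y) ^ 2 / (1 + (b * (u ^ 2 - v ^ 2)) ^ 2) := by
    rw [show (b * (v ^ 2 - u ^ 2)) ^ 2 = (b * (u ^ 2 - v ^ 2)) ^ 2 by ring]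
    rw [show (√|v| * x - √|u| * y) ^ 2 = √|v| ^ 2 * x ^ 2 + √|u| ^ 2 * y ^ 2
      - 2 * (√|u| * √|v| * x * y) by ring, e1, e2]
    ring
  have : 0 ≤ b * (√|v| * x - √|u| * y) ^ 2 / (1 + (b * (u ^ 2 - v ^ 2)) ^ 2) := by positivity
  linarith

lemma IsNice.integrable {g : ℝ → ℂ} (hg : IsNice g) : Integrable g := by
  obtain ⟨L, hL⟩ := hg.bdd
  refine Integrable.mono' (g := (Set.Icc (-L) L).indicator fun _ => L)
    ((integrable_indicator_iff measurableSet_Icc).2 (by simp)) hg.meas.aestronglyMeasurable ?_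
  refine Filter.Eventually.of_forall fun v => ?_
  by_cases hv : v ∈ Set.Icc (-L) L
  · rw [Set.indicator_of_mem hv]
    exact (hL v).1
  · have : L < |v| := by
      by_contra h
      exact hv (abs_le.mp (not_lt.mp h))
    simp [Set.indicator_of_notMem hv, (hL v).2 this]

lemma IsNice.mul {g m : ℝ → ℂ} (hg : IsNice g) (hm : Measurable m)
    (hb : ∀ L : ℝ, ∃ M : ℝ, ∀ v, |v| ≤ L → ‖m v‖ ≤ M) : IsNice fun v => m v * g v := by
  obtain ⟨L, hL⟩ := hg.bdd
  obtain ⟨M, hM⟩ := hb L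
  refine ⟨hm.mul hg.meas, max L (|M| * |L|), fun v => ⟨?_, fun hv => ?_⟩⟩
  · rcases le_or_gt |v| L with h | h
    · rw [norm_mul]
      exact (mul_le_mul ((hM v h).trans (le_abs_self _)) ((hL v).1.trans (le_abs_self _))
        (norm_nonneg _) (abs_nonneg _)).trans (le_max_right _ _)
    · rw [(hL v).2 h, mul_zero, norm_zero]
      exact le_max_of_le_right (by positivity)
  · rw [(hL v).2 ((le_max_left _ _).trans_lt hv), mul_zero]

lemma IsNice.mul_continuous {g m : ℝ → ℂ} (hg : IsNice g) (hm : Continuous m) :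
    IsNice fun v => m v * g v := by
  refine hg.mul hm.measurable fun L => ?_
  obtain ⟨M, hM⟩ := (isCompact_Icc (a := -L) (b := L)).exists_bound_of_continuousOn
    hm.continuousOn
  exact ⟨M, fun v hv => hM v (abs_le.mp hv)⟩

lemma IsNice.indicator {g : ℝ → ℂ} (hg : IsNice g) {s : Set ℝ} (hs : MeasurableSet s) :
    IsNice (s.indicator g) := by
  obtain ⟨L, hL⟩ := hg.bdd
  refine ⟨hg.meas.indicator hs, L, fun v => ⟨?_, fun hv => ?_⟩⟩
  · exact (norm_indicator_le_norm_self g v).trans (hL v).1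
  · by_cases hvs : v ∈ s <;> simp [hvs, (hL v).2 hv]

lemma IsNice.star {g : ℝ → ℂ} (hg : IsNice g) : IsNice fun v => starRingEnd ℂ (g v) := by
  obtain ⟨L, hL⟩ := hg.bdd
  refine ⟨Complex.continuous_conj.measurable.comp hg.meas, L, fun v => ⟨?_, fun hv => ?_⟩⟩
  · simpa using (hL v).1
  · simp [(hL v).2 hv]

/-- Fourier-type integral of the amplitude `a` with phase `q` at frequency `τ`. -/
def osc (a : ℝ → ℂ) (q : ℝ → ℝ) (τ : ℝ) : ℂ :=
  ∫ u, a u * Complex.exp ((-(τ * q u) : ℝ) * Complex.I)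

lemma norm_osc_le (a : ℝ → ℂ) (q : ℝ → ℝ) (τ : ℝ) : ‖osc a q τ‖ ≤ ∫ u, ‖a u‖ := by
  refine (norm_integral_le_integral_norm _).trans_eq ?_
  simp only [norm_mul, Complex.norm_exp_ofReal_mul_I, mul_one]

lemma stronglyMeasurable_osc {a : ℝ → ℂ} {q : ℝ → ℝ} (ha : Measurable a) (hq : Measurable q) :
    StronglyMeasurable (osc a q) := by
  refine StronglyMeasurable.integral_prod_right
    (f := fun τ u => a u * Complex.exp ((-(τ * q u) : ℝ) * Complex.I)) ?_
  apply Measurable.stronglyMeasurable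
  unfold Function.uncurry
  fun_prop

lemma conj_osc (a : ℝ → ℂ) (q : ℝ → ℝ) (τ : ℝ) :
    starRingEnd ℂ (osc a q τ) = osc (fun u => starRingEnd ℂ (a u)) q (-τ) := by
  unfold osc
  rw [← integral_conj]
  congr 1
  ext u
  rw [map_mul, ← Complex.exp_conj]
  simp

lemma integral_mul_osc_mul_osc {w a c : ℝ → ℂ} {q : ℝ → ℝ} (hw : Integrable w)
    (ha : Integrable a) (hc : Integrable c) (hq : Measurable q) :
    ∫ τ, w τ * (osc a q τ * osc c q (-τ)) =
      ∫ z : ℝ × ℝ, a z.1 * c z.2 *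
        ∫ τ, w τ * Complex.exp ((-(τ * (q z.1 - q z.2)) : ℝ) * Complex.I) := by
  have h1 : ∀ τ, w τ * (osc a q τ * osc c q (-τ)) = ∫ z : ℝ × ℝ, w τ * (a z.1 * c z.2) *
      Complex.exp ((-(τ * (q z.1 - q z.2)) : ℝ) * Complex.I) := by
    intro τ
    unfold osc
    rw [← integral_prod_mul, ← Measure.volume_eq_prod, ← integral_const_mul]
    congr 1
    ext z
    have : Complex.exp ((-(τ * (q z.1 - q z.2)) : ℝ) * Complex.I) =
        Complex.exp ((-(τ * q z.1) : ℝ) * Complex.I) *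
        Complex.exp ((-(-τ * q z.2) : ℝ) * Complex.I) := by
      rw [← Complex.exp_add]
      congr 1
      push_cast
      ring
    rw [this]
    ring
  simp_rw [h1]
  rw [integral_integral_swap]
  · congr 1
    ext z
    rw [← integral_const_mul]
    congr 1
    ext τ
    ring
  · have hi : Integrable (fun y : ℝ × (ℝ × ℝ) => w y.1 * (a y.2.1 * c y.2.2))
        (volume.prod volume) := hw.mul_prod (ha.mul_prod hc)
    refine (hi.norm).mono' ?_ ?_
    · refine hi.aestronglyMeasurable.mul ?_
      apply Measurable.aestronglyMeasurable
      fun_prop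
    · refine Filter.Eventually.of_forall fun y => ?_
      simp only [Function.uncurry, norm_mul, Complex.norm_exp_ofReal_mul_I, mul_one]
      exact le_rfl

lemma integral_exp_neg_mul_I (s : ℝ) :
    ∫ τ in (-1:ℝ)..1, Complex.exp ((-(τ * s) : ℝ) * Complex.I) = (2 * Real.sinc s : ℝ) := by
  rcases eq_or_ne s 0 with rfl | hs
  · simp; norm_num
  · have h := intervalIntegral.integral_comp_mul_right (a := -1) (b := 1)
      (fun t : ℝ => Complex.exp (t * Complex.I)) (neg_ne_zero.mpr hs)
    have e : ∀ τ : ℝ, Complex.exp ((-(τ * s) : ℝ) * Complex.I) =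
        Complex.exp (((τ * -s : ℝ) : ℂ) * Complex.I) := fun τ => by simp
    simp_rw [e]
    rw [h, show -1 * -s = -(-s) by ring, show 1 * -s = -s by ring, integral_exp_mul_I_eq_sinc]
    rw [Real.sinc_neg, Complex.real_smul]
    have : (s : ℂ) ≠ 0 := by exact_mod_cast hs
    push_cast
    field_simp

lemma norm_integral_gaussian_le (s : ℝ) :
    ‖∫ τ : ℝ, (Real.exp (-(1 / 4) * τ ^ 2) : ℂ) *
      Complex.exp ((-(τ * s) : ℝ) * Complex.I)‖ ≤ 4 / (1 + s ^ 2) := by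
  have h := fourierIntegral_gaussian (b := 1 / 4) (by norm_num) (-s)
  have e : ∀ τ : ℝ, (Real.exp (-(1 / 4) * τ ^ 2) : ℂ) *
      Complex.exp ((-(τ * s) : ℝ) * Complex.I) =
      Complex.exp (Complex.I * (-s) * τ) * Complex.exp (-(1 / 4) * τ ^ 2) := by
    intro τ
    rw [mul_comm]
    congr 1
    · congr 1; push_cast; ring
    · push_cast; rfl
  simp_rw [e]
  rw [h, norm_mul]
  have h1 : ‖Complex.exp (-(-(s:ℂ)) ^ 2 / (4 * (1 / 4)))‖ = Real.exp (-s ^ 2) := by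
    rw [Complex.norm_exp]
    congr 1
    have : (-(-(s:ℂ)) ^ 2 / (4 * (1 / 4))) = ((-s ^ 2 : ℝ) : ℂ) := by push_cast; ring
    rw [this, Complex.ofReal_re]
  have h2 : ‖((Real.pi : ℂ) / (1 / 4)) ^ (1 / 2 : ℂ)‖ ≤ 4 := by
    have e1 : ((Real.pi : ℂ) / (1 / 4)) = ((4 * Real.pi : ℝ) : ℂ) := by push_cast; ring
    rw [e1, Complex.norm_cpow_eq_rpow_re_of_pos (by positivity)]
    have : ((1 / 2 : ℂ)).re = 1 / 2 := by norm_num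
    rw [this, ← Real.sqrt_eq_rpow, Real.sqrt_le_left (by norm_num)]
    nlinarith [Real.pi_le_four]
  rw [h1]
  have h3 : Real.exp (-s ^ 2) ≤ 1 / (1 + s ^ 2) := by
    rw [Real.exp_neg, ← one_div]
    apply one_div_le_one_div_of_le (by positivity)
    linarith [Real.add_one_le_exp (s ^ 2)]
  calc _ ≤ 4 * (1 / (1 + s ^ 2)) := mul_le_mul h2 h3 (by positivity) (by norm_num)
    _ = _ := by ring

/-- The amplitude turning `v ↦ b v²` into an arc-length parameter. -/
def amp (b : ℝ) (g : ℝ → ℂ) (v : ℝ) : ℂ := ((√b * √|v| : ℝ) : ℂ) * g v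

lemma isNice_amp (b : ℝ) {g : ℝ → ℂ} (hg : IsNice g) : IsNice (amp b g) :=
  hg.mul_continuous (by fun_prop)

lemma integral_sq_nonneg (g : ℝ → ℂ) : 0 ≤ ∫ v, ‖g v‖ ^ 2 :=
  integral_nonneg fun _ => by positivity

lemma integrable_osc_sq {a : ℝ → ℂ} {q : ℝ → ℝ} (ha : Measurable a) (hq : Measurable q)
    {w : ℝ → ℝ} (hw : Integrable w) : Integrable fun τ => w τ * ‖osc a q τ‖ ^ 2 := by
  refine (hw.bdd_mul (c := (∫ u, ‖a u‖) ^ 2) (f := fun τ => ‖osc a q τ‖ ^ 2) ?_ ?_).congr ?_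
  · exact ((stronglyMeasurable_osc ha hq).norm.pow 2).aestronglyMeasurable
  · refine Filter.Eventually.of_forall fun τ => ?_
    simp only [norm_pow, norm_norm]
    exact pow_le_pow_left₀ (norm_nonneg _) (norm_osc_le a q τ) 2
  · exact Filter.Eventually.of_forall fun τ => mul_comm _ _

/-- A local Plancherel inequality. -/
lemma integral_osc_sq_le {b : ℝ} (hb : 0 < b) {g : ℝ → ℂ} (hg : IsNice g) :
    ∫ τ in (-1:ℝ)..1, ‖osc (amp b g) (fun v => b * v ^ 2) τ‖ ^ 2 ≤
      16 * Real.pi * ∫ v, ‖g v‖ ^ 2 := by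
  set q : ℝ → ℝ := fun v => b * v ^ 2 with hq
  have hqm : Measurable q := by fun_prop
  have ha := isNice_amp b hg
  have hwi : Integrable fun τ : ℝ => Real.exp (-(1 / 4) * τ ^ 2) :=
    integrable_exp_neg_mul_sq (by norm_num)
  have hint := integrable_osc_sq ha.meas hqm hwi
  have step1 : ∫ τ in (-1:ℝ)..1, ‖osc (amp b g) q τ‖ ^ 2 ≤
      2 * ∫ τ, Real.exp (-(1 / 4) * τ ^ 2) * ‖osc (amp b g) q τ‖ ^ 2 := by
    rw [intervalIntegral.integral_of_le (by norm_num), ← integral_const_mul]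
    refine le_trans (integral_mono_of_nonneg (Filter.Eventually.of_forall fun τ => by positivity)
      (hint.const_mul 2).integrableOn ?_)
      (setIntegral_le_integral (hint.const_mul 2)
        (Filter.Eventually.of_forall fun τ => by positivity))
    filter_upwards [ae_restrict_mem measurableSet_Ioc] with τ hτ
    have h1 : 1 ≤ 2 * Real.exp (-(1 / 4) * τ ^ 2) := by
      have := Real.add_one_le_exp (-(1 / 4) * τ ^ 2)
      nlinarith [hτ.1, hτ.2]
    calc ‖osc (amp b g) q τ‖ ^ 2 = 1 * ‖osc (amp b g) q τ‖ ^ 2 := (one_mul _).symm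
      _ ≤ (2 * Real.exp (-(1 / 4) * τ ^ 2)) * ‖osc (amp b g) q τ‖ ^ 2 := by gcongr
      _ = _ := by ring
  have step2 := integral_mul_osc_mul_osc (w := fun τ => (Real.exp (-(1 / 4) * τ ^ 2) : ℂ))
    hwi.ofReal ha.integrable ha.star.integrable hqm
  have step3 : ∫ τ : ℝ, (Real.exp (-(1 / 4) * τ ^ 2) : ℂ) * (osc (amp b g) q τ *
      osc (fun u => starRingEnd ℂ (amp b g u)) q (-τ)) =
      ((∫ τ, Real.exp (-(1 / 4) * τ ^ 2) * ‖osc (amp b g) q τ‖ ^ 2 : ℝ) : ℂ) := by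
    rw [← integral_complex_ofReal]
    congr 1
    ext τ
    rw [← conj_osc, Complex.mul_conj, Complex.normSq_eq_norm_sq]
    push_cast
    rfl
  have step4 := norm_integral_cauchy b hb hg hg (f := fun z => (1 / 4 : ℂ) *
    (amp b g z.1 * starRingEnd ℂ (amp b g z.2) * ∫ τ, (Real.exp (-(1 / 4) * τ ^ 2) : ℂ) *
      Complex.exp ((-(τ * (q z.1 - q z.2)) : ℝ) * Complex.I))) (by
    intro u v _ _
    have h := norm_integral_gaussian_le (q u - q v)
    have hs : √b * √b = b := Real.mul_self_sqrt hb.le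
    simp only [norm_mul, amp, RCLike.norm_conj, Complex.norm_real, Real.norm_eq_abs,
      abs_of_nonneg (Real.sqrt_nonneg _)]
    calc _ ≤ ‖(1 / 4 : ℂ)‖ * (√b * √|u| * ‖g u‖ * (√b * √|v| * ‖g v‖) *
          (4 / (1 + (q u - q v) ^ 2))) := by
          gcongr
      _ = (√b * √b) * (√|u| * √|v|) / (1 + (b * (u ^ 2 - v ^ 2)) ^ 2) * ‖g u‖ * ‖g v‖ := by
          rw [show q u - q v = b * (u ^ 2 - v ^ 2) by simp only [hq]; ring]
          norm_num
          ring
      _ = _ := by rw [hs])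
  rw [integral_const_mul, norm_mul, ← step2, step3, Complex.norm_real, Real.norm_eq_abs] at step4
  have hnn := le_abs_self (∫ τ, Real.exp (-(1 / 4) * τ ^ 2) * ‖osc (amp b g) q τ‖ ^ 2)
  norm_num at step4
  norm_num at step1 hnn ⊢
  linarith

/-- The model kernel `sin(b|u+v|(u−v))/(u−v)`, extended continuously across `u = v`. -/
def modelKer (b u v : ℝ) : ℝ :=
  if u = v then b * |u + v| else Real.sin (b * |u + v| * (u - v)) / (u - v)

lemma abs_modelKer_le {b : ℝ} (hb : 0 < b) (u v : ℝ) : |modelKer b u v| ≤ b * |u + v| := by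
  unfold modelKer
  split_ifs with h
  · rw [abs_of_nonneg (by positivity)]
  · have h' : 0 < |u - v| := abs_pos.mpr (sub_ne_zero.mpr h)
    rw [abs_div, div_le_iff₀ h']
    refine (Real.abs_sin_le_abs).trans_eq ?_
    rw [abs_mul, abs_of_nonneg (by positivity : 0 ≤ b * |u + v|)]

lemma measurable_modelKer (b : ℝ) : Measurable fun z : ℝ × ℝ => modelKer b z.1 z.2 := by
  unfold modelKer
  refine Measurable.ite (measurableSet_eq_fun measurable_fst measurable_snd) ?_ ?_ <;> fun_prop

lemma abs_modelKer_le_of_neg (b : ℝ) {u v : ℝ} (h : u * v < 0) :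
    |modelKer b u v| ≤ 1 / (|u| + |v|) := by
  have hne : u ≠ v := by
    rintro rfl
    nlinarith [mul_self_nonneg u]
  have hs : |u - v| = |u| + |v| := by
    rcases mul_neg_iff.mp h with ⟨h1, h2⟩ | ⟨h1, h2⟩
    · rw [abs_of_pos h1, abs_of_neg h2, abs_of_pos (by linarith)]; ring
    · rw [abs_of_neg h1, abs_of_pos h2, abs_of_neg (by linarith)]; ring
  unfold modelKer
  rw [if_neg hne, abs_div, hs]
  gcongr
  exact Real.abs_sin_le_one _

lemma modelKer_neg_neg (b u v : ℝ) : modelKer b (-u) (-v) = modelKer b u v := by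
  unfold modelKer
  rw [show -u + -v = -(u + v) by ring, abs_neg, show -u - -v = -(u - v) by ring, mul_neg,
    Real.sin_neg, neg_div_neg_eq]
  simp only [neg_inj]

lemma abs_modelKer_sub_le {b : ℝ} (hb : 0 < b) {u v : ℝ} (h : 0 < u * v) :
    |modelKer b u v - b * (√|u| * √|v|) * (2 * Real.sinc (b * u ^ 2 - b * v ^ 2))| ≤
      1 / (|u| + |v|) := by
  wlog hu : 0 < u generalizing u v
  · have := this (u := -u) (v := -v) (by linarith) (by
      rcases lt_or_eq_of_le (not_lt.mp hu) with h1 | h1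
      · linarith
      · simp [h1] at h)
    simpa [modelKer_neg_neg] using this
  have hv : 0 < v := (mul_pos_iff_of_pos_left hu).mp h
  rw [abs_of_pos hu, abs_of_pos hv]
  obtain ⟨x, hx, rfl⟩ : ∃ x, 0 < x ∧ x ^ 2 = u := ⟨√u, Real.sqrt_pos.mpr hu, Real.sq_sqrt hu.le⟩
  obtain ⟨y, hy, rfl⟩ : ∃ x, 0 < x ∧ x ^ 2 = v := ⟨√v, Real.sqrt_pos.mpr hv, Real.sq_sqrt hv.le⟩
  rw [Real.sqrt_sq hx.le, Real.sqrt_sq hy.le]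
  unfold modelKer
  split_ifs with e
  · have e' : x = y := by
      rwa [pow_left_inj₀ hx.le hy.le two_ne_zero] at e
    subst e'
    have hpos : |x ^ 2 + x ^ 2| = x ^ 2 + x ^ 2 := abs_of_pos (by positivity)
    rw [sub_self, Real.sinc_zero, hpos]
    rw [show b * (x ^ 2 + x ^ 2) - b * (x * x) * (2 * 1) = 0 by ring, abs_zero]
    positivity
  · have hd : x ^ 2 - y ^ 2 ≠ 0 := sub_ne_zero.mpr e
    have hX : b * (x ^ 2) ^ 2 - b * (y ^ 2) ^ 2 ≠ 0 := by
      rw [show b * (x ^ 2) ^ 2 - b * (y ^ 2) ^ 2 = b * (x ^ 2 + y ^ 2) * (x ^ 2 - y ^ 2) by ring]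
      exact mul_ne_zero (by positivity) hd
    rw [Real.sinc_of_ne_zero hX, abs_of_pos (by positivity : 0 < x ^ 2 + y ^ 2),
      show b * (x ^ 2) ^ 2 - b * (y ^ 2) ^ 2 = b * (x ^ 2 + y ^ 2) * (x ^ 2 - y ^ 2) by ring]
    set S := Real.sin (b * (x ^ 2 + y ^ 2) * (x ^ 2 - y ^ 2)) with hS
    have hxy : x - y ≠ 0 := fun h0 => hd (by rw [sub_eq_zero.mp h0, sub_self])
    have e2 : S / (x ^ 2 - y ^ 2) - b * (x * y) * (2 * (S / (b * (x ^ 2 + y ^ 2) * (x ^ 2 - y ^ 2))))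
        = S * ((x - y) / ((x + y) * (x ^ 2 + y ^ 2))) := by
      have : x + y ≠ 0 := by positivity
      have h2 : x ^ 2 + y ^ 2 ≠ 0 := by positivity
      have h3 : x ^ 2 - y ^ 2 = (x - y) * (x + y) := by ring
      rw [h3]
      field_simp
      ring
    rw [e2, abs_mul, abs_div, abs_of_pos (by positivity : 0 < (x + y) * (x ^ 2 + y ^ 2))]
    have h4 : |x - y| ≤ x + y := abs_le.mpr ⟨by linarith, by linarith⟩
    calc |S| * (|x - y| / ((x + y) * (x ^ 2 + y ^ 2)))
        ≤ 1 * ((x + y) / ((x + y) * (x ^ 2 + y ^ 2))) := by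
          gcongr
          exact Real.abs_sin_le_one _
      _ = _ := by field_simp

lemma integrable_sinc_form (b : ℝ) {F G : ℝ → ℂ} (hF : IsNice F) (hG : IsNice G) :
    Integrable fun z : ℝ × ℝ => amp b F z.1 * amp b G z.2 *
      ((2 * Real.sinc (b * z.1 ^ 2 - b * z.2 ^ 2) : ℝ) : ℂ) := by
  have h := (isNice_amp b hF).integrable.mul_prod (isNice_amp b hG).integrable
  refine h.mul_bdd (c := 2) ?_ (Filter.Eventually.of_forall fun z => ?_)
  · have := Real.continuous_sinc
    exact Continuous.aestronglyMeasurable (by fun_prop)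
  · rw [Complex.norm_real, Real.norm_eq_abs, abs_mul, abs_two]
    linarith [Real.abs_sinc_le_one (b * z.1 ^ 2 - b * z.2 ^ 2)]

lemma norm_integral_sinc_form {b : ℝ} (hb : 0 < b) {F G : ℝ → ℂ} (hF : IsNice F)
    (hG : IsNice G) :
    2 * ‖∫ z : ℝ × ℝ, amp b F z.1 * amp b G z.2 *
      ((2 * Real.sinc (b * z.1 ^ 2 - b * z.2 ^ 2) : ℝ) : ℂ)‖ ≤
      16 * Real.pi * ((∫ v, ‖F v‖ ^ 2) + ∫ v, ‖G v‖ ^ 2) := by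
  set q : ℝ → ℝ := fun v => b * v ^ 2 with hq
  have hqm : Measurable q := by fun_prop
  have hF' := isNice_amp b hF
  have hG' := isNice_amp b hG
  have hw : Integrable ((Set.Ioc (-1:ℝ) 1).indicator fun _ => (1:ℝ)) :=
    (integrable_indicator_iff measurableSet_Ioc).2 (by simp)
  have h := integral_mul_osc_mul_osc (w := fun τ =>
    (((Set.Ioc (-1:ℝ) 1).indicator (fun _ => (1:ℝ)) τ : ℝ) : ℂ)) hw.ofReal hF'.integrable
    hG'.integrable hqm
  have hind : ∀ H : ℝ → ℂ, ∫ τ, (((Set.Ioc (-1:ℝ) 1).indicator (fun _ => (1:ℝ)) τ : ℝ) : ℂ) * H τ =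
      ∫ τ in (-1:ℝ)..1, H τ := by
    intro H
    rw [intervalIntegral.integral_of_le (by norm_num), ← integral_indicator measurableSet_Ioc]
    congr 1
    ext τ
    by_cases hτ : τ ∈ Set.Ioc (-1:ℝ) 1 <;> simp [hτ]
  simp only [hind, integral_exp_neg_mul_I] at h
  rw [← h]
  have i1 : ∀ H : ℝ → ℂ, Measurable H → IntervalIntegrable (fun τ => ‖osc H q τ‖ ^ 2) volume (-1) 1 := by
    intro H hH
    rw [intervalIntegrable_iff_integrableOn_Ioc_of_le (by norm_num),
      ← integrable_indicator_iff measurableSet_Ioc]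
    refine (integrable_osc_sq hH hqm hw).congr (Filter.Eventually.of_forall fun τ => ?_)
    by_cases hτ : τ ∈ Set.Ioc (-1:ℝ) 1 <;> simp [hτ]
  have i2 : IntervalIntegrable (fun τ => ‖osc (amp b G) q (-τ)‖ ^ 2) volume (-1) 1 := by
    have := (i1 _ hG'.meas).comp_mul_left (c := -1)
    norm_num at this
    exact this.symm
  have h1 : ‖∫ τ in (-1:ℝ)..1, osc (amp b F) q τ * osc (amp b G) q (-τ)‖ ≤
      ∫ τ in (-1:ℝ)..1, 1 / 2 * (‖osc (amp b F) q τ‖ ^ 2 + ‖osc (amp b G) q (-τ)‖ ^ 2) := by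
    refine intervalIntegral.norm_integral_le_of_norm_le (by norm_num)
      (Filter.Eventually.of_forall fun τ _ => ?_) (((i1 _ hF'.meas).add i2).const_mul _)
    rw [norm_mul]
    nlinarith [sq_nonneg (‖osc (amp b F) q τ‖ - ‖osc (amp b G) q (-τ)‖)]
  rw [intervalIntegral.integral_const_mul, intervalIntegral.integral_add (i1 _ hF'.meas) i2,
    intervalIntegral.integral_comp_neg (fun τ => ‖osc (amp b G) q τ‖ ^ 2), neg_neg] at h1
  have h2 := integral_osc_sq_le hb hF
  have h3 := integral_osc_sq_le hb hG
  linarith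

lemma integrable_modelKer_form {b : ℝ} (hb : 0 < b) {F G : ℝ → ℂ} (hF : IsNice F)
    (hG : IsNice G) :
    Integrable fun z : ℝ × ℝ => (modelKer b z.1 z.2 : ℂ) * (F z.1 * G z.2) := by
  have hF1 : IsNice fun v => (v : ℂ) * F v := hF.mul_continuous (by fun_prop)
  have hG1 : IsNice fun v => (v : ℂ) * G v := hG.mul_continuous (by fun_prop)
  have hmF := hF.meas
  have hmG := hG.meas
  refine (((hF1.integrable.mul_prod hG.integrable).norm.add
    (hF.integrable.mul_prod hG1.integrable).norm).const_mul b).mono' ?_ ?_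
  · have := measurable_modelKer b
    exact Measurable.aestronglyMeasurable (by fun_prop)
  · refine Filter.Eventually.of_forall fun z => ?_
    have h := abs_modelKer_le hb z.1 z.2
    have h2 := abs_add_le z.1 z.2
    simp only [norm_mul, Complex.norm_real, Real.norm_eq_abs, Pi.add_apply]
    calc |modelKer b z.1 z.2| * (‖F z.1‖ * ‖G z.2‖)
        ≤ (b * (|z.1| + |z.2|)) * (‖F z.1‖ * ‖G z.2‖) := by
          gcongr
          exact h.trans (by gcongr)
      _ = _ := by ring

lemma norm_integral_modelKer_form {b : ℝ} (hb : 0 < b) {F G : ℝ → ℂ} (hF : IsNice F)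
    (hG : IsNice G) :
    2 * ‖∫ z : ℝ × ℝ, (modelKer b z.1 z.2 : ℂ) * (F z.1 * G z.2)‖ ≤
      34 * Real.pi * ((∫ v, ‖F v‖ ^ 2) + ∫ v, ‖G v‖ ^ 2) := by
  set s : ℝ × ℝ → ℂ := fun z => ((2 * Real.sinc (b * z.1 ^ 2 - b * z.2 ^ 2) : ℝ) : ℂ) with hs
  set P : Set ℝ := Set.Ioi 0
  set N : Set ℝ := Set.Iio 0
  have hP : MeasurableSet P := measurableSet_Ioi
  have hN : MeasurableSet N := measurableSet_Iio
  have hle : ∀ (H : ℝ → ℂ) (_ : IsNice H) (t : Set ℝ), MeasurableSet t →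
      ∫ v, ‖t.indicator H v‖ ^ 2 ≤ ∫ v, ‖H v‖ ^ 2 := by
    intro H hH t ht
    refine integral_mono (hH.indicator ht).integrable_sq hH.integrable_sq fun v => ?_
    exact pow_le_pow_left₀ (norm_nonneg _) (norm_indicator_le_norm_self H v) 2
  have iP := integrable_sinc_form b (hF.indicator hP) (hG.indicator hP)
  have iN := integrable_sinc_form b (hF.indicator hN) (hG.indicator hN)
  have bP := norm_integral_sinc_form hb (hF.indicator hP) (hG.indicator hP)
  have bN := norm_integral_sinc_form hb (hF.indicator hN) (hG.indicator hN)
  have iK := integrable_modelKer_form hb hF hG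
  have hR := norm_integral_hilbert hF hG (f := fun z =>
    (modelKer b z.1 z.2 : ℂ) * (F z.1 * G z.2) -
    (amp b (P.indicator F) z.1 * amp b (P.indicator G) z.2 * s z +
    amp b (N.indicator F) z.1 * amp b (N.indicator G) z.2 * s z)) (by
    intro u v hu hv
    have hsb : √b * √b = b := Real.mul_self_sqrt hb.le
    have same : ∀ a c : ℂ, 0 < u * v → a = amp b F u → c = amp b G v →
        ‖(modelKer b u v : ℂ) * (F u * G v) - a * c * s (u, v)‖ ≤
          1 / (|u| + |v|) * ‖F u‖ * ‖G v‖ := by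
      rintro _ _ huv rfl rfl
      have h := abs_modelKer_sub_le hb huv
      have e : (modelKer b u v : ℂ) * (F u * G v) - amp b F u * amp b G v * s (u, v) =
          ((modelKer b u v - b * (√|u| * √|v|) * (2 * Real.sinc (b * u ^ 2 - b * v ^ 2)) : ℝ) : ℂ)
            * (F u * G v) := by
        have hsb' : ((√b : ℝ) : ℂ) * (√b : ℝ) = b := by exact_mod_cast hsb
        simp only [amp, hs]
        push_cast
        linear_combination (-(√|u| : ℂ) * √|v| * (2 * Real.sinc (b * u ^ 2 - b * v ^ 2)) *
          F u * G v) * hsb'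
      rw [e, norm_mul, norm_mul, Complex.norm_real, Real.norm_eq_abs, mul_assoc (1 / _)]
      gcongr
    have opp : u * v < 0 → ‖(modelKer b u v : ℂ) * (F u * G v)‖ ≤
          1 / (|u| + |v|) * ‖F u‖ * ‖G v‖ := by
      intro huv
      rw [norm_mul, norm_mul, Complex.norm_real, Real.norm_eq_abs, mul_assoc (1 / _)]
      gcongr
      exact abs_modelKer_le_of_neg b huv
    rcases lt_or_gt_of_ne hu with h1 | h1 <;> rcases lt_or_gt_of_ne hv with h2 | h2
    · simpa [amp, P, N, h1, h2, h1.le, h2.le, not_lt] using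
        same _ _ (mul_pos_of_neg_of_neg h1 h2) rfl rfl
    · simpa [amp, P, N, h1, h2, h1.le, h2.le, not_lt] using opp (mul_neg_of_neg_of_pos h1 h2)
    · simpa [amp, P, N, h1, h2, h1.le, h2.le, not_lt] using opp (mul_neg_of_pos_of_neg h1 h2)
    · simpa [amp, P, N, h1, h2, h1.le, h2.le, not_lt] using same _ _ (mul_pos h1 h2) rfl rfl)
  have hsplit := integral_sub iK (iP.add iN)
  simp only [Pi.add_apply] at hsplit
  rw [integral_add iP iN] at hsplit
  rw [hsplit] at hR
  have h1 := hle F hF P hP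
  have h2 := hle F hF N hN
  have h3 := hle G hG P hP
  have h4 := hle G hG N hN
  set I := ∫ z : ℝ × ℝ, (modelKer b z.1 z.2 : ℂ) * (F z.1 * G z.2)
  set X := ∫ z : ℝ × ℝ, amp b (P.indicator F) z.1 * amp b (P.indicator G) z.2 * s z
  set Y := ∫ z : ℝ × ℝ, amp b (N.indicator F) z.1 * amp b (N.indicator G) z.2 * s z
  have ht : ‖I‖ ≤ ‖I - (X + Y)‖ + (‖X‖ + ‖Y‖) := by
    calc ‖I‖ = ‖(I - (X + Y)) + (X + Y)‖ := by rw [sub_add_cancel]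
      _ ≤ _ := (norm_add_le _ _).trans (by gcongr; exact norm_add_le _ _)
  have hpi := Real.pi_pos
  nlinarith [mul_le_mul_of_nonneg_left (add_le_add h1 h3) hpi.le,
    mul_le_mul_of_nonneg_left (add_le_add h2 h4) hpi.le]

/-- The operator with kernel `modelKer b` is bounded on `L²(ℝ)`, uniformly in `b`. -/
lemma lintegral_modelKer_sq_le {b : ℝ} (hb : 0 < b) {g : ℝ → ℂ} (hg : IsNice g) :
    ∫⁻ u, ‖∫ v, (modelKer b u v : ℂ) * g v‖ₑ ^ 2 ≤
      ENNReal.ofReal ((34 * Real.pi) ^ 2) * ∫⁻ v, ‖g v‖ₑ ^ 2 := by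
  set A : ℝ := 34 * Real.pi with hA
  have hA0 : 0 < A := by positivity
  set S : ℝ → ℂ := fun u => ∫ v, (modelKer b u v : ℂ) * g v with hS
  have hmg := hg.meas
  have hmk := measurable_modelKer b
  have hSm : Measurable S := by
    refine (StronglyMeasurable.integral_prod_right
      (f := fun u v => (modelKer b u v : ℂ) * g v) ?_).measurable
    apply Measurable.stronglyMeasurable
    unfold Function.uncurry
    fun_prop
  have hSb : ∀ u, ‖S u‖ ≤ b * |u| * (∫ v, ‖g v‖) + b * ∫ v : ℝ, ‖(v : ℂ) * g v‖ := by
    intro u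
    have hg1 : IsNice fun v => (v : ℂ) * g v := hg.mul_continuous (by fun_prop)
    rw [← integral_const_mul, ← integral_const_mul, ← integral_add (hg.integrable.norm.const_mul _)
      (hg1.integrable.norm.const_mul _)]
    refine norm_integral_le_of_norm_le ((hg.integrable.norm.const_mul _).add
      (hg1.integrable.norm.const_mul _)) (Filter.Eventually.of_forall fun v => ?_)
    have h := abs_modelKer_le hb u v
    have h2 := abs_add_le u v
    simp only [norm_mul, Complex.norm_real, Real.norm_eq_abs]
    calc |modelKer b u v| * ‖g v‖ ≤ (b * (|u| + |v|)) * ‖g v‖ := by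
          gcongr
          exact h.trans (by gcongr)
      _ = _ := by ring
  have main : ∀ N : ℕ, ∫⁻ u in Set.Icc (-(N:ℝ)) N, ‖S u‖ₑ ^ 2 ≤
      ENNReal.ofReal (A ^ 2) * ∫⁻ v, ‖g v‖ₑ ^ 2 := by
    intro N
    have h1N : IsNice ((Set.Icc (-(N:ℝ)) N).indicator fun _ => (1:ℂ)) := by
      refine ⟨measurable_const.indicator measurableSet_Icc, max 1 N, fun v => ⟨?_, fun hv => ?_⟩⟩
      · refine (norm_indicator_le_norm_self _ v).trans ?_
        simp
      · refine Set.indicator_of_notMem (fun h => ?_) _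
        exact absurd (abs_le.mpr h) (not_le.mpr ((le_max_right _ _).trans_lt hv))
    set ψ : ℝ → ℂ := fun u => ((A⁻¹ : ℝ) * starRingEnd ℂ (S u)) *
      (Set.Icc (-(N:ℝ)) N).indicator (fun _ => (1:ℂ)) u with hψ
    have hψn : IsNice ψ := by
      refine h1N.mul (by
        exact measurable_const.mul (Complex.continuous_conj.measurable.comp hSm)) fun L =>
        ⟨A⁻¹ * (b * L * (∫ v, ‖g v‖) + b * ∫ v : ℝ, ‖(v : ℂ) * g v‖), fun v hv => ?_⟩
      rw [norm_mul, Complex.norm_real, Real.norm_of_nonneg (by positivity), RCLike.norm_conj]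
      gcongr
      refine (hSb v).trans ?_
      have : 0 ≤ ∫ v, ‖g v‖ := integral_nonneg fun _ => norm_nonneg _
      gcongr
    have hform : ∫ z : ℝ × ℝ, (modelKer b z.1 z.2 : ℂ) * (ψ z.1 * g z.2) =
        ((A * ∫ u, ‖ψ u‖ ^ 2 : ℝ) : ℂ) := by
      have hi := integrable_modelKer_form hb hψn hg
      rw [Measure.volume_eq_prod] at hi ⊢
      rw [integral_prod _ hi, ← integral_const_mul, ← integral_complex_ofReal]
      congr 1
      ext u
      have : ∀ v, (modelKer b u v : ℂ) * (ψ u * g v) = ψ u * ((modelKer b u v : ℂ) * g v) :=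
        fun v => by ring
      simp only [this]
      rw [integral_const_mul]
      change ψ u * S u = _
      by_cases hu : u ∈ Set.Icc (-(N:ℝ)) N
      · simp only [hψ, Set.indicator_of_mem hu, mul_one, norm_mul, RCLike.norm_conj,
          Complex.norm_real, Real.norm_of_nonneg (inv_nonneg.mpr hA0.le)]
        rw [mul_assoc, mul_comm (starRingEnd ℂ (S u)), Complex.mul_conj, Complex.normSq_eq_norm_sq]
        have : (A : ℂ) ≠ 0 := by exact_mod_cast hA0.ne'
        push_cast
        field_simp
      · simp [hψ, Set.indicator_of_notMem hu]
    have hb1 := norm_integral_modelKer_form hb hψn hg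
    rw [hform, Complex.norm_real, Real.norm_of_nonneg (by
      have := integral_sq_nonneg ψ
      positivity)] at hb1
    have hE : ∫ u, ‖ψ u‖ ^ 2 ≤ ∫ u, ‖g u‖ ^ 2 := by
      have : A * (∫ u, ‖ψ u‖ ^ 2) ≤ A * ∫ u, ‖g u‖ ^ 2 := by linarith
      exact le_of_mul_le_mul_left this hA0
    have hE' : ∫⁻ u, ‖ψ u‖ₑ ^ 2 ≤ ∫⁻ u, ‖g u‖ₑ ^ 2 := by
      rw [hψn.lintegral_sq, hg.lintegral_sq]
      exact ENNReal.ofReal_le_ofReal hE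
    calc ∫⁻ u in Set.Icc (-(N:ℝ)) N, ‖S u‖ₑ ^ 2
        = ∫⁻ u in Set.Icc (-(N:ℝ)) N, ENNReal.ofReal (A ^ 2) * ‖ψ u‖ₑ ^ 2 := by
          refine setLIntegral_congr_fun measurableSet_Icc fun u hu => ?_
          simp only [hψ, Set.indicator_of_mem hu, mul_one]
          rw [← ofReal_norm, ← ofReal_norm, ← ENNReal.ofReal_pow (norm_nonneg _),
            ← ENNReal.ofReal_pow (norm_nonneg _), ← ENNReal.ofReal_mul (by positivity)]
          congr 1
          rw [norm_mul, Complex.norm_real, Real.norm_of_nonneg (by positivity), RCLike.norm_conj]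
          field_simp
      _ = ENNReal.ofReal (A ^ 2) * ∫⁻ u in Set.Icc (-(N:ℝ)) N, ‖ψ u‖ₑ ^ 2 :=
          lintegral_const_mul' _ _ ENNReal.ofReal_ne_top
      _ ≤ ENNReal.ofReal (A ^ 2) * ∫⁻ u, ‖ψ u‖ₑ ^ 2 := by
          gcongr
          exact Measure.restrict_le_self
      _ ≤ _ := by gcongr
  have hcover : AECover (volume : Measure ℝ) Filter.atTop fun N : ℕ => Set.Icc (-(N:ℝ)) N :=
    aecover_Icc (Filter.tendsto_neg_atTop_atBot.comp tendsto_natCast_atTop_atTop)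
      tendsto_natCast_atTop_atTop
  have hlim := hcover.lintegral_tendsto_of_countably_generated
    (f := fun u => ‖S u‖ₑ ^ 2) (by fun_prop)
  exact le_of_tendsto' hlim main

lemma continuous_bet : Continuous bet := by
  unfold bet
  fun_prop

lemma one_le_bet (t : ℝ) : 1 ≤ bet t := by
  unfold bet
  exact Real.one_le_sqrt.mpr (by nlinarith [sq_nonneg t])

lemma half_abs_le_bet (t : ℝ) : |t| / 2 ≤ bet t := by
  unfold bet
  refine Real.le_sqrt_of_sq_le ?_
  rw [div_pow, sq_abs]
  linarith

lemma sinq_eq_modelKer (p : ℝ[X]) (x y : ℝ × ℝ) :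
    sinq p x y = modelKer (bet (x.1 - y.1)) (x.2 + p.derivative.eval (x.1 + y.1) / 2)
      (y.2 + p.derivative.eval (x.1 + y.1) / 2) := by
  unfold sinq modelKer theta
  set c := p.derivative.eval (x.1 + y.1)
  have h1 : x.2 + c / 2 + (y.2 + c / 2) = x.2 + y.2 + c := by ring
  have h2 : x.2 + c / 2 - (y.2 + c / 2) = x.2 - y.2 := by ring
  simp only [h1, h2, add_left_inj]

/-- The common factor of the kernels of `𝒪^R` and `𝒯^R`. -/
def coreKer (p : ℝ[X]) (γ : ℝ) (x y : ℝ × ℝ) : ℂ :=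
  Complex.exp (Complex.I * (γ * Psi p x y : ℝ)) * (sinq p x y : ℝ)

lemma norm_exp_I_mul_ofReal (r : ℝ) : ‖Complex.exp (Complex.I * (r : ℂ))‖ = 1 := by
  rw [mul_comm]
  exact Complex.norm_exp_ofReal_mul_I r

lemma measurable_coreKer (p : ℝ[X]) (γ : ℝ) :
    Measurable fun z : (ℝ × ℝ) × (ℝ × ℝ) => coreKer p γ z.1 z.2 := by
  have h1 : Continuous fun z : (ℝ × ℝ) × (ℝ × ℝ) => Psi p z.1 z.2 := by
    unfold Psi
    have := p.continuous
    fun_prop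
  have h2 : Measurable fun z : (ℝ × ℝ) × (ℝ × ℝ) => theta p z.1 z.2 := by
    unfold theta
    have := p.derivative.continuous
    have := continuous_bet
    have : Continuous fun z : (ℝ × ℝ) × (ℝ × ℝ) => bet (z.1.1 - z.2.1) *
      |z.1.2 + z.2.2 + p.derivative.eval (z.1.1 + z.2.1)| * (z.1.2 - z.2.2) := by fun_prop
    exact this.measurable
  have h3 : Measurable fun z : (ℝ × ℝ) × (ℝ × ℝ) => sinq p z.1 z.2 := by
    unfold sinq
    refine Measurable.ite (measurableSet_eq_fun (by fun_prop) (by fun_prop)) ?_ ?_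
    · have := p.derivative.continuous
      have := continuous_bet
      have : Continuous fun z : (ℝ × ℝ) × (ℝ × ℝ) => bet (z.1.1 - z.2.1) *
        |z.1.2 + z.2.2 + p.derivative.eval (z.1.1 + z.2.1)| := by fun_prop
      exact this.measurable
    · fun_prop
  unfold coreKer
  refine Measurable.mul ?_ (by fun_prop)
  have : Continuous fun z : (ℝ × ℝ) × (ℝ × ℝ) =>
    Complex.exp (Complex.I * (γ * Psi p z.1 z.2 : ℝ)) := by fun_prop
  exact this.measurable

lemma norm_coreKer_le (p : ℝ[X]) (γ : ℝ) (x y : ℝ × ℝ) :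
    ‖coreKer p γ x y‖ ≤
      bet (x.1 - y.1) * |x.2 + y.2 + p.derivative.eval (x.1 + y.1)| := by
  unfold coreKer
  rw [norm_mul, norm_exp_I_mul_ofReal, one_mul, Complex.norm_real, Real.norm_eq_abs,
    sinq_eq_modelKer]
  refine (abs_modelKer_le (by linarith [one_le_bet (x.1 - y.1)]) _ _).trans_eq ?_
  congr 2
  ring

lemma lintegral_coreKer_slice_sq_le (p : ℝ[X]) (γ s t : ℝ) {h : ℝ → ℂ} (hh : IsNice h) :
    ∫⁻ u, ‖∫ v, coreKer p γ (s, u) (t, v) * h v‖ₑ ^ 2 ≤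
      ENNReal.ofReal ((34 * Real.pi) ^ 2) * ∫⁻ v, ‖h v‖ₑ ^ 2 := by
  have hb : 0 < bet (s - t) := by linarith [one_le_bet (s - t)]
  set b := bet (s - t) with hbdef
  set c := p.derivative.eval (s + t) with hc
  set q := p.eval (s + t) with hq
  set e : ℝ → ℂ := fun v =>
    Complex.exp (Complex.I * (γ * ((s - t) * v ^ 2 + v * q) : ℝ)) with he
  have hec : Continuous e := by fun_prop
  set g : ℝ → ℂ := fun w => e (w - c / 2) * h (w - c / 2) with hg
  have hgn : IsNice g := by
    obtain ⟨L, hL⟩ := (hh.mul_continuous hec).bdd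
    refine ⟨(hec.measurable.mul hh.meas).comp (measurable_id.sub_const _), L + |c / 2|,
      fun v => ⟨(hL _).1.trans (by linarith [abs_nonneg (c / 2)]), fun hv => (hL _).2 ?_⟩⟩
    have := abs_sub_abs_le_abs_sub v (c / 2)
    linarith
  have hS : ∀ u, ‖∫ v, coreKer p γ (s, u) (t, v) * h v‖ₑ =
      ‖∫ v, (modelKer b (u + c / 2) v : ℂ) * g v‖ₑ := by
    intro u
    have h1 : ∀ v, coreKer p γ (s, u) (t, v) * h v =
        Complex.exp (Complex.I * (γ * ((s - t) * u ^ 2 - u * q) : ℝ)) *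
          ((modelKer b (u + c / 2) (v + c / 2) : ℂ) * g (v + c / 2)) := by
      intro v
      unfold coreKer
      rw [sinq_eq_modelKer]
      simp only [hg, he, Psi, add_sub_cancel_right, ← hbdef, ← hc, ← hq]
      have : Complex.exp (Complex.I * (γ * ((s - t) * (u ^ 2 + v ^ 2) - (u - v) * q) : ℝ)) =
          Complex.exp (Complex.I * (γ * ((s - t) * u ^ 2 - u * q) : ℝ)) *
          Complex.exp (Complex.I * (γ * ((s - t) * v ^ 2 + v * q) : ℝ)) := by
        rw [← Complex.exp_add]
        congr 1
        push_cast
        ring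
      rw [this]
      ring
    simp only [h1]
    rw [integral_const_mul, enorm_mul,
      integral_add_right_eq_self (fun v => (modelKer b (u + c / 2) v : ℂ) * g v) (c / 2)]
    rw [← ofReal_norm, norm_exp_I_mul_ofReal, ENNReal.ofReal_one, one_mul]
  simp only [hS]
  rw [lintegral_add_right_eq_self
    (fun u => ‖∫ v, (modelKer b u v : ℂ) * g v‖ₑ ^ 2) (c / 2)]
  refine (lintegral_modelKer_sq_le hb hgn).trans_eq ?_
  congr 1
  have h2 : ∀ v, ‖g v‖ₑ ^ 2 = (fun v => ‖h v‖ₑ ^ 2) (v - c / 2) := by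
    intro v
    simp only [hg, he, enorm_mul]
    rw [← ofReal_norm (Complex.exp _), norm_exp_I_mul_ofReal, ENNReal.ofReal_one, one_mul]
  simp only [h2]
  exact lintegral_sub_right_eq_self (fun v => ‖h v‖ₑ ^ 2) (c / 2)

lemma integrable_coreKer_mul (p : ℝ[X]) (γ : ℝ) {m : ℝ → ℝ} (hm : Measurable m) {K : ℝ}
    (hK : ∀ t, |m t| ≤ K) {f : ℝ × ℝ → ℂ} (hf : Continuous f) (hfc : HasCompactSupport f)
    (x : ℝ × ℝ) : Integrable fun y => coreKer p γ x y * (m (x.1 - y.1) : ℂ) * f y := by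
  have hφ : Continuous fun y : ℝ × ℝ =>
      bet (x.1 - y.1) * |x.2 + y.2 + p.derivative.eval (x.1 + y.1)| * K * ‖f y‖ := by
    have := p.derivative.continuous
    have := continuous_bet
    fun_prop
  have hi := hφ.integrable_of_hasCompactSupport (μ := volume) (hfc.norm.mul_left)
  refine hi.mono' ?_ (Filter.Eventually.of_forall fun y => ?_)
  · have : Measurable (coreKer p γ x) := (measurable_coreKer p γ).of_uncurry_left
    exact ((this.mul (by fun_prop)).mul hf.measurable).aestronglyMeasurable
  · rw [norm_mul, norm_mul, Complex.norm_real, Real.norm_eq_abs]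
    have hK0 : 0 ≤ K := (abs_nonneg _).trans (hK 0)
    have := norm_coreKer_le p γ x y
    gcongr
    · exact mul_nonneg (by linarith [one_le_bet (x.1 - y.1)]) (abs_nonneg _)
    · exact hK _

lemma isNice_slice {f : ℝ × ℝ → ℂ} (hf : Continuous f) (hfc : HasCompactSupport f) (t : ℝ) :
    IsNice fun v => f (t, v) := by
  obtain ⟨A, hA⟩ := hf.bounded_above_of_compact_support hfc
  obtain ⟨r, hr⟩ := hfc.isCompact.isBounded.subset_closedBall (0 : ℝ × ℝ)
  refine ⟨by fun_prop, max A r, fun v => ⟨(hA _).trans (le_max_left _ _), fun hv => ?_⟩⟩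
  refine image_eq_zero_of_notMem_tsupport fun hmem => ?_
  have := hr hmem
  rw [mem_closedBall_zero_iff, Prod.norm_def] at this
  have h2 : |v| ≤ r := (le_max_right _ _).trans this
  exact absurd (h2.trans (le_max_right A r)) (not_le.mpr hv)

lemma sq_lintegral_mul_le {α : Type*} [MeasurableSpace α] {μ : Measure α} {w g : α → ENNReal}
    (hw : Measurable w) (hg : Measurable g) :
    (∫⁻ a, w a * g a ∂μ) ^ 2 ≤ (∫⁻ a, w a ∂μ) * ∫⁻ a, w a * g a ^ 2 ∂μ := by
  have h := ENNReal.lintegral_mul_le_Lp_mul_Lq μ Real.HolderConjugate.two_two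
    (f := fun a => w a ^ (1 / 2 : ℝ)) (g := fun a => w a ^ (1 / 2 : ℝ) * g a)
    (by fun_prop) (by fun_prop)
  have e0 : ∀ z : ENNReal, z ^ (1 / 2 : ℝ) * z ^ (1 / 2 : ℝ) = z := fun z => by
    rw [← ENNReal.rpow_add_of_nonneg _ _ (by norm_num) (by norm_num)]
    norm_num
  have e1 : ∀ z : ENNReal, (z ^ (1 / 2 : ℝ)) ^ (2 : ℝ) = z := fun z => by
    rw [← ENNReal.rpow_mul]
    norm_num
  simp only [Pi.mul_apply, ← mul_assoc, e0, ENNReal.mul_rpow_of_nonneg _ _ zero_le_two, e1] at h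
  have h' := pow_le_pow_left₀ (zero_le) h 2
  have e2 : ∀ z : ENNReal, (z ^ (1 / 2 : ℝ)) ^ 2 = z := fun z => by rw [sq, e0]
  rw [mul_pow, e2, e2] at h'
  simpa using h'

lemma lintegral_coreKer_conv_sq_le (p : ℝ[X]) (γ : ℝ) {m : ℝ → ℝ} (hm : Measurable m) {K : ℝ}
    (hK : ∀ t, |m t| ≤ K) {B : ENNReal} (hB : ∫⁻ t, ‖m t‖ₑ ≤ B)
    {f : ℝ × ℝ → ℂ} (hf : Continuous f) (hfc : HasCompactSupport f) :
    ∫⁻ x : ℝ × ℝ, ‖∫ y, coreKer p γ x y * (m (x.1 - y.1) : ℂ) * f y‖ₑ ^ 2 ≤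
      B ^ 2 * ENNReal.ofReal ((34 * Real.pi) ^ 2) * ∫⁻ y, ‖f y‖ₑ ^ 2 := by
  set S : (ℝ × ℝ) → ℝ → ℂ := fun x t => ∫ v, coreKer p γ x (t, v) * f (t, v) with hS
  have hSm : Measurable fun z : (ℝ × ℝ) × ℝ => S z.1 z.2 := by
    refine (StronglyMeasurable.integral_prod_right
      (f := fun (z : (ℝ × ℝ) × ℝ) (v : ℝ) => coreKer p γ z.1 (z.2, v) * f (z.2, v)) ?_).measurable
    refine Measurable.stronglyMeasurable ?_
    refine Measurable.mul ?_ (hf.measurable.comp (by fun_prop))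
    exact (measurable_coreKer p γ).comp
      (f := fun w : ((ℝ × ℝ) × ℝ) × ℝ => (w.1.1, (w.1.2, w.2))) (by fun_prop)
  have hpt : ∀ x : ℝ × ℝ, ‖∫ y, coreKer p γ x y * (m (x.1 - y.1) : ℂ) * f y‖ₑ ^ 2 ≤
      B * ∫⁻ t, ‖m (x.1 - t)‖ₑ * ‖S x t‖ₑ ^ 2 := by
    intro x
    have hi := integrable_coreKer_mul p γ hm hK hf hfc x
    rw [Measure.volume_eq_prod] at hi ⊢
    rw [integral_prod _ hi]
    have h1 : ∀ t, ∫ v, coreKer p γ x (t, v) * (m (x.1 - t) : ℂ) * f (t, v) =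
        (m (x.1 - t) : ℂ) * S x t := by
      intro t
      rw [hS, ← integral_const_mul]
      congr 1
      ext v
      ring
    simp only [h1]
    have h2 : ‖∫ t, (m (x.1 - t) : ℂ) * S x t‖ₑ ≤ ∫⁻ t, ‖m (x.1 - t)‖ₑ * ‖S x t‖ₑ := by
      refine (enorm_integral_le_lintegral_enorm _).trans_eq ?_
      refine lintegral_congr fun t => ?_
      rw [enorm_mul]
      congr 1
      rw [← ofReal_norm, ← ofReal_norm, Complex.norm_real]
    refine (pow_le_pow_left₀ zero_le h2 2).trans ?_
    refine (sq_lintegral_mul_le (by fun_prop)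
      (hSm.comp (measurable_prodMk_left (x := x))).enorm).trans ?_
    refine mul_le_mul' ?_ le_rfl
    rw [lintegral_sub_left_eq_self (fun t => ‖m t‖ₑ) x.1]
    exact hB
  refine (lintegral_mono hpt).trans ?_
  have hG : Measurable fun z : (ℝ × ℝ) × ℝ => ‖m (z.1.1 - z.2)‖ₑ * ‖S z.1 z.2‖ₑ ^ 2 := by
    fun_prop
  rw [lintegral_const_mul _ hG.lintegral_prod_right', Measure.volume_eq_prod]
  rw [lintegral_prod _ hG.lintegral_prod_right'.aemeasurable]
  have h3 : ∀ s : ℝ, ∫⁻ u, ∫⁻ t, ‖m (s - t)‖ₑ * ‖S (s, u) t‖ₑ ^ 2 ≤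
      ∫⁻ t, ‖m (s - t)‖ₑ * (ENNReal.ofReal ((34 * Real.pi) ^ 2) * ∫⁻ v, ‖f (t, v)‖ₑ ^ 2) := by
    intro s
    have hmeas : Measurable fun z : ℝ × ℝ => ‖m (s - z.2)‖ₑ * ‖S (s, z.1) z.2‖ₑ ^ 2 :=
      hG.comp (f := fun z : ℝ × ℝ => ((s, z.1), z.2)) (by fun_prop)
    rw [lintegral_lintegral_swap hmeas.aemeasurable]
    refine lintegral_mono fun t => ?_
    have : Measurable fun u => ‖S (s, u) t‖ₑ ^ 2 :=
      (hSm.comp (f := fun u : ℝ => ((s, u), t)) (by fun_prop)).enorm.pow_const 2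
    rw [lintegral_const_mul _ this]
    gcongr
    exact lintegral_coreKer_slice_sq_le p γ s t (isNice_slice hf hfc t)
  have hfm : Measurable fun t => ∫⁻ v, ‖f (t, v)‖ₑ ^ 2 :=
    (hf.measurable.enorm.pow_const 2).lintegral_prod_right'
  calc B * ∫⁻ s, ∫⁻ u, ∫⁻ t, ‖m (s - t)‖ₑ * ‖S (s, u) t‖ₑ ^ 2
      ≤ B * ∫⁻ s, ∫⁻ t, ‖m (s - t)‖ₑ *
          (ENNReal.ofReal ((34 * Real.pi) ^ 2) * ∫⁻ v, ‖f (t, v)‖ₑ ^ 2) := by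
        exact mul_le_mul' le_rfl (lintegral_mono h3)
    _ = B * ∫⁻ t, (∫⁻ s, ‖m s‖ₑ) *
          (ENNReal.ofReal ((34 * Real.pi) ^ 2) * ∫⁻ v, ‖f (t, v)‖ₑ ^ 2) := by
        rw [lintegral_lintegral_swap (by fun_prop)]
        congr 1
        refine lintegral_congr fun t => ?_
        rw [lintegral_mul_const _ (by fun_prop),
          lintegral_sub_right_eq_self (fun s => ‖m s‖ₑ) t]
    _ ≤ B * ∫⁻ t, B * (ENNReal.ofReal ((34 * Real.pi) ^ 2) * ∫⁻ v, ‖f (t, v)‖ₑ ^ 2) := by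
        gcongr
    _ = _ := by
        rw [lintegral_const_mul _ (by fun_prop), lintegral_const_mul _ hfm,
          lintegral_prod _ (by fun_prop)]
        ring

lemma hasSum_int_telescope (G : ℤ → ℝ) (a : ℤ) (k : ℕ) :
    HasSum ((Set.Ico a (a + k)).indicator fun j => G (j + 1) - G j) (G (a + k) - G a) := by
  have hinj : Function.Injective fun i : ℕ => a + (i : ℤ) := fun i j h => by simpa using h
  have h := hasSum_sum_of_ne_finset_zero
    (f := (Set.Ico a (a + k)).indicator fun j => G (j + 1) - G j)
    (s := (Finset.range k).map ⟨_, hinj⟩) (L := .unconditional ℤ) (fun j hj => by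
      refine Set.indicator_of_notMem (fun hmem => hj ?_) _
      obtain ⟨h1, h2⟩ := hmem
      simp only [Finset.mem_map, Finset.mem_range, Function.Embedding.coeFn_mk]
      exact ⟨(j - a).toNat, by omega, by omega⟩)
  convert h using 1
  rw [Finset.sum_map]
  have : ∀ i ∈ Finset.range k, (Set.Ico a (a + k)).indicator (fun j => G (j + 1) - G j)
      ((⟨_, hinj⟩ : ℕ ↪ ℤ) i) = G (a + ((i + 1 : ℕ) : ℤ)) - G (a + (i : ℤ)) := by
    intro i hi
    rw [Set.indicator_of_mem]
    · simp only [Function.Embedding.coeFn_mk, Nat.cast_add, Nat.cast_one, add_assoc]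
    · rw [Finset.mem_range] at hi
      simp only [Function.Embedding.coeFn_mk, Set.mem_Ico]
      omega
  rw [Finset.sum_congr rfl this, Finset.sum_range_sub (fun i : ℕ => G (a + (i : ℤ)))]
  simp

namespace CutoffFun

variable {η₀ : ℝ → ℝ}

lemma etad_nonneg (h : CutoffFun η₀) (s : ℝ) : 0 ≤ etad η₀ s := by
  unfold etad
  rcases le_total |s| 1 with hs | hs
  · rw [h.eq_one (s / 2) (by rw [abs_div, abs_two]; linarith)]
    linarith [(h.mem01 s).2]
  · rw [h.eq_zero s (by linarith), sub_zero]
    exact (h.mem01 _).1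

lemma etad_dyadic (j : ℤ) (s : ℝ) : etad η₀ ((2 : ℝ) ^ (-j) * s) =
    η₀ ((2 : ℝ) ^ (-(j + 1)) * s) - η₀ ((2 : ℝ) ^ (-j) * s) := by
  unfold etad
  congr 2
  rw [neg_add, zpow_add₀ two_ne_zero, zpow_neg_one]
  ring

lemma hasSum_etad (h : CutoffFun η₀) {s : ℝ} (hs : s ≠ 0) :
    HasSum (fun j : ℤ => etad η₀ ((2 : ℝ) ^ (-j) * s)) 1 := by
  obtain ⟨N, hN⟩ := pow_unbounded_of_one_lt (2 * |s| + |s|⁻¹) (one_lt_two (α := ℝ))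
  have hs' : 0 < |s| := abs_pos.mpr hs
  have habs : ∀ j : ℤ, |(2 : ℝ) ^ (-j) * s| = (2 : ℝ) ^ (-j) * |s| := fun j => by
    rw [abs_mul, abs_of_pos (by positivity)]
  have hi : 0 < |s|⁻¹ := inv_pos.mpr hs'
  have hbig : ∀ j : ℤ, (N : ℤ) ≤ j → η₀ ((2 : ℝ) ^ (-j) * s) = 1 := by
    intro j hj
    refine h.eq_one _ ?_
    rw [habs, zpow_neg, inv_mul_le_iff₀ (by positivity)]
    have : (2 : ℝ) ^ N ≤ (2 : ℝ) ^ j := by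
      rw [← zpow_natCast]
      exact zpow_le_zpow_right₀ one_le_two hj
    linarith
  have hsmall : ∀ j : ℤ, j ≤ -(N : ℤ) → η₀ ((2 : ℝ) ^ (-j) * s) = 0 := by
    intro j hj
    refine h.eq_zero _ ?_
    rw [habs]
    have h1 : (2 : ℝ) ^ N ≤ (2 : ℝ) ^ (-j) := by
      rw [← zpow_natCast]
      exact zpow_le_zpow_right₀ one_le_two (by omega)
    have h2 : |s|⁻¹ * |s| = 1 := inv_mul_cancel₀ hs'.ne'
    nlinarith
  have ht := hasSum_int_telescope (fun j => η₀ ((2 : ℝ) ^ (-j) * s)) (-(N : ℤ)) (2 * N)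
  simp only [hbig _ (show (N : ℤ) ≤ -(N : ℤ) + ((2 * N : ℕ) : ℤ) by push_cast; omega),
    hsmall _ le_rfl, sub_zero] at ht
  convert ht using 1
  ext j
  rw [etad_dyadic]
  by_cases hj : j ∈ Set.Ico (-(N : ℤ)) (-(N : ℤ) + ((2 * N : ℕ) : ℤ))
  · rw [Set.indicator_of_mem hj]
  · rw [Set.indicator_of_notMem hj]
    rw [Set.mem_Ico, not_and_or] at hj
    push_cast at hj
    rcases hj with hj | hj
    · rw [hsmall _ (by omega), hsmall _ (by omega), sub_zero]
    · rw [hbig _ (by omega), hbig _ (by omega), sub_self]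

end CutoffFun

/-- The number of dyadic scales `j₁` with `10 < j₁ ≤ log₂ R`. -/
def numScales (R : ℝ) : ℕ := (⌊Real.logb 2 R⌋ - 10).toNat

/-- The sum over the dyadic scales `10 < j₁ ≤ log₂ R` of the cut-offs in the first variable. -/
def scaleSum (η₀ : ℝ → ℝ) (R t : ℝ) : ℝ :=
  η₀ ((2 : ℝ) ^ (-(11 + (numScales R : ℤ))) * t) - η₀ ((2 : ℝ) ^ (-11 : ℤ) * t)

lemma setOf_scales_eq_Ico (R : ℝ) :
    {j : ℤ | 10 < j ∧ (j : ℝ) ≤ Real.logb 2 R} = Set.Ico 11 (11 + (numScales R : ℤ)) := by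
  ext j
  simp only [Set.mem_ofPred_eq, Set.mem_Ico, numScales, ← Int.le_floor]
  omega

lemma lt_two_pow_numScales {R : ℝ} (hR : 0 < R) :
    R < (2 : ℝ) ^ (11 + (numScales R : ℤ)) := by
  have h1 := Int.lt_floor_add_one (Real.logb 2 R)
  rw [Real.logb_lt_iff_lt_rpow one_lt_two hR] at h1
  refine h1.trans_le ?_
  rw [← Real.rpow_intCast]
  refine Real.rpow_le_rpow_of_exponent_le one_le_two ?_
  have : ⌊Real.logb 2 R⌋ + 1 ≤ 11 + (numScales R : ℤ) := by
    unfold numScales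
    omega
  exact_mod_cast this

lemma two_pow_numScales_le {R : ℝ} (hR : 0 < R) (hN : numScales R ≠ 0) :
    (2 : ℝ) ^ (10 + (numScales R : ℤ)) ≤ R := by
  have h1 := Int.floor_le (Real.logb 2 R)
  rw [Real.le_logb_iff_rpow_le one_lt_two hR] at h1
  refine le_trans ?_ h1
  rw [← Real.rpow_intCast]
  refine Real.rpow_le_rpow_of_exponent_le one_le_two ?_
  have : 10 + (numScales R : ℤ) ≤ ⌊Real.logb 2 R⌋ := by
    unfold numScales at hN ⊢
    omega
  exact_mod_cast this

lemma hasSum_scaleSum (η₀ : ℝ → ℝ) (R t : ℝ) :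
    HasSum ({j : ℤ | 10 < j ∧ (j : ℝ) ≤ Real.logb 2 R}.indicator fun j =>
      etad η₀ ((2 : ℝ) ^ (-j) * t)) (scaleSum η₀ R t) := by
  rw [setOf_scales_eq_Ico]
  simp only [CutoffFun.etad_dyadic]
  exact hasSum_int_telescope (fun j => η₀ ((2 : ℝ) ^ (-j) * t)) 11 (numScales R)

lemma CutoffFun.etad_zero {η₀ : ℝ → ℝ} : etad η₀ 0 = 0 := by simp [etad]

lemma Tker_eq (η₀ : ℝ → ℝ) (p : ℝ[X]) (γ : ℝ) (j : ℤ × ℤ) (x y : ℝ × ℝ) :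
    Tker η₀ p γ j x y = coreKer p γ x y * ((bet (x.1 - y.1))⁻¹ *
      (etad η₀ ((2 : ℝ) ^ (-j.1) * (x.1 - y.1)) *
        etad η₀ ((2 : ℝ) ^ (-j.2) * (x.2 - y.2))) : ℝ) := by
  unfold Tker coreKer chi1 chi2
  by_cases h : x.2 = y.2
  · simp [h, CutoffFun.etad_zero]
  · have hs : x.2 - y.2 ≠ 0 := sub_ne_zero.mpr h
    have hb : bet (x.1 - y.1) ≠ 0 := by linarith [one_le_bet (x.1 - y.1)]
    rw [sinq, if_neg h, mul_comm _ (Complex.exp _), mul_assoc (Complex.exp _), ← Complex.ofReal_mul]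
    congr 2
    have : (2 : ℝ) ^ (-j.1 - j.2) = ((2 : ℝ) ^ j.1)⁻¹ * ((2 : ℝ) ^ j.2)⁻¹ := by
      rw [sub_eq_add_neg, zpow_add₀ two_ne_zero, zpow_neg, zpow_neg]
    rw [this]
    have h1 : (2 : ℝ) ^ j.1 ≠ 0 := by positivity
    have h2 : (2 : ℝ) ^ j.2 ≠ 0 := by positivity
    field_simp

lemma abs_inv_bet_mul_le {t c A : ℝ} (h : |c| ≤ A) : |(bet t)⁻¹ * c| ≤ A := by
  have hb := one_le_bet t
  have : (bet t)⁻¹ ≤ 1 := inv_le_one_of_one_le₀ hb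
  rw [abs_mul, abs_of_nonneg (by positivity)]
  nlinarith [abs_nonneg c]

lemma CutoffFun.abs_scaleSum_le {η₀ : ℝ → ℝ} (h : CutoffFun η₀) (R t : ℝ) :
    |scaleSum η₀ R t| ≤ 1 := by
  unfold scaleSum
  rw [abs_le]
  constructor <;> linarith [(h.mem01 ((2 : ℝ) ^ (-(11 + (numScales R : ℤ))) * t)).1,
    (h.mem01 ((2 : ℝ) ^ (-(11 + (numScales R : ℤ))) * t)).2,
    (h.mem01 ((2 : ℝ) ^ (-11 : ℤ) * t)).1, (h.mem01 ((2 : ℝ) ^ (-11 : ℤ) * t)).2]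

lemma CutoffFun.continuous_scaleSum {η₀ : ℝ → ℝ} (h : CutoffFun η₀) (R : ℝ) :
    Continuous (scaleSum η₀ R) := by
  have := h.smooth.continuous
  unfold scaleSum
  fun_prop

lemma Toper_eq_integral {η₀ : ℝ → ℝ} (h : CutoffFun η₀) (p : ℝ[X]) (γ R : ℝ)
    {f : ℝ × ℝ → ℂ} (hf : Continuous f) (hfc : HasCompactSupport f) (x : ℝ × ℝ) :
    Toper η₀ p γ R f x = ∫ y, coreKer p γ x y *
      (((bet (x.1 - y.1))⁻¹ * scaleSum η₀ R (x.1 - y.1) : ℝ) : ℂ) * f y := by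
  set A : Set ℤ := {j : ℤ | 10 < j ∧ (j : ℝ) ≤ Real.logb 2 R} with hA
  set a : ℤ → ℝ → ℝ := fun j t => A.indicator (fun j => etad η₀ ((2 : ℝ) ^ (-j) * t)) j with ha
  set w : ℤ × ℤ → ℝ × ℝ → ℝ := fun j y =>
    a j.1 (x.1 - y.1) * etad η₀ ((2 : ℝ) ^ (-j.2) * (x.2 - y.2)) with hw
  have ha0 : ∀ j t, 0 ≤ a j t := fun j t => Set.indicator_nonneg (fun _ _ => h.etad_nonneg _) _
  have hw0 : ∀ j y, 0 ≤ w j y := fun j y => mul_nonneg (ha0 _ _) (h.etad_nonneg _)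
  have hη : Continuous (etad η₀) := by
    have := h.smooth.continuous
    unfold etad
    fun_prop
  have hwm : ∀ j, Measurable (w j) := by
    intro j
    have h1 : Continuous (a j.1) := by
      by_cases hj : j.1 ∈ A
      · simp only [ha, Set.indicator_of_mem hj]
        fun_prop
      · simp only [ha, Set.indicator_of_notMem hj]
        fun_prop
    have : Continuous (w j) := by
      simp only [hw]
      fun_prop
    exact this.measurable
  have hwsum : ∀ y : ℝ × ℝ, y.2 ≠ x.2 → HasSum (fun j => w j y) (scaleSum η₀ R (x.1 - y.1)) := by
    intro y hy
    have h1 : HasSum (fun j => a j (x.1 - y.1)) (scaleSum η₀ R (x.1 - y.1)) :=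
      hasSum_scaleSum η₀ R (x.1 - y.1)
    have h2 := h.hasSum_etad (sub_ne_zero.mpr hy.symm)
    have h3 := h1.mul h2 (h1.summable.mul_of_nonneg h2.summable (fun j => ha0 j _)
      fun j => h.etad_nonneg _)
    rwa [mul_one] at h3
  have hae : ∀ᵐ y : ℝ × ℝ, y.2 ≠ x.2 := by
    have h1 : Filter.Tendsto (Prod.snd : ℝ × ℝ → ℝ) (ae volume) (ae volume) := by
      rw [Measure.volume_eq_prod]
      exact Measure.quasiMeasurePreserving_snd.tendsto_ae
    exact h1.eventually (Measure.ae_ne volume x.2)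
  have hcore : Measurable fun y => coreKer p γ x y :=
    (measurable_coreKer p γ).of_uncurry_left
  have hbm : Measurable bet := continuous_bet.measurable
  have hF : ∀ j, ({j : ℤ × ℤ | 10 < j.1 ∧ (j.1 : ℝ) ≤ Real.logb 2 R}.indicator
      (fun j => ∫ y : ℝ × ℝ, Tker η₀ p γ j x y * f y) j) =
      ∫ y : ℝ × ℝ, coreKer p γ x y * (((bet (x.1 - y.1))⁻¹ * w j y : ℝ) : ℂ) * f y := by
    intro j
    by_cases hj : j.1 ∈ A
    · rw [Set.indicator_of_mem (show j ∈ {j : ℤ × ℤ | 10 < j.1 ∧ (j.1 : ℝ) ≤ Real.logb 2 R} from hj)]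
      simp only [Tker_eq, hw, ha, Set.indicator_of_mem hj]
    · rw [Set.indicator_of_notMem (show j ∉ {j : ℤ × ℤ | 10 < j.1 ∧ (j.1 : ℝ) ≤ Real.logb 2 R} from hj)]
      simp [hw, ha, Set.indicator_of_notMem hj]
  unfold Toper
  simp only [hF]
  refine HasSum.tsum_eq ?_
  refine hasSum_integral_of_dominated_convergence
    (fun j y => ‖coreKer p γ x y‖ * ((bet (x.1 - y.1))⁻¹ * w j y) * ‖f y‖) ?_ ?_ ?_ ?_ ?_
  · intro j
    have := hwm j
    have := hf.measurable
    exact Measurable.aestronglyMeasurable (by fun_prop)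
  · intro j
    refine Filter.Eventually.of_forall fun y => ?_
    rw [norm_mul, norm_mul, Complex.norm_real, Real.norm_of_nonneg]
    exact mul_nonneg (inv_nonneg.mpr (by linarith [one_le_bet (x.1 - y.1)])) (hw0 j y)
  · filter_upwards [hae] with y hy
    exact (((hwsum y hy).summable.mul_left _).mul_left _).mul_right _
  · have hi := (integrable_coreKer_mul p γ (m := fun t => (bet t)⁻¹ * scaleSum η₀ R t)
      (hbm.inv.mul (h.continuous_scaleSum R).measurable)
      (fun t => abs_inv_bet_mul_le (h.abs_scaleSum_le R t)) hf hfc x).norm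
    refine hi.congr ?_
    filter_upwards [hae] with y hy
    have hs := hwsum y hy
    have hs0 : 0 ≤ scaleSum η₀ R (x.1 - y.1) := hs.nonneg fun j => hw0 j y
    rw [((((hs.mul_left _).mul_left _).mul_right _)).tsum_eq, norm_mul, norm_mul,
      Complex.norm_real, Real.norm_of_nonneg]
    exact mul_nonneg (inv_nonneg.mpr (by linarith [one_le_bet (x.1 - y.1)])) hs0
  · filter_upwards [hae] with y hy
    exact ((Complex.hasSum_ofReal.mpr ((hwsum y hy).mul_left _)).mul_left _).mul_right _

/-- The weight in the first variable of the kernel of `𝒪^R - 𝒯^R`. -/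
def diffWeight (η₀ : ℝ → ℝ) (R t : ℝ) : ℝ :=
  (bet t)⁻¹ * ((if |t| ≤ R then 1 else 0) - scaleSum η₀ R t)

lemma CutoffFun.abs_diffWeight_le {η₀ : ℝ → ℝ} (h : CutoffFun η₀) (R t : ℝ) :
    |diffWeight η₀ R t| ≤ 2 := by
  refine abs_inv_bet_mul_le ?_
  refine (abs_sub _ _).trans ?_
  have := h.abs_scaleSum_le R t
  split_ifs <;> simp <;> linarith

lemma CutoffFun.measurable_diffWeight {η₀ : ℝ → ℝ} (h : CutoffFun η₀) (R : ℝ) :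
    Measurable (diffWeight η₀ R) := by
  have := continuous_bet.measurable
  have := (h.continuous_scaleSum R).measurable
  have : Measurable fun t : ℝ => if |t| ≤ R then (1 : ℝ) else 0 :=
    Measurable.ite (measurableSet_le (by fun_prop) measurable_const) measurable_const
      measurable_const
  unfold diffWeight
  fun_prop

lemma CutoffFun.abs_diffWeight_le_of_lt {η₀ : ℝ → ℝ} (h : CutoffFun η₀) {R t : ℝ} (hR : 0 < R)
    (ht : 2 ^ 11 < |t|) :
    |diffWeight η₀ R t| ≤ (Set.Icc (-(2 : ℝ) ^ (11 + (numScales R : ℤ)))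
      ((2 : ℝ) ^ (11 + (numScales R : ℤ)))).indicator
        (fun _ => 2 * ((2 : ℝ) ^ (10 + (numScales R : ℤ)))⁻¹) t := by
  set N := numScales R with hN
  have hlt := lt_two_pow_numScales hR
  rw [← hN] at hlt
  have h11 : (2 : ℝ) ^ (11 + (N : ℤ)) = 2 * (2 : ℝ) ^ (10 + (N : ℤ)) := by
    rw [show (11 : ℤ) + N = 1 + (10 + N) by ring, zpow_add₀ two_ne_zero 1, zpow_one]
  set Q : ℝ := (2 : ℝ) ^ (10 + (N : ℤ)) with hQ
  have hQ0 : 0 < Q := by positivity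
  have habs : ∀ j : ℤ, |(2 : ℝ) ^ (-j) * t| = ((2 : ℝ) ^ j)⁻¹ * |t| := fun j => by
    rw [abs_mul, abs_of_pos (by positivity), zpow_neg]
  have hz : η₀ ((2 : ℝ) ^ (-11 : ℤ) * t) = 0 := by
    refine h.eq_zero _ ?_
    rw [habs]
    norm_num at ht ⊢
    linarith
  have hbet : (bet t)⁻¹ ≤ 2 / |t| := by
    rw [← inv_div]
    exact inv_anti₀ (by linarith) (half_abs_le_bet t)
  have hb0 : 0 ≤ (bet t)⁻¹ := inv_nonneg.mpr (by linarith [one_le_bet t])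
  unfold diffWeight scaleSum
  rw [hz, sub_zero, ← hN]
  rcases le_or_gt |t| Q with h1 | h1
  · have hN0 : N ≠ 0 := by
      intro h0
      rw [hQ, h0] at h1
      norm_num at h1 ht
      linarith
    have hle := two_pow_numScales_le hR hN0
    rw [← hN, ← hQ] at hle
    rw [if_pos (h1.trans hle), h.eq_one]
    · simp only [sub_self, mul_zero, abs_zero]
      exact Set.indicator_nonneg (fun _ _ => by positivity) _
    · rw [habs, h11, inv_mul_le_iff₀ (by positivity)]
      linarith
  · rcases le_or_gt |t| ((2 : ℝ) ^ (11 + (N : ℤ))) with h2 | h2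
    · rw [Set.indicator_of_mem (Set.mem_Icc.mpr (abs_le.mp h2)), abs_mul, abs_of_nonneg hb0]
      have h3 : |(if |t| ≤ R then (1 : ℝ) else 0) - η₀ ((2 : ℝ) ^ (-(11 + (N : ℤ))) * t)| ≤ 1 := by
        have := h.mem01 ((2 : ℝ) ^ (-(11 + (N : ℤ))) * t)
        rw [abs_le]
        split_ifs <;> constructor <;> linarith [this.1, this.2]
      have h4 : 2 / |t| ≤ 2 * Q⁻¹ := by
        rw [div_eq_mul_inv]
        gcongr
      calc _ ≤ 2 / |t| * 1 := by gcongr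
        _ ≤ _ := by rwa [mul_one]
    · rw [if_neg (by linarith), h.eq_zero, sub_self, mul_zero, abs_zero]
      · exact Set.indicator_nonneg (fun _ _ => by positivity) _
      · rw [habs, le_inv_mul_iff₀ (by positivity)]
        linarith

lemma CutoffFun.lintegral_diffWeight_le {η₀ : ℝ → ℝ} (h : CutoffFun η₀) {R : ℝ} (hR : 0 < R) :
    ∫⁻ t, ‖diffWeight η₀ R t‖ₑ ≤ ENNReal.ofReal (2 ^ 13 + 8) := by
  set Q : ℝ := (2 : ℝ) ^ (10 + (numScales R : ℤ)) with hQ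
  have hQ0 : 0 < Q := by positivity
  have h11 : (2 : ℝ) ^ (11 + (numScales R : ℤ)) = 2 * Q := by
    rw [hQ, show (11 : ℤ) + numScales R = 1 + (10 + numScales R) by ring,
      zpow_add₀ two_ne_zero 1, zpow_one]
  have hpt : ∀ t, ‖diffWeight η₀ R t‖ₑ ≤
      (Set.Icc (-(2 : ℝ) ^ 11) (2 ^ 11)).indicator (fun _ => ENNReal.ofReal 2) t +
      (Set.Icc (-(2 * Q)) (2 * Q)).indicator (fun _ => ENNReal.ofReal (2 * Q⁻¹)) t := by
    intro t
    rw [← ofReal_norm, Real.norm_eq_abs]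
    by_cases ht : |t| ≤ 2 ^ 11
    · rw [Set.indicator_of_mem (Set.mem_Icc.mpr (abs_le.mp ht))]
      exact (ENNReal.ofReal_le_ofReal (h.abs_diffWeight_le R t)).trans le_self_add
    · refine le_trans ?_ le_add_self
      refine (ENNReal.ofReal_le_ofReal (h.abs_diffWeight_le_of_lt hR (not_le.mp ht))).trans ?_
      rw [h11, ← hQ]
      by_cases h2 : t ∈ Set.Icc (-(2 * Q)) (2 * Q)
      · simp [Set.indicator_of_mem h2]
      · simp [Set.indicator_of_notMem h2]
  refine (lintegral_mono hpt).trans_eq ?_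
  rw [lintegral_add_left (measurable_const.indicator measurableSet_Icc),
    lintegral_indicator_const measurableSet_Icc, lintegral_indicator_const measurableSet_Icc,
    Real.volume_Icc, Real.volume_Icc, ← ENNReal.ofReal_mul (by norm_num),
    ← ENNReal.ofReal_mul (by positivity), ← ENNReal.ofReal_add (by norm_num) (by
      rw [sub_neg_eq_add]; positivity)]
  congr 1
  field_simp
  norm_num

lemma Oop_sub_Toper {η₀ : ℝ → ℝ} (h : CutoffFun η₀) (p : ℝ[X]) (γ R : ℝ)
    {f : ℝ × ℝ → ℂ} (hf : Continuous f) (hfc : HasCompactSupport f) (x : ℝ × ℝ) :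
    Oop p γ R f x - Toper η₀ p γ R f x =
      ∫ y, coreKer p γ x y * (diffWeight η₀ R (x.1 - y.1) : ℂ) * f y := by
  have hbm : Measurable bet := continuous_bet.measurable
  have hite : Measurable fun t : ℝ => if |t| ≤ R then (1 : ℝ) else 0 :=
    Measurable.ite (measurableSet_le (by fun_prop) measurable_const) measurable_const
      measurable_const
  have hO : Oop p γ R f x = ∫ y, coreKer p γ x y *
      (((bet (x.1 - y.1))⁻¹ * (if |x.1 - y.1| ≤ R then 1 else 0) : ℝ) : ℂ) * f y := by
    unfold Oop Oker coreKer
    congr 1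
    ext y
    push_cast
    split_ifs <;> simp
  rw [hO, Toper_eq_integral h p γ R hf hfc x, ← integral_sub]
  · congr 1
    ext y
    unfold diffWeight
    push_cast
    ring
  · exact integrable_coreKer_mul p γ (m := fun t => (bet t)⁻¹ * if |t| ≤ R then 1 else 0)
      (hbm.inv.mul hite) (K := 1)
      (fun t => abs_inv_bet_mul_le (by split_ifs <;> simp)) hf hfc x
  · exact integrable_coreKer_mul p γ (m := fun t => (bet t)⁻¹ * scaleSum η₀ R t)
      (hbm.inv.mul (h.continuous_scaleSum R).measurable)
      (fun t => abs_inv_bet_mul_le (h.abs_scaleSum_le R t)) hf hfc x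

lemma eLpNorm_two_le_of_lintegral {α E F : Type*} [MeasurableSpace α] {μ : Measure α}
    [NormedAddCommGroup E] [NormedAddCommGroup F] {g : α → E} {f : α → F} {C : ENNReal}
    (h : ∫⁻ a, ‖g a‖ₑ ^ 2 ∂μ ≤ C ^ 2 * ∫⁻ a, ‖f a‖ₑ ^ 2 ∂μ) :
    eLpNorm g 2 μ ≤ C * eLpNorm f 2 μ := by
  have e : ∀ I : ENNReal, (I ^ (2 : ℝ)) ^ (1 / 2 : ℝ) = I := fun I => by
    rw [← ENNReal.rpow_mul]
    norm_num
  rw [eLpNorm_eq_lintegral_rpow_enorm_toReal two_ne_zero ENNReal.ofNat_ne_top,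
    eLpNorm_eq_lintegral_rpow_enorm_toReal two_ne_zero ENNReal.ofNat_ne_top]
  simp only [ENNReal.toReal_ofNat]
  have h' := ENNReal.rpow_le_rpow h (show (0 : ℝ) ≤ 1 / 2 by norm_num)
  rw [ENNReal.mul_rpow_of_nonneg _ _ (by norm_num)] at h'
  simp only [← ENNReal.rpow_two, e] at h'
  exact h'

theorem stmt6 (n : ℕ) (hn : 1 ≤ n) (Γ : ℝ) (hΓ : 1 / 2 < Γ)
    (η₀ : ℝ → ℝ) (hη₀ : CutoffFun η₀) :
    ∃ C > 0,
      ∀ p : Polynomial ℝ, p.natDegree ≤ n →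
      ∀ γ : ℝ, min 1 ((n : ℝ) / 2) ≤ |γ| → |γ| ≤ Γ →
      ∀ R : ℝ, 100 ≤ R →
      ∀ f : ℝ × ℝ → ℂ, ContDiff ℝ (⊤ : ℕ∞) f → HasCompactSupport f →
        eLpNorm (fun x => Oop p γ R f x - Toper η₀ p γ R f x) 2 volume ≤
          ENNReal.ofReal C * eLpNorm f 2 volume := by
  refine ⟨(2 ^ 13 + 8) * (34 * Real.pi), by positivity, ?_⟩
  intro p _ γ _ _ R hR f hf hfc
  refine eLpNorm_two_le_of_lintegral ?_
  simp only [Oop_sub_Toper hη₀ p γ R hf.continuous hfc]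
  refine (lintegral_coreKer_conv_sq_le p γ (hη₀.measurable_diffWeight R)
    (hη₀.abs_diffWeight_le R) (hη₀.lintegral_diffWeight_le (by linarith)) hf.continuous
    hfc).trans_eq ?_
  rw [← ENNReal.ofReal_pow (by positivity), ← ENNReal.ofReal_pow (by positivity),
    ← ENNReal.ofReal_mul (by positivity), mul_pow (2 ^ 13 + 8 : ℝ)]

end
end
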